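/- If Γ is a graph of girth at least 5 on 32 vertices with 85 edges, then Γ has an embedded S_{6,[5,4,4,4,4,4]} star; that is, Γ has a vertex of degree 6 with one neighbour of degree at least 6 and five neighbours of degree at least 5. -/

import Mathlib

open SimpleGraph

/-- `Γ` has girth at least 5: every cycle has length at least 5. -/
def GirthAtLeast5 {V : Type*} (G : SimpleGraph V) : Prop :=
  ∀ ⦃u : V⦄ (w : G.Walk u u), w.IsCycle → 5 ≤ w.length

/-- `G` has an embedded `S_{D,[e 0, …, e (D-1)]}` star: a vertex `x` of degree `D`
whose `D` neighbours can be enumerated as `y 0, …, y (D-1)` with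
`deg (y i) ≥ e i + 1` for each `i`. -/
def HasEmbeddedStar {V : Type*} [Fintype V] (G : SimpleGraph V) [DecidableRel G.Adj]
    (D : ℕ) (e : Fin D → ℕ) : Prop :=
  ∃ (x : V) (y : Fin D → V), G.degree x = D ∧ Function.Injective y ∧
    (∀ i, G.Adj x (y i)) ∧ ∀ i, e i + 1 ≤ G.degree (y i)

namespace Q19
open scoped Classical
open Finset

structure Good {V : Type} (r : V → V → Prop) : Prop where
  sy : ∀ {a b}, r a b → r b a
  ir : ∀ {a}, ¬ r a a
  c3 : ∀ {a b c}, r a b → r b c → r a c → False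
  c4 : ∀ {a b c d}, r b a → r b c → r d a → r d c → a ≠ c → b = d

noncomputable def nb {V : Type} (r : V → V → Prop) (S : Finset V) (v : V) : Finset V :=
  S.filter (fun w => r v w)
noncomputable def dg {V : Type} (r : V → V → Prop) (S : Finset V) (v : V) : ℕ := (nb r S v).card
noncomputable def E2 {V : Type} (r : V → V → Prop) (S : Finset V) : ℕ := ∑ v ∈ S, dg r S v
noncomputable def ms {V : Type} (r : V → V → Prop) (S X : Finset V) (v : V) : Finset V :=
  X.filter (fun x => x ≠ v ∧ ¬ r v x ∧ ∀ w ∈ S, r v w → ¬ r w x)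
def bd (V : Type) (n k : ℕ) : Prop :=
  ∀ (r : V → V → Prop), Good r → ∀ S : Finset V, S.card = n → E2 r S ≤ 2 * k

variable {V : Type} {r : V → V → Prop}

lemma mem_nb {S : Finset V} {v w : V} : w ∈ nb r S v ↔ w ∈ S ∧ r v w := by simp [nb]
lemma mem_ms {S X : Finset V} {v x : V} : x ∈ ms r S X v ↔
    x ∈ X ∧ x ≠ v ∧ ¬ r v x ∧ ∀ w ∈ S, r v w → ¬ r w x := by simp [ms]
lemma Good.ne (h : Good r) {a b : V} (hab : r a b) : a ≠ b := by
  rintro rfl; exact h.ir hab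

lemma dg_eq_sum (S : Finset V) (v : V) : dg r S v = ∑ w ∈ S, if r v w then 1 else 0 := by
  simp [dg, nb]
lemma sum_swap (h : Good r) (X S : Finset V) (f : V → ℕ) :
    ∑ v ∈ X, ∑ w ∈ nb r S v, f w = ∑ w ∈ S, dg r X w * f w := by
  simp only [nb, sum_filter]
  rw [sum_comm]
  refine sum_congr rfl fun w _ => ?_
  rw [dg_eq_sum, sum_mul]
  refine sum_congr rfl fun v _ => ?_
  by_cases hh : r w v
  · simp [hh, h.sy hh]
  · have : ¬ r v w := fun h' => hh (h.sy h')
    simp [hh, this]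
lemma sum_dg_comm (h : Good r) (X Y : Finset V) :
    ∑ v ∈ X, dg r Y v = ∑ w ∈ Y, dg r X w := by
  have := sum_swap h X Y (fun _ => 1)
  simpa [dg] using this
lemma dg_union {X Y : Finset V} (hd : Disjoint X Y) (v : V) :
    dg r (X ∪ Y) v = dg r X v + dg r Y v := by
  simp only [dg_eq_sum]; rw [sum_union hd]
lemma dg_sdiff {D S : Finset V} (hD : D ⊆ S) (v : V) :
    dg r (S \ D) v + dg r D v = dg r S v := by
  rw [← dg_union sdiff_disjoint, sdiff_union_of_subset hD]
lemma dg_mono {X Y : Finset V} (h : X ⊆ Y) (v : V) : dg r X v ≤ dg r Y v :=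
  card_le_card (filter_subset_filter _ h)
lemma dg_pos {X : Finset V} {v : V} : 0 < dg r X v ↔ ∃ w ∈ X, r v w := by
  simp [dg, card_pos, Finset.Nonempty, mem_nb]
lemma dg_le_card {X : Finset V} {v : V} : dg r X v ≤ X.card := card_le_card (filter_subset _ _)

lemma E2_del (h : Good r) {D S : Finset V} (hD : D ⊆ S) :
    E2 r (S \ D) + 2 * ∑ v ∈ D, dg r S v = E2 r S + E2 r D := by
  have e1 : E2 r S = ∑ v ∈ S \ D, dg r S v + ∑ v ∈ D, dg r S v := by
    unfold E2; rw [sum_sdiff hD]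
  have e2 : ∑ v ∈ S \ D, dg r S v = E2 r (S \ D) + ∑ v ∈ S \ D, dg r D v := by
    unfold E2; rw [← sum_add_distrib]; exact sum_congr rfl fun v _ => (dg_sdiff hD v).symm
  have e3 : ∑ v ∈ D, dg r S v = ∑ v ∈ D, dg r (S \ D) v + E2 r D := by
    unfold E2; rw [← sum_add_distrib]; exact sum_congr rfl fun v _ => (dg_sdiff hD v).symm
  have e4 := sum_dg_comm h (S \ D) D
  omega

lemma E2_insert (h : Good r) {D : Finset V} {x : V} (hx : x ∉ D) :
    E2 r (insert x D) = E2 r D + 2 * dg r D x := by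
  have := E2_del h (D := {x}) (S := insert x D) (by simp)
  have e1 : insert x D \ {x} = D := by simp [insert_sdiff_of_mem, hx]
  have e2 : E2 r {x} = 0 := by simp [E2, dg, nb, h.ir]
  have e3 : dg r (insert x D) x = dg r D x := by
    simp [dg, nb, filter_insert, h.ir]
  simp [e1, e2, e3] at this
  omega
lemma E2_even (h : Good r) (S : Finset V) : ∃ e, E2 r S = 2 * e := by
  induction S using Finset.induction_on with
  | empty => exact ⟨0, by simp [E2]⟩
  | insert x D hx ih =>
    obtain ⟨e, he⟩ := ih
    exact ⟨e + dg r D x, by rw [E2_insert h hx, he]; ring⟩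

lemma bd_del (h : Good r) {n k : ℕ} (hb : bd V n k) {D S : Finset V} (hD : D ⊆ S)
    (hc : S.card = n + D.card) : E2 r S + E2 r D ≤ 2 * k + 2 * ∑ v ∈ D, dg r S v := by
  have := hb r h (S \ D) (by rw [card_sdiff_of_subset hD]; omega)
  have := E2_del h hD
  omega
lemma bd_min (h : Good r) {n k : ℕ} (hb : bd V n k) {S : Finset V} 
    (hc : S.card = n + 1) {v : V} (hv : v ∈ S) : E2 r S ≤ 2 * k + 2 * dg r S v := by
  have := bd_del h hb (D := {v}) (S := S) (by simpa using hv) (by simpa using hc)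
  simp at this; omega

lemma bd_exact {n k : ℕ} (H : ∀ (r : V → V → Prop), Good r → ∀ S : Finset V, S.card = n →
    E2 r S = 2 * (k + 1) → False) : bd V n k := by
  have key : ∀ m, ∀ (r : V → V → Prop), Good r → ∀ S : Finset V, S.card = n →
      E2 r S = 2 * (k + 1 + m) → False := by
    intro m
    induction m with
    | zero => exact H
    | succ m ih =>
      intro r h S hS hE
      have hpos : 0 < ∑ v ∈ S, dg r S v := by have : E2 r S = ∑ v ∈ S, dg r S v := rfl; omega
      obtain ⟨a, ha, hda⟩ := exists_ne_zero_of_sum_ne_zero hpos.ne'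
      obtain ⟨b, hb, hab⟩ := dg_pos.1 (Nat.pos_of_ne_zero hda)
      have hne := h.ne hab
      let r' : V → V → Prop := fun x y => r x y ∧ ¬ (x = a ∧ y = b) ∧ ¬ (x = b ∧ y = a)
      have h' : Good r' := by
        refine ⟨?_, ?_, ?_, ?_⟩
        · rintro x y ⟨h1, h2, h3⟩
          exact ⟨h.sy h1, fun hh => h3 ⟨hh.2, hh.1⟩, fun hh => h2 ⟨hh.2, hh.1⟩⟩
        · rintro x ⟨h1, _⟩; exact h.ir h1
        · rintro x y z ⟨h1, _⟩ ⟨h2, _⟩ ⟨h3, _⟩; exact h.c3 h1 h2 h3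
        · rintro x y z w ⟨h1, _⟩ ⟨h2, _⟩ ⟨h3, _⟩ ⟨h4, _⟩ h5; exact h.c4 h1 h2 h3 h4 h5
      refine ih r' h' S hS ?_
      have : E2 r S = E2 r' S + 2 := by
        have key : ∀ x ∈ S, ∀ y ∈ S, (if r x y then 1 else 0) = (if r' x y then 1 else 0) +
          ((if x = a then if y = b then 1 else 0 else 0) +
            (if x = b then if y = a then 1 else 0 else 0)) := by
          intro x _ y _
          by_cases h1 : r x y
          · by_cases h2 : x = a ∧ y = b
            · obtain ⟨rfl, rfl⟩ := h2
              simp [r', hab, hne]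
            · by_cases h3 : x = b ∧ y = a
              · obtain ⟨rfl, rfl⟩ := h3
                simp [r', h.sy hab, hne.symm]
              · have : r' x y := ⟨h1, h2, h3⟩
                rw [if_pos h1, if_pos this]
                split_ifs <;> simp_all
          · have h2 : ¬ (x = a ∧ y = b) := by rintro ⟨rfl, rfl⟩; exact h1 hab
            have h3 : ¬ (x = b ∧ y = a) := by rintro ⟨rfl, rfl⟩; exact h1 (h.sy hab)
            have : ¬ r' x y := fun h' => h1 h'.1
            rw [if_neg h1, if_neg this]
            split_ifs <;> simp_all
        unfold E2
        simp only [dg_eq_sum]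
        rw [sum_congr rfl fun x hx => sum_congr rfl fun y hy => key x hx y hy]
        simp only [sum_add_distrib]
        have q1 : ∀ c d : V, c ∈ S → d ∈ S → ∑ x ∈ S, ∑ y ∈ S, (if x = c then if y = d then 1 else 0 else 0) = 1 := by
          intro c d hc hd
          rw [sum_eq_single c]
          · simp [hd]
          · intro x _ hx; simp [hx]
          · intro hh; exact absurd hc hh
        rw [q1 a b ha hb, q1 b a hb ha]
        congr!
      omega
  intro r h S hS
  obtain ⟨e, he⟩ := E2_even h S
  by_contra hc
  exact key (e - (k + 1)) r h S hS (by omega)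

/-- partition identity, raw form -/
lemma ident0 (h : Good r) (S X : Finset V) (_hX : X ⊆ S) (v : V) :
    (X.erase v).card = dg r X v + ∑ w ∈ nb r S v, ((nb r X w).erase v).card
      + (ms r S X v).card := by
  have e : X.erase v = (nb r X v ∪ (nb r S v).biUnion (fun w => (nb r X w).erase v)) ∪ ms r S X v := by
    ext x
    simp only [mem_erase, mem_union, mem_nb, mem_biUnion, mem_ms]
    constructor
    · rintro ⟨h1, h2⟩
      by_cases h3 : r v x
      · exact Or.inl (Or.inl ⟨h2, h3⟩)
      · by_cases h4 : ∃ w ∈ S, r v w ∧ r w x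
        · obtain ⟨w, a, b, c⟩ := h4
          exact Or.inl (Or.inr ⟨w, ⟨a, b⟩, h1, h2, c⟩)
        · push Not at h4
          exact Or.inr ⟨h2, h1, h3, h4⟩
    · rintro ((⟨h1, h2⟩ | ⟨w, _, h1, h2, _⟩) | ⟨h1, h2, _⟩)
      · exact ⟨(h.ne h2).symm, h1⟩
      · exact ⟨h1, h2⟩
      · exact ⟨h2, h1⟩
  rw [e, card_union_of_disjoint, card_union_of_disjoint, card_biUnion]
  · rfl
  · intro w hw w' hw' hne
    rw [Function.onFun, Finset.disjoint_left]
    intro x hx hx'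
    simp only [mem_coe, mem_erase, mem_nb] at hx hx' hw hw'
    exact hne (h.c4 (h.sy hw.2) hx.2.2 (h.sy hw'.2) hx'.2.2 (Ne.symm hx.1))
  · rw [Finset.disjoint_left]
    intro x hx hx'
    simp only [mem_biUnion, mem_erase, mem_nb] at hx hx'
    obtain ⟨w, ⟨_, hw⟩, _, _, hw2⟩ := hx'
    exact h.c3 hw hw2 hx.2
  · rw [Finset.disjoint_left]
    intro x hx hx'
    simp only [mem_union, mem_biUnion, mem_erase, mem_nb, mem_ms] at hx hx'
    rcases hx with hx | ⟨w, ⟨hw0, hw⟩, _, _, hw2⟩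
    · exact hx'.2.2.1 hx.2
    · exact hx'.2.2.2 w hw0 hw hw2

lemma ident_out (h : Good r) {S X : Finset V} (hX : X ⊆ S) {v : V} (hv : v ∉ X) :
    X.card = dg r X v + ∑ w ∈ nb r S v, dg r X w + (ms r S X v).card := by
  have := ident0 h S X hX v
  rw [erase_eq_of_notMem hv] at this
  rw [this]
  congr 2
  refine sum_congr rfl fun w _ => ?_
  rw [erase_eq_of_notMem]; rfl
  simp [mem_nb, hv]
lemma ident_in (h : Good r) {S X : Finset V} (hX : X ⊆ S) {v : V} (hv : v ∈ X) :
    X.card + dg r S v = 1 + dg r X v + ∑ w ∈ nb r S v, dg r X w + (ms r S X v).card := by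
  have := ident0 h S X hX v
  rw [card_erase_of_mem hv] at this
  have e : ∑ w ∈ nb r S v, dg r X w = ∑ w ∈ nb r S v, ((nb r X w).erase v).card + dg r S v := by
    have : dg r S v = ∑ w ∈ nb r S v, 1 := by simp [dg]
    rw [this, ← sum_add_distrib]
    refine sum_congr rfl fun w hw => ?_
    have : v ∈ nb r X w := mem_nb.2 ⟨hv, h.sy (mem_nb.1 hw).2⟩
    rw [card_erase_of_mem this]
    have := card_pos.2 ⟨v, this⟩
    unfold dg; omega
  have := card_pos.2 ⟨v, hv⟩
  omega
lemma ident_S (h : Good r) {S : Finset V} {v : V} (hv : v ∈ S) :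
    S.card = 1 + ∑ w ∈ nb r S v, dg r S w + (ms r S S v).card := by
  have := ident_in h (subset_refl S) hv
  omega
lemma ms_symm (h : Good r) {S X Y : Finset V} {v x : V} (hx : x ∈ ms r S X v) (hv : v ∈ Y) :
    v ∈ ms r S Y x := by
  rw [mem_ms] at *
  exact ⟨hv, hx.2.1.symm, fun a => hx.2.2.1 (h.sy a), fun w hw a b => hx.2.2.2 w hw (h.sy b) (h.sy a)⟩
lemma ms_mono {S X Y : Finset V} (hXY : X ⊆ Y) (v : V) : ms r S X v ⊆ ms r S Y v :=
  filter_subset_filter _ hXY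
/-- with a lower bound on the degrees -/
lemma ball_ge (h : Good r) {S : Finset V} {v : V} (hv : v ∈ S) {k : ℕ}
    (hk : ∀ w ∈ S, k ≤ dg r S w) : 1 + dg r S v * k ≤ S.card := by
  have := ident_S h hv
  have h2 : ∑ w ∈ nb r S v, k ≤ ∑ w ∈ nb r S v, dg r S w :=
    sum_le_sum fun w hw => hk w (mem_nb.1 hw).1
  simp at h2
  have : (nb r S v).card = dg r S v := rfl
  rw [this] at h2
  omega
/-- sum of squares bound -/
lemma sum_sq_le (h : Good r) (S : Finset V) : S.card + ∑ v ∈ S, dg r S v * dg r S v ≤ S.card * S.card := by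
  have : ∑ v ∈ S, (1 + ∑ w ∈ nb r S v, dg r S w) ≤ ∑ v ∈ S, S.card :=
    sum_le_sum fun v hv => by have := ident_S h hv; omega
  rw [sum_add_distrib, sum_swap h] at this
  simpa using this
lemma convex (N : Finset V) (f : V → ℕ) (a : ℕ) :
    (2 * a + 1) * ∑ v ∈ N, f v ≤ ∑ v ∈ N, f v * f v + a * (a + 1) * N.card := by
  have : ∑ v ∈ N, (2 * a + 1) * f v ≤ ∑ v ∈ N, (f v * f v + a * (a + 1)) := by
    refine sum_le_sum fun v _ => ?_
    rcases le_or_gt (f v) a with hh | hh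
    · obtain ⟨c, rfl⟩ := Nat.exists_eq_add_of_le hh
      nlinarith
    · obtain ⟨c, hc⟩ := Nat.exists_eq_add_of_lt hh
      rw [hc]; nlinarith
  rw [← mul_sum, sum_add_distrib] at this
  simpa [mul_comm] using this
end Q19

namespace Q19
open scoped Classical
open Finset
variable {V : Type} {r : V → V → Prop}

lemma ident_sum (h : Good r) {S X : Finset V} (hX : X ⊆ S) :
    X.card * X.card + ∑ v ∈ X, dg r S v = X.card + ∑ v ∈ X, dg r X v
      + ∑ w ∈ S, dg r X w * dg r X w + ∑ v ∈ X, (ms r S X v).card := by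
  have e : ∑ v ∈ X, (X.card + dg r S v) = ∑ v ∈ X, (1 + dg r X v + ∑ w ∈ nb r S v, dg r X w + (ms r S X v).card) :=
    sum_congr rfl fun v hv => ident_in h hX hv
  simp only [sum_add_distrib, sum_swap h] at e
  simpa using e

lemma dist2 {S X : Finset V} {v x : V} (hm : ms r S X v = ∅) (hx : x ∈ X) (hne : x ≠ v) :
    r v x ∨ ∃ w ∈ S, r v w ∧ r w x := by
  by_contra hc
  push Not at hc
  have : x ∈ ms r S X v := mem_ms.2 ⟨hx, hne, hc.1, fun w hw => hc.2 w hw⟩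
  simp [hm] at this
lemma dist2' {S X : Finset V} {v x : V} (hm : (ms r S X v).card = 0) (hx : x ∈ X) (hne : x ≠ v) :
    r v x ∨ ∃ w ∈ S, r v w ∧ r w x := dist2 (card_eq_zero.1 hm) hx hne

lemma bd_easy {n k k' : ℕ} (hb : bd V n k') (δ D : ℕ) (h1 : k' + δ = k + 1)
    (h2 : (n + 1) * D < 2 * (k + 1)) (h3 : n < (D + 1) * δ) : bd V (n + 1) k := by
  apply bd_exact
  intro r h S hS hE
  have hd : ∀ w ∈ S, δ ≤ dg r S w := by
    intro w hw
    have := bd_min h hb hS hw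
    omega
  have : ∃ v ∈ S, D < dg r S v := by
    by_contra hc
    push Not at hc
    have : E2 r S ≤ ∑ v ∈ S, D := sum_le_sum hc
    simp [hS] at this
    omega
  obtain ⟨v, hv, hD⟩ := this
  have := ball_ge h hv hd
  have : (D + 1) * δ ≤ dg r S v * δ := Nat.mul_le_mul_right _ hD
  omega

structure Two (r : V → V → Prop) (S T R : Finset V) (a : ℕ) : Prop where
  Ts : T ⊆ S
  Rs : R ⊆ S
  dj : ∀ {x}, x ∈ T → x ∈ R → False
  un : ∀ {x}, x ∈ S → x ∈ T ∨ x ∈ R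
  dT : ∀ {x}, x ∈ T → dg r S x = a + 1
  dR : ∀ {x}, x ∈ R → dg r S x = a
  cd : T.card + R.card = S.card
  cT : E2 r S = a * S.card + T.card
  ds : ∀ x, dg r S x = dg r T x + dg r R x
  sm : ∀ (x : V) (f : V → ℕ), ∑ w ∈ nb r S x, f w = ∑ w ∈ nb r T x, f w + ∑ w ∈ nb r R x, f w
  ss : ∀ (f : V → ℕ), ∑ w ∈ S, f w = ∑ w ∈ T, f w + ∑ w ∈ R, f w
  eT : ∀ {x}, x ∈ T → S.card = 1 + (a * (a + 1) + dg r T x) + (ms r S S x).card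
  eR : ∀ {x}, x ∈ R → S.card = 1 + (a * a + dg r T x) + (ms r S S x).card
  iT : ∀ {x}, x ∈ T → T.card + a = dg r T x + (∑ w ∈ nb r T x, dg r T w + ∑ w ∈ nb r R x, dg r T w) + (ms r S T x).card
  iR : ∀ {x}, x ∈ R → T.card = dg r T x + (∑ w ∈ nb r T x, dg r T w + ∑ w ∈ nb r R x, dg r T w) + (ms r S T x).card
  sc : ∑ w ∈ R, dg r T w + ∑ w ∈ T, dg r T w = (a + 1) * T.card
  sq : T.card * T.card + a * T.card = ∑ v ∈ T, dg r T v
      + (∑ w ∈ T, dg r T w * dg r T w + ∑ w ∈ R, dg r T w * dg r T w) + ∑ v ∈ T, (ms r S T v).card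

lemma two_split (h : Good r) {S : Finset V} {a : ℕ} (hd : ∀ v ∈ S, a ≤ dg r S v ∧ dg r S v ≤ a + 1) :
    ∃ T R, Two r S T R a := by
  set T := S.filter (fun v => dg r S v = a + 1) with hT
  set R := S.filter (fun v => ¬ dg r S v = a + 1) with hR
  have Ts : T ⊆ S := filter_subset _ _
  have Rs : R ⊆ S := filter_subset _ _
  have dj : Disjoint T R := disjoint_filter_filter_not _ _ _
  have un : T ∪ R = S := filter_union_filter_not_eq _ _
  have dT : ∀ {x}, x ∈ T → dg r S x = a + 1 := by intro x hx; simp [hT] at hx; exact hx.2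
  have dR : ∀ {x}, x ∈ R → dg r S x = a := by
    intro x hx; simp [hR] at hx; have := hd x hx.1; omega
  have cd : T.card + R.card = S.card := by rw [← un, card_union_of_disjoint dj]
  have ss : ∀ (f : V → ℕ), ∑ w ∈ S, f w = ∑ w ∈ T, f w + ∑ w ∈ R, f w := by
    intro f; rw [← un, sum_union dj]
  have sm : ∀ (x : V) (f : V → ℕ), ∑ w ∈ nb r S x, f w = ∑ w ∈ nb r T x, f w + ∑ w ∈ nb r R x, f w := by
    intro x f; simp only [nb, sum_filter]; rw [ss]
  have ds : ∀ x, dg r S x = dg r T x + dg r R x := by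
    intro x; rw [← dg_union dj, un]
  have sdT : ∑ w ∈ T, dg r S w = (a + 1) * T.card := by
    rw [sum_congr rfl fun x hx => dT hx]; simp [mul_comm]
  have sdR : ∑ w ∈ R, dg r S w = a * R.card := by
    rw [sum_congr rfl fun x hx => dR hx]; simp [mul_comm]
  have sdeg : ∀ x, ∑ w ∈ nb r S x, dg r S w = a * dg r S x + dg r T x := by
    intro x
    rw [sm, sum_congr rfl fun w hw => dT (mem_nb.1 hw).1, sum_congr (s₁ := nb r R x) rfl fun w hw => dR (mem_nb.1 hw).1, ds]
    simp only [sum_const, smul_eq_mul]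
    change dg r T x * _ + dg r R x * _ = _
    ring
  refine ⟨T, R, Ts, Rs, fun hx hy => Finset.disjoint_left.1 dj hx hy, fun {x} hx => ?_, dT, dR, cd, ?_, ds, sm, ss, ?_, ?_, ?_, ?_, ?_, ?_⟩
  · rw [← un] at hx; exact mem_union.1 hx
  · unfold E2; rw [ss, sdT, sdR, ← cd]; ring
  · intro x hx
    have := ident_S h (Ts hx)
    rw [sdeg, dT hx] at this; exact this
  · intro x hx
    have := ident_S h (Rs hx)
    rw [sdeg, dR hx] at this; exact this
  · intro x hx
    have := ident_in h Ts hx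
    rw [sm, dT hx] at this; omega
  · intro x hx
    have := ident_out h Ts (fun hh => Finset.disjoint_left.1 dj hh hx)
    rw [sm] at this; omega
  · have := sum_dg_comm h R T
    have e : ∑ w ∈ T, dg r S w = ∑ w ∈ T, dg r T w + ∑ w ∈ T, dg r R w := by
      rw [← sum_add_distrib]; exact sum_congr rfl fun x _ => ds x
    omega
  · have := ident_sum h Ts
    rw [sdT, ss] at this
    have e2 : (a + 1) * T.card = a * T.card + T.card := by ring
    omega

lemma bd10 : bd V 10 15 := by
  apply bd_exact
  intro r h S hS hE
  have h1 := sum_sq_le h S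
  have h2 := convex S (dg r S) 3
  change _ * E2 r S ≤ _ at h2
  rw [hS] at h1 h2; omega

lemma removed_miss (h : Good r) {S : Finset V} {v x y : V} (hx : r v x) (hy : r v y)
    (hv : v ∉ S) (hyS : y ∈ S) (hne : x ≠ y) : y ∈ ms r S S x := by
  refine mem_ms.2 ⟨hyS, hne.symm, fun hh => h.c3 hx hh hy, fun w hw h1 h2 => ?_⟩
  have := h.c4 hx hy (h.sy h1) h2 hne
  exact hv (this ▸ hw)

lemma E2_erase (h : Good r) {S : Finset V} {v : V} (hv : v ∈ S) :
    E2 r (S.erase v) + 2 * dg r S v = E2 r S := by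
  have := E2_insert h (D := S.erase v) (x := v) (by simp)
  rw [insert_erase hv] at this
  have e3 : dg r (S.erase v) v = dg r S v := by
    unfold dg; congr 1; ext x; simp [mem_nb]; intro hx _; rintro rfl; exact h.ir hx
  omega
lemma nb_erase_ne (h : Good r) {S : Finset V} {v x : V} (hx : x ∈ nb r S v) : x ∈ S.erase v := by
  rw [mem_nb] at hx
  exact mem_erase.2 ⟨(h.ne hx.2).symm, hx.1⟩

lemma bd11 : bd V 11 16 := by
  apply bd_exact
  intro r h S hS hE
  have hd : ∀ w ∈ S, 3 ≤ dg r S w := by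
    intro w hw
    have := bd_min h bd10 hS hw
    by_contra hc
    have hw2 : dg r S w = 2 := by omega
    have hE' := E2_erase h hw
    have hc' : (S.erase w).card = 10 := by rw [card_erase_of_mem hw, hS]
    have h1 := ident_sum h (subset_refl (S.erase w))
    have h2 := convex (S.erase w) (dg r (S.erase w)) 3
    change _ * E2 r (S.erase w) ≤ _ at h2
    rw [hc'] at h1 h2
    have : ∑ v ∈ S.erase w, (ms r (S.erase w) (S.erase w) v).card = 0 := by omega
    rw [sum_eq_zero_iff] at this
    obtain ⟨x, y, hne, hxy⟩ := card_eq_two.1 hw2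
    have hx : x ∈ nb r S w := by rw [hxy]; simp
    have hy : y ∈ nb r S w := by rw [hxy]; simp
    have := this x (nb_erase_ne h hx)
    rw [card_eq_zero] at this
    have h3 := removed_miss h (mem_nb.1 hx).2 (mem_nb.1 hy).2 (notMem_erase w S) (nb_erase_ne h hy) hne
    rw [this] at h3
    simp at h3
  have hu : ∀ w ∈ S, dg r S w ≤ 3 := by
    intro w hw
    have := ball_ge h hw hd
    omega
  have : E2 r S ≤ ∑ v ∈ S, 3 := sum_le_sum hu
  simp [hS] at this
  omega

lemma bd12 : bd V 12 18 := bd_easy bd11 3 3 (by norm_num) (by norm_num) (by norm_num)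
lemma bd13 : bd V 13 21 := bd_easy bd12 4 3 (by norm_num) (by norm_num) (by norm_num)

lemma sum_eq_const_of_le {N : Finset V} {f : V → ℕ} {c : ℕ} (h1 : ∀ v ∈ N, f v ≤ c)
    (h2 : c * N.card ≤ ∑ v ∈ N, f v) : ∀ v ∈ N, f v = c := by
  by_contra hc
  push Not at hc
  obtain ⟨v, hv, hne⟩ := hc
  have : ∑ v ∈ N, f v < ∑ v ∈ N, c := sum_lt_sum h1 ⟨v, hv, by have := h1 v hv; omega⟩
  simp [mul_comm] at this
  omega
lemma convex_eq {N : Finset V} {f : V → ℕ} {a : ℕ} 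
    (he : ∑ v ∈ N, f v * f v + a * (a + 1) * N.card ≤ (2 * a + 1) * ∑ v ∈ N, f v) :
    ∀ v ∈ N, f v = a ∨ f v = a + 1 := by
  by_contra hc
  push Not at hc
  obtain ⟨v, hv, h1, h2⟩ := hc
  have h3 := convex (N.erase v) f a
  rw [← add_sum_erase _ _ hv] at he
  rw [← add_sum_erase _ f hv] at he
  rw [card_erase_of_mem hv] at h3
  have := card_pos.2 ⟨v, hv⟩
  obtain ⟨m, hm⟩ : ∃ m, N.card = m + 1 := ⟨N.card - 1, by omega⟩
  rw [hm] at he h3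
  simp only [Nat.add_sub_cancel] at h3
  have h4 : f v * f v + a * (a + 1) ≤ (2 * a + 1) * f v := by nlinarith
  rcases le_or_gt (f v) a with hh | hh
  · obtain ⟨c, hc⟩ := Nat.exists_eq_add_of_lt (show f v < a by omega)
    rw [hc] at h4; nlinarith
  · obtain ⟨c, hc⟩ := Nat.exists_eq_add_of_lt (show a + 1 < f v by omega)
    rw [hc] at h4; nlinarith

lemma sum_sq_of_le_one {N : Finset V} {f : V → ℕ} (h1 : ∀ v ∈ N, f v ≤ 1) :
    ∑ v ∈ N, f v * f v = ∑ v ∈ N, f v := by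
  refine sum_congr rfl fun v hv => ?_
  have := h1 v hv
  interval_cases f v <;> rfl
lemma dg_one {X : Finset V} {v : V} (hd : dg r X v = 1) : ∃ w ∈ X, r v w ∧ ∀ x ∈ X, r v x → x = w := by
  obtain ⟨w, hw⟩ := card_eq_one.1 hd
  have h1 : ∀ x, x ∈ nb r X v ↔ x = w := by rw [hw]; simp
  simp only [mem_nb] at h1
  exact ⟨w, ((h1 w).2 rfl).1, ((h1 w).2 rfl).2, fun x hx hr => (h1 x).1 ⟨hx, hr⟩⟩
lemma dg_le_one {X : Finset V} {v : V} (hd : dg r X v ≤ 1) {x y : V} (hx : x ∈ X) (hy : y ∈ X)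
    (h1 : r v x) (h2 : r v y) : x = y :=
  card_le_one.1 hd x (mem_nb.2 ⟨hx, h1⟩) y (mem_nb.2 ⟨hy, h2⟩)
lemma dg_two {X : Finset V} {v : V} (hd : dg r X v = 2) : ∃ w ∈ X, ∃ w' ∈ X, w ≠ w' ∧ r v w ∧ r v w' ∧
    (∀ x ∈ X, r v x → x = w ∨ x = w') ∧ nb r X v = {w, w'} := by
  obtain ⟨w, w', hne, hw⟩ := card_eq_two.1 hd
  have h1 : ∀ x, x ∈ nb r X v ↔ x = w ∨ x = w' := by rw [hw]; simp
  simp only [mem_nb] at h1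
  exact ⟨w, ((h1 w).2 (by simp)).1, w', ((h1 w').2 (by simp)).1, hne, ((h1 w).2 (by simp)).2, ((h1 w').2 (by simp)).2, fun x hx hr => (h1 x).1 ⟨hx, hr⟩, hw⟩
lemma nb_sum_const {X : Finset V} {v : V} {f : V → ℕ} {c : ℕ} (hf : ∀ w ∈ X, r v w → f w = c) :
    ∑ w ∈ nb r X v, f w = c * dg r X v := by
  rw [sum_congr rfl fun w hw => hf w (mem_nb.1 hw).1 (mem_nb.1 hw).2]
  simp [dg, mul_comm]
lemma miss_zero_symm (h : Good r) {S X T : Finset V} (_hT : T ⊆ S) (hX : X ⊆ S)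
    (hz : ∀ t ∈ T, (ms r S S t).card = 0) {v : V} (hv : v ∈ X) : ms r S T v = ∅ := by
  rw [eq_empty_iff_forall_notMem]
  intro t ht
  have h1 := ms_symm h ht (hX hv)
  have := hz t (mem_ms.1 ht).1
  rw [card_eq_zero] at this
  rw [this] at h1
  simp at h1
lemma ms_card_le {S X Y : Finset V} (h : X ⊆ Y) (v : V) : (ms r S X v).card ≤ (ms r S Y v).card :=
  card_le_card (ms_mono h v)

lemma bd14 : bd V 14 23 := by
  apply bd_exact
  intro r h S hS hE
  have hd : ∀ w ∈ S, 3 ≤ dg r S w := by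
    intro w hw
    have := bd_min h bd13 hS hw
    omega
  obtain ⟨T, R, t⟩ := two_split h (S := S) (a := 3) fun w hw => ⟨hd w hw, by
    have := ball_ge h hw hd
    omega⟩
  have hTc : T.card = 6 := by have := t.cT; omega
  have hRc : R.card = 8 := by have := t.cd; omega
  have hg : ∀ x ∈ T, dg r T x ≤ 1 := by intro x hx; have := t.eT hx; omega
  have q1 := t.sq
  have q2 := t.sc
  have q3 := convex R (dg r T) 2
  have q4 : ∑ v ∈ T, dg r T v ≤ ∑ v ∈ T, 1 := sum_le_sum hg
  rw [sum_sq_of_le_one hg] at q1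
  simp at q4
  rw [hTc] at q1 q2 q4
  rw [hRc] at q3
  have hg1 := sum_eq_const_of_le hg (by rw [hTc]; omega)
  have hk := convex_eq (N := R) (f := dg r T) (a := 2) (by rw [hRc]; omega)
  have hz : ∀ x ∈ T, (ms r S S x).card = 0 := by
    intro x hx; have := t.eT hx; have := hg1 x hx; omega
  have : ∃ v ∈ R, dg r T v = 2 := by
    by_contra hc
    push Not at hc
    have : ∑ v ∈ R, dg r T v = ∑ v ∈ R, 3 := sum_congr rfl fun v hv => by
      have := hk v hv; have := hc v hv; omega
    simp [hRc] at this
    omega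
  obtain ⟨v, hv, hv2⟩ := this
  have hvR : dg r R v = 1 := by have := t.ds v; have := t.dR hv; omega
  obtain ⟨w, hw, hvw, hwu⟩ := dg_one hvR
  have hms := miss_zero_symm h t.Ts t.Rs hz hv
  have i1 := t.iR hv
  rw [hTc, hms, nb_sum_const (fun w hw _ => hg1 w hw), nb_sum_const (c := dg r T w) (fun x hx hr => by rw [hwu x hx hr]), hv2, hvR] at i1
  simp at i1
  obtain ⟨c, hc, hwc⟩ := dg_pos.1 (show 0 < dg r T w by omega)
  obtain ⟨p, hp, hcp, hpu⟩ := dg_one (hg1 c hc)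
  have hcv : ¬ r v c := fun hh => h.c3 hvw hwc hh
  rcases dist2 hms hp (by rintro rfl; exact t.dj hp hv) with hvp | ⟨w', hw', hvw', hwp⟩
  · have := h.c4 (h.sy hvp) (h.sy hcp) (h.sy hvw) hwc (by rintro rfl; exact t.dj hc hv)
    exact t.dj hp (this ▸ hw)
  · rcases t.un hw' with hT' | hR'
    · have := dg_le_one (hg p hp) hT' hc (h.sy hwp) (h.sy hcp)
      exact hcv (this ▸ hvw')
    · have := hwu w' hR' hvw'
      subst this
      exact h.c3 hwc hcp hwp
lemma bd15 : bd V 15 26 := bd_easy bd14 4 3 (by norm_num) (by norm_num) (by norm_num)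
end Q19

namespace Q19
open scoped Classical
open Finset
variable {V : Type} {r : V → V → Prop}

lemma E2_pair (h : Good r) {a b : V} (hab : r a b) : E2 r {a, b} = 2 := by
  have e1 : nb r {b} a = {b} := by ext x; simp [mem_nb]; rintro rfl; exact hab
  have e2 : E2 r {b} = 0 := by simp [E2, dg, nb, h.ir]
  rw [show ({a, b} : Finset V) = insert a {b} from rfl, E2_insert h (by simpa using h.ne hab), e2, dg, e1]
  simp
/-- star: vertex together with some of its neighbours -/
lemma E2_star (h : Good r) {D : Finset V} {v : V} (hD : ∀ x ∈ D, r v x) : 2 * D.card ≤ E2 r (insert v D) := by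
  rw [E2_insert h (fun hh => h.ir (hD v hh))]
  have : dg r D v = D.card := by unfold dg nb; rw [filter_true_of_mem hD]
  omega
lemma bd_star (h : Good r) {n k : ℕ} (hb : bd V n k) {S D : Finset V} {v : V} (hv : v ∈ S) (hDS : D ⊆ S)
    (hD : ∀ x ∈ D, r v x) (hc : S.card = n + (D.card + 1)) :
    E2 r S + 2 * D.card ≤ 2 * k + 2 * (dg r S v + ∑ x ∈ D, dg r S x) := by
  have hvD : v ∉ D := fun hh => h.ir (hD v hh)
  have h1 := bd_del h hb (D := insert v D) (S := S) (insert_subset hv hDS) (by rw [card_insert_of_notMem hvD]; exact hc)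
  rw [sum_insert hvD] at h1
  have := E2_star h hD
  omega
lemma bd_adj (h : Good r) {n k : ℕ} (hb : bd V n k) {S : Finset V} {a b : V} (ha : a ∈ S) (hbS : b ∈ S)
    (hab : r a b) (hc : S.card = n + 2) :
    E2 r S + 2 ≤ 2 * k + 2 * (dg r S a + dg r S b) := by
  have := bd_star h hb (D := {b}) ha (by simpa using hbS) (by simpa using hab) (by simpa using hc)
  simpa using this

lemma bd_easy' {n k k' : ℕ} (hb : bd V n k') (δ : ℕ) (h1 : k' + δ = k + 1)
    (h2 : 2 * (k + 1) < (n + 1) * δ) : bd V (n + 1) k := by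
  apply bd_exact
  intro r h S hS hE
  have hd : ∀ w ∈ S, δ ≤ dg r S w := by
    intro w hw
    have := bd_min h hb hS hw
    omega
  have : ∑ v ∈ S, δ ≤ E2 r S := sum_le_sum hd
  simp [hS] at this
  omega

lemma bd16 : bd V 16 28 := by
  apply bd_exact
  intro r h S hS hE
  have hd : ∀ w ∈ S, 3 ≤ dg r S w := by
    intro w hw
    have := bd_min h bd15 hS hw
    omega
  have hind : ∀ a ∈ S, ∀ b ∈ S, dg r S a = 3 → dg r S b = 3 → ¬ r a b := by
    intro a ha b hb h1 h2 hab
    have := bd_adj h bd14 ha hb hab (by omega)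
    omega
  have hu : ∀ w ∈ S, dg r S w ≤ 4 := by
    intro x hx
    have b1 := ball_ge h hx hd
    by_contra hc
    have hx5 : dg r S x = 5 := by omega
    have i1 := ident_S h hx
    have hn3 : ∀ w ∈ nb r S x, dg r S w = 3 := by
      by_contra hc
      push Not at hc
      obtain ⟨y, hy, hy3⟩ := hc
      have : ∑ w ∈ nb r S x, 3 < ∑ w ∈ nb r S x, dg r S w :=
        sum_lt_sum (fun w hw => hd w (mem_nb.1 hw).1) ⟨y, hy, by have := hd y (mem_nb.1 hy).1; omega⟩
      simp at this
      change dg r S x * 3 < _ at this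
      omega
    have : ∑ w ∈ nb r S x, dg r S w = 15 := by
      rw [sum_congr rfl hn3]; simp; change dg r S x * 3 = _; omega
    have hm : (ms r S S x).card = 0 := by omega
    have hsub : S.filter (fun w => dg r S w = 3) ⊆ nb r S x := by
      intro p hp
      simp only [mem_filter] at hp
      rcases dist2' hm hp.1 (by rintro rfl; omega) with hh | ⟨w, hw, h1, h2⟩
      · exact mem_nb.2 ⟨hp.1, hh⟩
      · exact absurd h2 (hind w hw p hp.1 (hn3 w (mem_nb.2 ⟨hw, h1⟩)) hp.2)
    have h5 := card_le_card hsub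
    change _ ≤ dg r S x at h5
    have : ∑ w ∈ S, 4 ≤ ∑ w ∈ S, (dg r S w + if dg r S w = 3 then 1 else 0) := by
      refine sum_le_sum fun w hw => ?_
      have := hd w hw
      split_ifs <;> omega
    rw [sum_add_distrib, ← card_filter] at this
    change _ ≤ E2 r S + _ at this
    simp [hS] at this
    omega
  obtain ⟨T, R, t⟩ := two_split h (S := S) (a := 3) fun w hw => ⟨hd w hw, hu w hw⟩
  have hTc : T.card = 10 := by have := t.cT; omega
  have hRc : R.card = 6 := by have := t.cd; omega
  have hRR : ∀ x ∈ R, ∀ y ∈ R, ¬ r x y := fun x hx y hy => hind x (t.Rs hx) y (t.Rs hy) (t.dR hx) (t.dR hy)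
  have hR0 : ∀ x ∈ R, dg r R x = 0 := by
    intro x hx
    by_contra hc
    obtain ⟨w, hw, hh⟩ := dg_pos.1 (Nat.pos_of_ne_zero hc)
    exact hRR x hx w hw hh
  have hsa : ∑ x ∈ T, dg r R x = 18 := by
    rw [sum_dg_comm h]
    rw [sum_congr (g := fun _ => 3) rfl fun x hx => by have := t.ds x; have := t.dR hx; have := hR0 x hx; omega]
    simp [hRc]
  have ha : ∀ x ∈ T, dg r R x = 1 ∨ dg r R x = 2 := by
    intro x hx
    have h1 := t.eT hx
    have h2 := t.ds x
    have h3 := t.dT hx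
    have hs := bd_star h (n := 15 - dg r R x) (S := S) (D := nb r R x) (v := x) (k := if dg r R x = 3 then 18 else 16)
    have hsum : ∑ y ∈ nb r R x, dg r S y = 3 * dg r R x := nb_sum_const (fun w hw _ => t.dR hw)
    have hc : (nb r R x).card = dg r R x := rfl
    by_contra hcon
    have : dg r R x = 3 ∨ dg r R x = 4 := by omega
    rcases this with h4 | h4
    · simp only [h4, if_true, hsum] at hs
      have := hs bd12 (t.Ts hx) (fun y hy => t.Rs (mem_nb.1 hy).1) (fun y hy => (mem_nb.1 hy).2) (by omega)
      omega
    · simp only [h4, hsum, if_neg (show ¬ (4:ℕ) = 3 by norm_num)] at hs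
      have := hs bd11 (t.Ts hx) (fun y hy => t.Rs (mem_nb.1 hy).1) (fun y hy => (mem_nb.1 hy).2) (by omega)
      omega
  have hg : ∀ x ∈ T, dg r T x = 4 - dg r R x := by
    intro x hx; have h2 := t.ds x; have h3 := t.dT hx; have := ha x hx; omega
  -- the singles
  have hcount : (T.filter (fun x => dg r R x = 1)).card = 2 := by
    have : ∑ x ∈ T, (dg r R x + if dg r R x = 1 then 1 else 0) = ∑ x ∈ T, 2 := by
      refine sum_congr rfl fun x hx => ?_
      rcases ha x hx with h1 | h1 <;> simp [h1]
    rw [sum_add_distrib, ← card_filter] at this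
    simp [hTc] at this
    omega
  obtain ⟨y, y', hyy, hY⟩ := card_eq_two.1 hcount
  have hY' : ∀ x ∈ T, dg r R x = 1 → x = y ∨ x = y' := by
    intro x hx h1
    have : x ∈ T.filter (fun x => dg r R x = 1) := mem_filter.2 ⟨hx, h1⟩
    rw [hY] at this; simpa using this
  obtain ⟨hyT, hy1⟩ : y ∈ T ∧ dg r R y = 1 := by
    have : y ∈ T.filter (fun x => dg r R x = 1) := by rw [hY]; simp
    simpa using this
  obtain ⟨hyT', hy1'⟩ : y' ∈ T ∧ dg r R y' = 1 := by
    have : y' ∈ T.filter (fun x => dg r R x = 1) := by rw [hY]; simp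
    simpa using this
  -- identity with X = R
  have idR : ∀ v ∈ T, 6 = dg r R v + ∑ w ∈ nb r T v, dg r R w + (ms r S R v).card := by
    intro v hv
    have := ident_out h t.Rs (v := v) (fun hh => t.dj hv hh)
    rw [t.sm, nb_sum_const (X := R) (c := 0) (fun w hw _ => hR0 w hw)] at this
    omega
  have hadj : r y y' := by
    have i1 := idR y hyT
    have : (ms r S R y).card = 0 := by
      have h1 := t.eT hyT
      have h2 := hg y hyT
      have := ms_card_le (r := r) (S := S) t.Rs y
      omega
    by_contra hna
    have : ∑ w ∈ nb r T y, dg r R w = 2 * dg r T y := nb_sum_const (fun w hw hr => by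
      rcases ha w hw with h1 | h1
      · rcases hY' w hw h1 with rfl | rfl
        · exact absurd hr h.ir
        · exact absurd hr hna
      · exact h1)
    have h2 := hg y hyT
    omega
  set W := nb r T y ∪ nb r T y' with hW
  set A := T \ W with hA
  have hWT : W ⊆ T := by
    intro x hx; simp only [hW, mem_union, mem_nb] at hx; tauto
  have hyW : y ∈ W := by simp only [hW, mem_union, mem_nb]; exact Or.inr ⟨hyT, h.sy hadj⟩
  have hyW' : y' ∈ W := by simp only [hW, mem_union, mem_nb]; exact Or.inl ⟨hyT', hadj⟩
  have hWc : W.card ≤ 6 := by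
    rw [hW]
    have := card_union_le (nb r T y) (nb r T y')
    have h1 := hg y hyT
    have h2 := hg y' hyT'
    unfold dg at h1 h2 hy1 hy1'
    omega
  have hAc : A.card + W.card = 10 := by rw [hA, card_sdiff_add_card_eq_card hWT, hTc]
  have hAm : ∀ z ∈ A, z ∈ T ∧ ¬ r y z ∧ ¬ r y' z := by
    intro z hz
    simp only [hA, hW, mem_sdiff, mem_union, mem_nb] at hz; tauto
  have hA2 : ∀ z ∈ A, dg r R z = 2 := by
    intro z hz
    have h1 := hAm z hz
    rcases ha z h1.1 with h2 | h2
    · rcases hY' z h1.1 h2 with rfl | rfl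
      · exact absurd (h.sy hadj) h1.2.2
      · exact absurd hadj h1.2.1
    · exact h2
  have hAT : ∀ z ∈ A, dg r T z = 2 := by
    intro z hz; have := hg z (hAm z hz).1; have := hA2 z hz; omega
  have hAn : ∀ z ∈ A, ∀ w ∈ T, r z w → dg r R w = 2 := by
    intro z hz w hw hr
    rcases ha w hw with h1 | h1
    · rcases hY' w hw h1 with rfl | rfl
      · exact absurd (h.sy hr) (hAm z hz).2.1
      · exact absurd (h.sy hr) (hAm z hz).2.2
    · exact h1
  have hAms : ∀ z ∈ A, (ms r S R z).card = 0 := by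
    intro z hz
    have := idR z (hAm z hz).1
    rw [nb_sum_const (c := 2) (fun w hw hr => hAn z hz w hw hr)] at this
    have := hA2 z hz; have := hAT z hz; omega
  have hAA : ∃ z ∈ A, ∃ z' ∈ A, r z z' := by
    by_contra hc
    push Not at hc
    have h1 : ∑ z ∈ A, dg r W z = ∑ z ∈ A, 2 := by
      refine sum_congr rfl fun z hz => ?_
      have h2 := dg_sdiff (r := r) hWT z
      have h3 : dg r (T \ W) z = 0 := by
        by_contra hh
        obtain ⟨w, hw, hr⟩ := dg_pos.1 (Nat.pos_of_ne_zero hh)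
        exact hc z hz w hw hr
      have := hAT z hz
      omega
    rw [sum_dg_comm h] at h1
    have h2 : ∑ w ∈ W, (dg r A w + if w = y then 1 else 0) + ∑ w ∈ W, (if w = y' then 1 else 0) ≤ ∑ w ∈ W, 1 := by
      rw [← sum_add_distrib]
      refine sum_le_sum fun w hw => ?_
      have hz0 : ∀ u, (u = y ∨ u = y') → dg r A u = 0 := by
        intro u hu
        by_contra hh
        obtain ⟨z, hz, hr⟩ := dg_pos.1 (Nat.pos_of_ne_zero hh)
        rcases hu with rfl | rfl
        · exact (hAm z hz).2.1 hr
        · exact (hAm z hz).2.2 hr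
      by_cases e1 : w = y
      · have := hz0 w (Or.inl e1); subst e1; simp [hyy, this]
      · by_cases e2 : w = y'
        · have := hz0 w (Or.inr e2); subst e2; simp [e1, this]
        · simp only [e1, e2, if_false]
          have h5 := dg_sdiff (r := r) hWT w
          have h6 : 0 < dg r W w := by
            simp only [hW, mem_union, mem_nb] at hw
            rcases hw with hw | hw
            · exact dg_pos.2 ⟨y, hyW, h.sy hw.2⟩
            · exact dg_pos.2 ⟨y', hyW', h.sy hw.2⟩
          have h7 := hg w (hWT hw)
          have h8 : dg r R w = 2 := by
            rcases ha w (hWT hw) with h1 | h1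
            · rcases hY' w (hWT hw) h1 with h2 | h2
              · exact absurd h2 e1
              · exact absurd h2 e2
            · exact h1
          change dg r A w + dg r W w = _ at h5
          omega
    simp [sum_add_distrib, hyW, hyW'] at h2 h1
    omega
  obtain ⟨z, hz, z', hz', hzz⟩ := hAA
  obtain ⟨p, hp, hzp, hpne⟩ : ∃ p ∈ T, r z p ∧ p ≠ z' := by
    obtain ⟨w, hw, w', hw', hne, h1, h2, _⟩ := dg_two (hAT z hz)
    by_cases e : w = z'
    · exact ⟨w', hw', h2, fun hh => hne (e.trans hh.symm)⟩
    · exact ⟨w, hw, h1, e⟩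
  obtain ⟨p', hp', hzp', hpne', hpu'⟩ : ∃ p ∈ T, r z' p ∧ p ≠ z ∧ ∀ x ∈ T, r z' x → x = p ∨ x = z := by
    obtain ⟨w, hw, w', hw', hne, h1, h2, h3, _⟩ := dg_two (hAT z' hz')
    rcases h3 z (hAm z hz).1 (h.sy hzz) with e | e
    · exact ⟨w', hw', h2, fun hh => hne (e.symm.trans hh.symm), fun x hx hr => by rw [e]; exact (h3 x hx hr).symm⟩
    · exact ⟨w, hw, h1, fun hh => hne (hh.trans e), fun x hx hr => by rw [e]; exact (h3 x hx hr)⟩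
  obtain ⟨u1, hu1, u2, hu2, hne, hr1, hr2, -⟩ := dg_two (hAn z hz p hp hzp)
  have key : ∀ u ∈ R, r p u → r p' u := by
    intro u hu hr
    rcases dist2' (hAms z' hz') hu (by rintro rfl; exact t.dj (hAm _ hz').1 hu) with hh | ⟨w, hw, h1, h2⟩
    · exact absurd (h.c4 (h.sy hzp) hr (h.sy hzz) hh (by rintro rfl; exact t.dj (hAm _ hz).1 hu)) hpne
    · rcases t.un hw with hw | hw
      · rcases hpu' w hw h1 with rfl | rfl
        · exact h2
        · exact absurd h2 (fun hh => h.c3 hzp hr hh)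
      · exact absurd h2 (hRR w hw u hu)
  have := h.c4 hr1 hr2 (key u1 hu1 hr1) (key u2 hu2 hr2) hne
  subst this
  exact h.c3 hzz hzp' hzp

lemma bd17 : bd V 17 31 := bd_easy' bd16 4 (by norm_num) (by norm_num)
lemma bd18 : bd V 18 34 := bd_easy' bd17 4 (by norm_num) (by norm_num)
lemma bd19 : bd V 19 38 := bd_easy bd18 5 4 (by norm_num) (by norm_num) (by norm_num)
lemma bd20 : bd V 20 41 := bd_easy bd19 4 4 (by norm_num) (by norm_num) (by norm_num)
end Q19

namespace Q19
open scoped Classical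
open Finset
variable {V : Type} {r : V → V → Prop}

lemma two_of_le {X : Finset V} {v : V} (hd : 2 ≤ dg r X v) : ∃ w ∈ X, ∃ w' ∈ X, w ≠ w' ∧ r v w ∧ r v w' := by
  obtain ⟨a, ha, b, hb, hne⟩ := one_lt_card.1 (show 1 < (nb r X v).card from hd)
  exact ⟨a, (mem_nb.1 ha).1, b, (mem_nb.1 hb).1, hne, (mem_nb.1 ha).2, (mem_nb.1 hb).2⟩
lemma other_of_two {X : Finset V} {v z : V} (hd : dg r X v = 2) (hz : z ∈ X) (hvz : r v z) :
    ∃ w ∈ X, w ≠ z ∧ r v w ∧ ∀ x ∈ X, r v x → x = w ∨ x = z := by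
  obtain ⟨w, hw, w', hw', hne, h1, h2, h3, _⟩ := dg_two hd
  rcases h3 z hz hvz with e | e
  · exact ⟨w', hw', fun hh => hne (e.symm.trans hh.symm), h2, fun x hx hr => by rw [e]; exact (h3 x hx hr).symm⟩
  · exact ⟨w, hw, fun hh => hne (hh.trans e), h1, fun x hx hr => by rw [e]; exact (h3 x hx hr)⟩

lemma endgame (h : Good r) {S T : Finset V} {z z' p p' : V} (hzz : r z z') (hzp : r z p) (hpne : p ≠ z')
    (hzp' : r z' p') (hms : (ms r S T z').card = 0) (hz : z ∉ T) (hz' : z' ∉ T)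
    (hnb : ∀ x ∈ S, r z' x → x = p' ∨ x = z ∨ ∀ u ∈ T, ¬ r x u) (h2 : 2 ≤ dg r T p) : False := by
  obtain ⟨u1, hu1, u2, hu2, hne, hr1, hr2⟩ := two_of_le h2
  have key : ∀ u ∈ T, r p u → r p' u := by
    intro u hu hr
    rcases dist2' hms hu (by rintro rfl; exact hz' hu) with hh | ⟨w, hw, h1, h2⟩
    · exact absurd (h.c4 (h.sy hzp) hr (h.sy hzz) hh (by rintro rfl; exact hz hu)) hpne
    · rcases hnb w hw h1 with rfl | rfl | hn
      · exact h2
      · exact absurd h2 (fun hh => h.c3 hzp hr hh)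
      · exact absurd h2 (hn u hu)
  have := h.c4 hr1 hr2 (key u1 hu1 hr1) (key u2 hu2 hr2) hne
  subst this
  exact h.c3 hzz hzp' hzp
lemma dg_zero {X : Finset V} {v : V} (hd : dg r X v = 0) : ∀ w ∈ X, ¬ r v w := by
  intro w hw hr
  have := dg_pos.2 ⟨w, hw, hr⟩
  omega

lemma bd21 : bd V 21 44 := by
  apply bd_exact
  intro r h S hS hE
  have hd : ∀ w ∈ S, 4 ≤ dg r S w := by
    intro w hw
    have := bd_min h bd20 hS hw
    omega
  obtain ⟨T, R, t⟩ := two_split h (S := S) (a := 4) fun w hw => ⟨hd w hw, by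
    have := ball_ge h hw hd
    omega⟩
  have hTc : T.card = 6 := by have := t.cT; omega
  have hRc : R.card = 15 := by have := t.cd; omega
  have hg : ∀ x ∈ T, dg r T x = 0 := by intro x hx; have := t.eT hx; omega
  have hz : ∀ x ∈ T, (ms r S S x).card = 0 := by intro x hx; have := t.eT hx; omega
  have q1 := t.sq
  have q2 := t.sc
  rw [sum_sq_of_le_one (N := T) (fun x hx => by rw [hg x hx]; omega)] at q1
  rw [sum_eq_zero hg] at q1 q2
  rw [hTc] at q1 q2
  have k1 := convex_eq (N := R) (f := dg r T) (a := 2) (by rw [hRc]; omega)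
  have k2 := convex_eq (N := R) (f := dg r T) (a := 1) (by rw [hRc]; omega)
  have hk : ∀ x ∈ R, dg r T x = 2 := fun x hx => by have := k1 x hx; have := k2 x hx; omega
  have hkR : ∀ x ∈ R, dg r R x = 2 := fun x hx => by have := hk x hx; have := t.ds x; have := t.dR hx; omega
  obtain ⟨v, hv⟩ := card_pos.1 (show 0 < R.card by omega)
  obtain ⟨w, hw, p, hp, hne, h1, h2, _⟩ := dg_two (hkR v hv)
  obtain ⟨p', hp', _, h3, h4⟩ := other_of_two (hkR w hw) hv (h.sy h1)
  refine endgame (z := v) (z' := w) (p := p) (p' := p') (S := S) (T := T) h h1 h2 hne.symm h3 ?_ 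
    (fun hh => t.dj hh hv) (fun hh => t.dj hh hw) ?_ (by have := hk p hp; omega)
  · rw [card_eq_zero]; exact miss_zero_symm h t.Ts t.Rs hz hw
  · intro x hx hr
    rcases t.un hx with hh | hh
    · exact Or.inr (Or.inr (dg_zero (hg x hh)))
    · rcases h4 x hh hr with e | e
      · exact Or.inl e
      · exact Or.inr (Or.inl e)

lemma bd22 : bd V 22 47 := by
  apply bd_exact
  intro r h S hS hE
  have hd : ∀ w ∈ S, 4 ≤ dg r S w := by
    intro w hw
    have := bd_min h bd21 hS hw
    omega
  obtain ⟨T, R, t⟩ := two_split h (S := S) (a := 4) fun w hw => ⟨hd w hw, by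
    have := ball_ge h hw hd
    omega⟩
  have hTc : T.card = 8 := by have := t.cT; omega
  have hRc : R.card = 14 := by have := t.cd; omega
  have hg : ∀ x ∈ T, dg r T x ≤ 1 := by intro x hx; have := t.eT hx; omega
  have q1 := t.sq
  have q2 := t.sc
  have q3 := convex R (dg r T) 2
  obtain ⟨m, hm⟩ := E2_even h T
  change ∑ v ∈ T, dg r T v = _ at hm
  have q4 : ∑ v ∈ T, dg r T v ≤ ∑ v ∈ T, 1 := sum_le_sum hg
  rw [sum_sq_of_le_one hg] at q1
  simp at q4
  rw [hTc] at q1 q2 q4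
  rw [hRc] at q3
  have hg1 := sum_eq_const_of_le hg (by rw [hTc]; omega)
  have hz : ∀ x ∈ T, (ms r S S x).card = 0 := by
    intro x hx; have := t.eT hx; have := hg1 x hx; omega
  have hms : ∀ x ∈ R, ms r S T x = ∅ := fun x hx => miss_zero_symm h t.Ts t.Rs hz hx
  have star : ∀ v ∈ R, ∀ w ∈ R, ∀ c ∈ T, ∀ p ∈ T, r v w → r w c → r c p → ∃ w' ∈ R, w' ≠ w ∧ r v w' ∧ r w' p := by
    intro v hv w hw c hc p hp hvw hwc hcp
    rcases dist2 (hms v hv) hp (by rintro rfl; exact t.dj hp hv) with hvp | ⟨w', hw', hvw', hwp⟩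
    · have := h.c4 (h.sy hvp) (h.sy hcp) (h.sy hvw) hwc (by rintro rfl; exact t.dj hc hv)
      exact absurd hw (fun hh => t.dj hp (this ▸ hh))
    · rcases t.un hw' with hT' | hR'
      · have := dg_le_one (hg p hp) hT' hc (h.sy hwp) (h.sy hcp)
        exact absurd (this ▸ hvw') (fun hh => h.c3 hvw hwc hh)
      · refine ⟨w', hR', ?_, hvw', hwp⟩
        rintro rfl
        exact h.c3 hwc hcp hwp
  have id : ∀ v ∈ R, 8 = 2 * dg r T v + ∑ w ∈ nb r R v, dg r T w := by
    intro v hv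
    have := t.iR hv
    rw [hTc, hms v hv, nb_sum_const (X := T) (fun w hw _ => hg1 w hw)] at this
    simp at this
    omega
  have hdR : ∀ v ∈ R, dg r T v + dg r R v = 4 := fun v hv => by have := t.ds v; have := t.dR hv; omega
  have hk3 : ∀ v ∈ R, dg r T v ≠ 3 := by
    intro v hv h3
    have := hdR v hv
    obtain ⟨w, hw, hvw, hu⟩ := dg_one (show dg r R v = 1 by omega)
    have i := id v hv
    rw [nb_sum_const (c := dg r T w) (fun x hx hr => by rw [hu x hx hr])] at i
    obtain ⟨c, hc, hwc⟩ := dg_pos.1 (show 0 < dg r T w by 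
      by_contra hh
      have : dg r T w = 0 := by omega
      rw [this] at i; omega)
    obtain ⟨p, hp, hcp, -⟩ := dg_one (hg1 c hc)
    obtain ⟨w', hw', hne, hr, -⟩ := star v hv w hw c hc p hp hvw hwc hcp
    exact hne (hu w' hw' hr)
  have hle2 : ∀ v ∈ R, ∀ w ∈ R, r v w → dg r T w ≤ 2 := by
    intro v hv w hw hr
    have h1 := hdR w hw
    have h2 := hk3 w hw
    have h3 := dg_pos.2 ⟨v, hv, h.sy hr⟩
    omega
  have hnb2 : ∀ v ∈ R, ∀ w ∈ R, r v w → dg r T w = 2 := by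
    intro v hv w hw hr
    have hs := sum_eq_const_of_le (N := nb r R v) (f := dg r T) (c := 2) (fun x hx => hle2 v hv x (mem_nb.1 hx).1 (mem_nb.1 hx).2) (by
      have h1 := hdR v hv
      have h2 := id v hv
      change 2 * dg r R v ≤ _
      omega)
    exact hs w (mem_nb.2 ⟨hw, hr⟩)
  have : ∃ v ∈ R, dg r T v ≠ 4 := by
    by_contra hc
    push Not at hc
    have : ∑ v ∈ R, dg r T v = ∑ v ∈ R, 4 := sum_congr rfl hc
    simp [hRc] at this
    omega
  obtain ⟨v0, hv0, hne4⟩ := this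
  have h1 := hdR v0 hv0
  obtain ⟨v, hv, hr0⟩ := dg_pos.1 (show 0 < dg r R v0 by omega)
  have hv2 := hnb2 v0 hv0 v hv hr0
  have h2 := hdR v hv
  obtain ⟨w, hw, w', hw', hne, hvw, hvw', -⟩ := dg_two (show dg r R v = 2 by omega)
  have hw2 := hnb2 v hv w hw hvw
  have hw2' := hnb2 v hv w' hw' hvw'
  obtain ⟨u, hu, hune, hwu, huu⟩ := other_of_two (show dg r R w = 2 by have := hdR w hw; omega) hv (h.sy hvw)
  obtain ⟨u', hu', hune', hwu', huu'⟩ := other_of_two (show dg r R w' = 2 by have := hdR w' hw'; omega) hv (h.sy hvw')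
  obtain ⟨a1, ha1, a2, ha2, hane, hr1, hr2, -⟩ := dg_two hv2
  obtain ⟨p1, hp1, hap1, -⟩ := dg_one (hg1 a1 ha1)
  obtain ⟨p2, hp2, hap2, -⟩ := dg_one (hg1 a2 ha2)
  have hpne : p1 ≠ p2 := by
    rintro rfl
    exact hane (dg_le_one (hg p1 hp1) ha1 ha2 (h.sy hap1) (h.sy hap2))
  have key : ∀ p ∈ T, ∀ a ∈ T, r v a → r a p → r u p ∧ r u' p := by
    intro p hp a ha hva hap
    constructor
    · obtain ⟨x, hx, hxne, hxr, hxp⟩ := star w hw v hv a ha p hp (h.sy hvw) hva hap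
      rcases huu x hx hxr with rfl | rfl
      · exact hxp
      · exact absurd rfl hxne
    · obtain ⟨x, hx, hxne, hxr, hxp⟩ := star w' hw' v hv a ha p hp (h.sy hvw') hva hap
      rcases huu' x hx hxr with rfl | rfl
      · exact hxp
      · exact absurd rfl hxne
  obtain ⟨x1, x2⟩ := key p1 hp1 a1 ha1 hr1 hap1
  obtain ⟨x3, x4⟩ := key p2 hp2 a2 ha2 hr2 hap2
  have := h.c4 x1 x3 x2 x4 hpne
  subst this
  exact hune (h.c4 (h.sy hwu) (h.sy hwu') hvw hvw' hne)
end Q19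

namespace Q19
open scoped Classical
open Finset
variable {V : Type} {r : V → V → Prop}

structure C23 (r : V → V → Prop) (S T R : Finset V) : Prop where
  h : Good r
  t : Two r S T R 4
  hS : S.card = 23
  hT : T.card = 10
  hR : R.card = 13

lemma E2_ins_ge (h : Good r) {D : Finset V} {x y : V} (hx : x ∉ D) (hy : y ∈ D) (hr : r x y) :
    E2 r D + 2 ≤ E2 r (insert x D) := by
  rw [E2_insert h hx]
  have := dg_pos.2 ⟨y, hy, hr⟩
  omega
lemma E2_ins_ge2 (h : Good r) {D : Finset V} {x y y' : V} (hx : x ∉ D) (hy : y ∈ D) (hy' : y' ∈ D)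
    (hne : y ≠ y') (hr : r x y) (hr' : r x y') :
    E2 r D + 4 ≤ E2 r (insert x D) := by
  rw [E2_insert h hx]
  have : 1 < dg r D x := one_lt_card.2 ⟨y, mem_nb.2 ⟨hy, hr⟩, y', mem_nb.2 ⟨hy', hr'⟩, hne⟩
  omega
/-- a path on four vertices -/
lemma path4 (h : Good r) {a b c d : V} (hab : r a b) (hbc : r b c) (hcd : r c d) (had : a ≠ d) (hac : a ≠ c) (hbd : b ≠ d) :
    ({a, b, c, d} : Finset V).card = 4 ∧ 6 ≤ E2 r {a, b, c, d} := by
  have h1 := h.ne hab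
  have h2 := h.ne hbc
  have h3 := h.ne hcd
  constructor
  · rw [card_insert_of_notMem (by simp [h1, had, hac]), card_insert_of_notMem (by simp [h2, hbd]), card_pair h3]
  · have e1 := E2_pair h hcd
    have e2 := E2_ins_ge h (D := {c, d}) (x := b) (y := c) (by simp [h2, hbd]) (by simp) hbc
    have e3 := E2_ins_ge h (D := {b, c, d}) (x := a) (y := b) (by simp [h1, had, hac]) (by simp) hab
    omega

namespace C23
variable {S T R : Finset V}

lemma e2S (C : C23 r S T R) : E2 r S = 102 := by have := C.t.cT; rw [C.hS, C.hT] at this; omega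
lemma ext4 (C : C23 r S T R) {D : Finset V} (hD : D ⊆ R) (hc : D.card = 4) (hE : 6 ≤ E2 r D)
    {x y : V} (hx : x ∈ R) (hy : y ∈ D) (hr : r x y) : x ∈ D := by
  by_contra hxD
  have h1 := E2_ins_ge C.h hxD hy hr
  have h2 := bd_del C.h bd18 (S := S) (D := insert x D) (insert_subset (C.t.Rs hx) (hD.trans C.t.Rs))
    (by rw [card_insert_of_notMem hxD, C.hS, hc])
  rw [sum_insert hxD, C.t.dR hx, sum_congr rfl fun z hz => C.t.dR (hD hz), C.e2S] at h2
  simp [hc] at h2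
  omega
lemma ext4T (C : C23 r S T R) {D : Finset V} (hD : D ⊆ R) (hc : D.card = 4) (hE : 6 ≤ E2 r D)
    {x y y' : V} (hx : x ∈ T) (hy : y ∈ D) (hy' : y' ∈ D) (hne : y ≠ y') (hr : r x y) (hr' : r x y') : False := by
  have hxD : x ∉ D := fun hh => C.t.dj hx (hD hh)
  have h1 := E2_ins_ge2 C.h hxD hy hy' hne hr hr'
  have h2 := bd_del C.h bd18 (S := S) (D := insert x D) (insert_subset (C.t.Ts hx) (hD.trans C.t.Rs))
    (by rw [card_insert_of_notMem hxD, C.hS, hc])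
  rw [sum_insert hxD, C.t.dT hx, sum_congr rfl fun z hz => C.t.dR (hD hz), C.e2S] at h2
  simp [hc] at h2
  omega
lemma gm (C : C23 r S T R) {x : V} (hx : x ∈ T) : dg r T x + (ms r S S x).card = 2 := by
  have := C.t.eT hx; rw [C.hS] at this; omega
lemma kr (C : C23 r S T R) {x : V} (hx : x ∈ R) : dg r T x + dg r R x = 4 := by
  have := C.t.ds x; have := C.t.dR hx; omega
lemma r3 (C : C23 r S T R) {v : V} (hv : v ∈ R) : dg r R v ≤ 3 := by
  by_contra hc
  have h4 : dg r R v = 4 := by have := C.kr hv; omega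
  have := bd_star C.h bd18 (S := S) (D := nb r R v) (C.t.Rs hv) (fun x hx => C.t.Rs (mem_nb.1 hx).1) (fun x hx => (mem_nb.1 hx).2)
    (by change _ = 18 + (dg r R v + 1); rw [C.hS, h4])
  rw [nb_sum_const (c := 4) (fun w hw _ => C.t.dR hw), h4, C.e2S, C.t.dR hv] at this
  change _ + 2 * dg r R v ≤ _ at this
  omega
lemma r3nb (C : C23 r S T R) {v w : V} (hv : v ∈ R) (hw : w ∈ R) (h3 : dg r R v = 3) (hr : r v w) : dg r R w = 1 := by
  have h := C.h
  have h0 := dg_pos.2 ⟨v, hv, h.sy hr⟩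
  by_contra hc
  obtain ⟨x, hx, y, hy, hne, hx', hy'⟩ := two_of_le (r := r) (X := R) (v := w) (by omega)
  have : ∃ u ∈ R, u ≠ v ∧ r w u := by
    by_cases e : x = v
    · exact ⟨y, hy, fun hh => hne (e.trans hh.symm), hy'⟩
    · exact ⟨x, hx, e, hx'⟩
  obtain ⟨u, hu, huv, hwu⟩ := this
  have hvn : v ∉ nb r R v := fun hh => h.ir (mem_nb.1 hh).2
  have hst := E2_star h (D := nb r R v) (v := v) (fun x hx => (mem_nb.1 hx).2)
  have := C.ext4 (D := insert v (nb r R v)) (insert_subset hv (filter_subset _ _)) 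
    (by rw [card_insert_of_notMem hvn]; change dg r R v + 1 = 4; omega) (by change 2 * dg r R v ≤ _ at hst; omega)
    hu (mem_insert_of_mem (mem_nb.2 ⟨hw, hr⟩)) (h.sy hwu)
  rcases mem_insert.1 this with e | e
  · exact huv e
  · exact h.c3 hr hwu (mem_nb.1 e).2
/-- reaching `l` from `a` -/
lemma reach (C : C23 r S T R) {a l : V} (ha : a ∈ R) (hl : l ∈ T) (h1 : ¬ r a l) (h2 : ∀ x ∈ R, r a x → ¬ r x l) :
    ∃ e ∈ nb r T l ∪ ms r S S l, e = a ∨ (e ∈ T ∧ r a e) := by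
  by_cases hc : a ∈ ms r S S l
  · exact ⟨a, mem_union_right _ hc, Or.inl rfl⟩
  · rw [mem_ms] at hc
    push Not at hc
    obtain ⟨w, hw, h3, h4⟩ := hc (C.t.Rs ha) (by rintro rfl; exact C.t.dj hl ha) (fun hh => h1 (C.h.sy hh))
    rcases C.t.un hw with hw' | hw'
    · exact ⟨w, mem_union_left _ (mem_nb.2 ⟨hw', h3⟩), Or.inr ⟨hw', C.h.sy h4⟩⟩
    · exact absurd (C.h.sy h3) (h2 w hw' (C.h.sy h4))
lemma reach_card (C : C23 r S T R) {l : V} (hl : l ∈ T) : (nb r T l ∪ ms r S S l).card ≤ 2 := by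
  have := card_union_le (nb r T l) (ms r S S l)
  have := C.gm hl
  unfold dg at this
  omega
lemma noP3 (C : C23 r S T R) {v w w' : V} (hv : v ∈ R) (hw : w ∈ R) (hw' : w' ∈ R) (hne : w ≠ w') (h1 : r v w) (h2 : r v w')
    (hv2 : dg r R v = 2) (hw1 : dg r R w = 1) (hw1' : dg r R w' = 1) (hu : ∀ x ∈ R, r v x → x = w ∨ x = w') : False := by
  have h := C.h
  have hk := C.kr hv
  have hk1 := C.kr hw
  have hk2 := C.kr hw'
  have : ∃ l ∈ T, ¬ r v l ∧ ¬ r w l ∧ ¬ r w' l := by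
    by_contra hc
    push Not at hc
    have hsub : T ⊆ nb r T v ∪ nb r T w ∪ nb r T w' := by
      intro l hl
      simp only [mem_union, mem_nb]
      have := hc l hl
      tauto
    have c1 := card_le_card hsub
    have c2 := card_union_le (nb r T v ∪ nb r T w) (nb r T w')
    have c3 := card_union_le (nb r T v) (nb r T w)
    rw [C.hT] at c1
    unfold dg at hk hk1 hk2 hv2 hw1 hw1'
    omega
  obtain ⟨l, hl, n1, n2, n3⟩ := this
  have u1 : ∀ x ∈ R, r w x → x = v := fun x hx hr => dg_le_one hw1.le hx hv hr (h.sy h1)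
  have u2 : ∀ x ∈ R, r w' x → x = v := fun x hx hr => dg_le_one hw1'.le hx hv hr (h.sy h2)
  obtain ⟨e1, he1, x1⟩ := C.reach hv hl n1 (fun x hx hr => by rcases hu x hx hr with rfl | rfl <;> assumption)
  obtain ⟨e2, he2, x2⟩ := C.reach hw hl n2 (fun x hx hr => by rw [u1 x hx hr]; assumption)
  obtain ⟨e3, he3, x3⟩ := C.reach hw' hl n3 (fun x hx hr => by rw [u2 x hx hr]; assumption)
  have hc := C.reach_card hl
  have dj := @C.t.dj
  have : 2 < (nb r T l ∪ ms r S S l).card := by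
    refine two_lt_card.2 ⟨e1, he1, e2, he2, e3, he3, ?_, ?_, ?_⟩
    · rintro rfl
      rcases x1 with rfl | ⟨a, b⟩ <;> rcases x2 with rfl | ⟨c, d⟩
      · exact h.ir h1
      · exact dj c hv
      · exact dj a hw
      · exact h.c3 h1 d b
    · rintro rfl
      rcases x1 with rfl | ⟨a, b⟩ <;> rcases x3 with rfl | ⟨c, d⟩
      · exact h.ir h2
      · exact dj c hv
      · exact dj a hw'
      · exact h.c3 h2 d b
    · rintro rfl
      rcases x2 with rfl | ⟨a, b⟩ <;> rcases x3 with rfl | ⟨c, d⟩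
      · exact hne rfl
      · exact dj c hw
      · exact dj a hw'
      · have := h.c4 h1 h2 (h.sy b) (h.sy d) hne
        subst this; exact dj a hv
  omega
lemma r2nb (C : C23 r S T R) {v : V} (hv : v ∈ R) (hv2 : dg r R v = 2) : ∃ w ∈ R, ∃ w' ∈ R, w ≠ w' ∧ r v w ∧ r v w' ∧
    dg r R w = 2 ∧ dg r R w' = 1 ∧ ∀ x ∈ R, r v x → x = w ∨ x = w' := by
  have h := C.h
  obtain ⟨w, hw, w', hw', hne, h1, h2, hu, -⟩ := dg_two hv2
  have fact : ∀ x ∈ R, r v x → dg r R x = 1 ∨ dg r R x = 2 := by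
    intro x hx hr
    have a1 := C.r3 hx
    have a2 := dg_pos.2 ⟨v, hv, h.sy hr⟩
    have a3 : dg r R x ≠ 3 := fun hh => by have := C.r3nb hx hv hh (h.sy hr); omega
    omega
  rcases fact w hw h1 with f1 | f1 <;> rcases fact w' hw' h2 with f2 | f2
  · exact absurd (C.noP3 hv hw hw' hne h1 h2 hv2 f1 f2 hu) id
  · exact ⟨w', hw', w, hw, hne.symm, h2, h1, f2, f1, fun x hx hr => (hu x hx hr).symm⟩
  · exact ⟨w, hw, w', hw', hne, h1, h2, f1, f2, hu⟩
  · exfalso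
    obtain ⟨u, huR, hune, hwu, _⟩ := other_of_two f1 hv (h.sy h1)
    obtain ⟨u', huR', hune', hwu', _⟩ := other_of_two f2 hv (h.sy h2)
    have hp := path4 h (a := u) (b := w) (c := v) (d := w') (h.sy hwu) (h.sy h1) h2 
      (by rintro rfl; exact h.c3 h1 hwu h2) hune hne
    have hmem := C.ext4 (D := {u, w, v, w'}) (by 
        intro x hx; simp only [mem_insert, mem_singleton] at hx; rcases hx with rfl | rfl | rfl | rfl <;> assumption)
      hp.1 hp.2 huR' (y := w') (by simp) (h.sy hwu')
    simp only [mem_insert, mem_singleton] at hmem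
    rcases hmem with rfl | rfl | rfl | rfl
    · exact hune (h.c4 (h.sy hwu) (h.sy hwu') h1 h2 hne)
    · exact h.c3 h1 (h.sy hwu') h2
    · exact hune' rfl
    · exact h.ir hwu'
end C23
end Q19

namespace Q19
open scoped Classical
open Finset
variable {V : Type} {r : V → V → Prop}

lemma hist {N : Finset V} {f : V → ℕ} (hf : ∀ v ∈ N, f v ≤ 3) (F : ℕ → ℕ) :
    ∑ v ∈ N, F (f v) = F 0 * (N.filter (fun v => f v = 0)).card + F 1 * (N.filter (fun v => f v = 1)).card
      + F 2 * (N.filter (fun v => f v = 2)).card + F 3 * (N.filter (fun v => f v = 3)).card := by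
  simp only [card_filter, mul_sum, ← sum_add_distrib]
  refine sum_congr rfl fun v hv => ?_
  have := hf v hv
  interval_cases f v <;> simp

structure P4s (r : V → V → Prop) (T R : Finset V) (a b c d : V) : Prop where
  aR : a ∈ R
  bR : b ∈ R
  cR : c ∈ R
  dR : d ∈ R
  ab : r a b
  bc : r b c
  cd : r c d
  a1 : dg r R a = 1
  b2 : dg r R b = 2
  c2 : dg r R c = 2
  d1 : dg r R d = 1
  bu : ∀ x ∈ R, r b x → x = a ∨ x = c
  cu : ∀ x ∈ R, r c x → x = b ∨ x = d
  ne1 : a ≠ d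
  ne2 : a ≠ c
  ne3 : b ≠ d
  cov : ∀ t ∈ T, r a t ∨ r b t ∨ r c t ∨ r d t
  djad : ∀ t ∈ T, r a t → r d t → False
lemma P4s.rev (h : Good r) {T R : Finset V} {a b c d : V} (P : P4s r T R a b c d) : P4s r T R d c b a :=
  ⟨P.dR, P.cR, P.bR, P.aR, h.sy P.cd, h.sy P.bc, h.sy P.ab, P.d1, P.c2, P.b2, P.a1,
    fun x hx hr => (P.cu x hx hr).symm, fun x hx hr => (P.bu x hx hr).symm, P.ne1.symm, P.ne3.symm, P.ne2.symm,
    fun t ht => by have := P.cov t ht; tauto, fun t ht h1 h2 => P.djad t ht h2 h1⟩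

namespace C23
variable {S T R : Finset V}

lemma p4 (C : C23 r S T R) {b : V} (hb : b ∈ R) (hb2 : dg r R b = 2) :
    ∃ a c d, P4s r T R a b c d := by
  have h := C.h
  obtain ⟨c, hc, a, ha, hne, hbc, hba, hc2, ha1, hbu⟩ := C.r2nb hb hb2
  obtain ⟨b', hb', d, hd, hne', hcb', hcd, hb2', hd1, hcu⟩ := C.r2nb hc hc2
  have hdb : d ≠ b := by rintro rfl; omega
  have : b = b' := by
    rcases hcu b hb (h.sy hbc) with e | e
    · exact e
    · exact absurd e.symm hdb
  subst this
  have had : a ≠ d := by rintro rfl; exact h.c3 hba (h.sy hcd) hbc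
  have pp := path4 h (h.sy hba) hbc hcd had hne.symm hdb.symm
  have hsub : ({a, b, c, d} : Finset V) ⊆ R := by
    intro x hx; simp only [mem_insert, mem_singleton] at hx; rcases hx with rfl | rfl | rfl | rfl <;> assumption
  have djad : ∀ t ∈ T, r a t → r d t → False := fun t ht h1 h2 =>
    C.ext4T hsub pp.1 pp.2 ht (y := a) (y' := d) (by simp) (by simp) had (h.sy h1) (h.sy h2)
  refine ⟨a, c, d, ha, hb, hc, hd, h.sy hba, hbc, hcd, ha1, hb2, hc2, hd1, fun x hx hr => (hbu x hx hr).symm, hcu, had, hne.symm, hdb.symm, ?_, djad⟩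
  have k1 := C.kr ha
  have k2 := C.kr hb
  have k3 := C.kr hc
  have k4 := C.kr hd
  have dj := @C.t.dj
  have c1 : (((nb r T a ∪ nb r T b) ∪ nb r T c) ∪ nb r T d).card = 10 := by
    rw [card_union_of_disjoint, card_union_of_disjoint, card_union_of_disjoint]
    · change dg r T a + dg r T b + dg r T c + dg r T d = 10; omega
    · rw [Finset.disjoint_left]; intro x h1 h2; rw [mem_nb] at h1 h2
      exact h.c3 hba h1.2 h2.2
    · rw [Finset.disjoint_left]; intro x h1 h2; rw [mem_union, mem_nb, mem_nb] at h1; rw [mem_nb] at h2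
      rcases h1 with h1 | h1
      · have := h.c4 hba hbc (h.sy h1.2) (h.sy h2.2) hne.symm
        subst this; exact dj h1.1 hb
      · exact h.c3 hbc h2.2 h1.2
    · rw [Finset.disjoint_left]; intro x h1 h2; rw [mem_union, mem_union, mem_nb, mem_nb, mem_nb] at h1; rw [mem_nb] at h2
      rcases h1 with (h1 | h1) | h1
      · exact djad x h1.1 h1.2 h2.2
      · have := h.c4 (h.sy hbc) hcd (h.sy h1.2) (h.sy h2.2) hdb.symm
        subst this; exact dj h1.1 hc
      · exact h.c3 hcd h2.2 h1.2
  have hT : ((nb r T a ∪ nb r T b) ∪ nb r T c) ∪ nb r T d = T := by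
    apply eq_of_subset_of_card_le
    · intro x hx; simp only [mem_union, mem_nb] at hx; tauto
    · rw [c1, C.hT]
  intro t ht
  rw [← hT] at ht
  simp only [mem_union, mem_nb] at ht
  tauto

lemma p4g (C : C23 r S T R) {a b c d : V} (P : P4s r T R a b c d) : ∀ t ∈ T, r c t → dg r T t ≤ 1 := by
  have h := C.h
  have dj := @C.t.dj
  intro t ht hct
  have inA : ∀ x ∈ T, r t x → r a x := by
    intro x hx hr
    rcases P.cov x hx with h1 | h1 | h1 | h1
    · exact h1
    · have := h.c4 (h.sy hr |> fun q => q) (h.sy h1) hct (h.sy P.bc) (by rintro rfl; exact dj ht P.bR)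
      subst this; exact absurd P.cR (dj hx)
    · exact absurd (h.c3 hct hr h1) id
    · have := h.c4 (h.sy hr) (h.sy h1) hct P.cd (by rintro rfl; exact dj ht P.dR)
      subst this; exact absurd P.cR (dj hx)
  by_contra hc
  obtain ⟨x, hx, y, hy, hne, h1, h2⟩ := two_of_le (r := r) (X := T) (v := t) (by omega)
  have := h.c4 h1 h2 (inA x hx h1) (inA y hy h2) hne
  subst this
  exact dj ht P.aR

lemma p4m (C : C23 r S T R) {a b c d : V} (P : P4s r T R a b c d) :
    ∃ t ∈ T, r a t ∧ dg r T t ≤ 1 := by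
  have h := C.h
  have i := C.t.iR P.cR
  have kc := C.kr P.cR
  have kb := C.kr P.bR
  have kd := C.kr P.dR
  have e1 : ∑ w ∈ nb r T c, dg r T w ≤ ∑ w ∈ nb r T c, 1 :=
    sum_le_sum fun w hw => C.p4g P w (mem_nb.1 hw).1 (mem_nb.1 hw).2
  simp at e1
  change _ ≤ dg r T c at e1
  have e2 : ∑ w ∈ nb r R c, dg r T w = dg r T b + dg r T d := by
    have : nb r R c = {b, d} := by
      ext x
      simp only [mem_nb, mem_insert, mem_singleton]
      constructor
      · rintro ⟨h1, h2⟩; exact P.cu x h1 h2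
      · rintro (rfl | rfl)
        · exact ⟨P.bR, h.sy P.bc⟩
        · exact ⟨P.dR, P.cd⟩
    rw [this, sum_pair P.ne3]
  rw [C.hT] at i
  have p1 := P.b2
  have p2 := P.c2
  have p3 := P.d1
  obtain ⟨t, ht⟩ := card_pos.1 (show 0 < (ms r S T c).card by omega)
  have hs := ms_symm h ht (C.t.Rs P.cR)
  rw [mem_ms] at ht
  have g := C.gm ht.1
  have := card_pos.2 ⟨_, hs⟩
  refine ⟨t, ht.1, ?_, by omega⟩
  rcases P.cov t ht.1 with h1 | h1 | h1 | h1
  · exact h1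
  · exact absurd h1 (ht.2.2.2 b (C.t.Rs P.bR) (h.sy P.bc))
  · exact absurd h1 ht.2.2.1
  · exact absurd h1 (ht.2.2.2 d (C.t.Rs P.dR) P.cd)

/-- the low-degree vertices of `T` -/
lemma p4U (C : C23 r S T R) {a b c d : V} (P : P4s r T R a b c d) (X : Finset V) 
    (hX : ∀ x ∈ X, x ∈ T ∧ dg r T x ≤ 1 ∧ (r a x ∨ r d x)) :
    4 + X.card ≤ (T.filter (fun x => dg r T x ≤ 1)).card := by
  have h := C.h
  have dj := @C.t.dj
  have kc := C.kr P.cR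
  have kb := C.kr P.bR
  have p1 := P.b2
  have p2 := P.c2
  have : ((nb r T b ∪ nb r T c) ∪ X).card = 4 + X.card := by
    rw [card_union_of_disjoint, card_union_of_disjoint]
    · change dg r T b + dg r T c + _ = _; omega
    · rw [Finset.disjoint_left]; intro x h1 h2; rw [mem_nb] at h1 h2
      exact h.c3 P.bc h2.2 h1.2
    · rw [Finset.disjoint_left]; intro x h1 h2; rw [mem_union, mem_nb, mem_nb] at h1
      obtain ⟨h3, h4, h5⟩ := hX x h2
      rcases h1 with h1 | h1 <;> rcases h5 with h5 | h5
      · exact h.c3 P.ab h1.2 h5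
      · have := h.c4 (h.sy h1.2) (h.sy h5) (h.sy P.bc) P.cd P.ne3
        subst this; exact dj h3 P.cR
      · have := h.c4 (h.sy h1.2) (h.sy h5) P.bc (h.sy P.ab) P.ne2.symm
        subst this; exact dj h3 P.bR
      · exact h.c3 P.cd h5 h1.2
  rw [← this]
  apply card_le_card
  intro x hx
  rw [mem_union, mem_union, mem_nb, mem_nb] at hx
  rw [mem_filter]
  rcases hx with (hx | hx) | hx
  · exact ⟨hx.1, C.p4g (P.rev h) x hx.1 hx.2⟩
  · exact ⟨hx.1, C.p4g P x hx.1 hx.2⟩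
  · exact ⟨(hX x hx).1, (hX x hx).2.1⟩

lemma p4six (C : C23 r S T R) {a b c d : V} (P : P4s r T R a b c d) :
    6 ≤ (T.filter (fun x => dg r T x ≤ 1)).card := by
  obtain ⟨t, ht, hat, hg⟩ := C.p4m P
  obtain ⟨t', ht', hat', hg'⟩ := C.p4m (P.rev C.h)
  have := C.p4U P {t, t'} (by
    intro x hx; simp only [mem_insert, mem_singleton] at hx
    rcases hx with rfl | rfl
    · exact ⟨ht, hg, Or.inl hat⟩
    · exact ⟨ht', hg', Or.inr hat'⟩)
  rw [card_pair (by rintro rfl; exact P.djad t ht hat hat')] at this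
  omega
lemma p4Q1 (C : C23 r S T R) {a b c d : V} (P : P4s r T R a b c d) 
    (hU : (T.filter (fun x => dg r T x ≤ 1)).card ≤ 6) {q : V} (hq : q ∈ T) (hq2 : 2 ≤ dg r T q) (haq : r a q) :
    ∃ q' ∈ T, q' ≠ q ∧ 2 ≤ dg r T q' ∧ r a q' ∧ ∃ e ∈ T, dg r T e ≤ 1 ∧ r a e := by
  obtain ⟨t, ht, hat, hg⟩ := C.p4m P
  obtain ⟨t', ht', hat', hg'⟩ := C.p4m (P.rev C.h)
  have k := C.kr P.aR
  have k2 := P.a1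
  have : 0 < ((nb r T a).erase t |>.erase q).card := by
    have h1 := pred_card_le_card_erase (s := (nb r T a).erase t) (a := q)
    have h2 := pred_card_le_card_erase (s := (nb r T a)) (a := t)
    unfold dg at k k2
    omega
  obtain ⟨y, hy⟩ := card_pos.1 this
  simp only [mem_erase, mem_nb] at hy
  obtain ⟨h1, h2, h3, h4⟩ := hy
  refine ⟨y, h3, h1, ?_, h4, t, ht, hg, hat⟩
  by_contra hc
  have := C.p4U P {t, t', y} (by
    intro x hx; simp only [mem_insert, mem_singleton] at hx
    rcases hx with rfl | rfl | rfl
    · exact ⟨ht, hg, Or.inl hat⟩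
    · exact ⟨ht', hg', Or.inr hat'⟩
    · exact ⟨h3, by omega, Or.inl h4⟩)
  have hne : t ≠ t' := by rintro rfl; exact P.djad t ht hat hat'
  have hne' : t' ≠ y := by rintro rfl; exact P.djad _ h3 h4 hat'
  rw [card_eq_three.2 ⟨t, t', y, hne, h2.symm, hne', rfl⟩] at this
  omega
lemma p4Q (C : C23 r S T R) {a b c d : V} (P : P4s r T R a b c d) 
    (hU : (T.filter (fun x => dg r T x ≤ 1)).card ≤ 6) {q : V} (hq : q ∈ T) (hq2 : 2 ≤ dg r T q) :
    ∃ z ∈ R, (z = a ∨ z = d) ∧ r z q ∧ 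
    ∃ q' ∈ T, q' ≠ q ∧ 2 ≤ dg r T q' ∧ r z q' ∧ ∃ e ∈ T, dg r T e ≤ 1 ∧ r z e := by
  rcases P.cov q hq with h1 | h1 | h1 | h1
  · exact ⟨a, P.aR, Or.inl rfl, h1, C.p4Q1 P hU hq hq2 h1⟩
  · have := C.p4g (P.rev C.h) q hq h1; omega
  · have := C.p4g P q hq h1; omega
  · exact ⟨d, P.dR, Or.inr rfl, h1, C.p4Q1 (P.rev C.h) hU hq hq2 h1⟩

/-- numerical consequences -/
lemma nums (C : C23 r S T R) : E2 r T = 14 ∧ (∀ x ∈ T, 1 ≤ dg r T x) ∧ 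
    (R.filter (fun v => dg r R v = 2)).card = 4 ∧ (R.filter (fun v => dg r R v = 1)).card = 8 ∧ 
    (R.filter (fun v => dg r R v = 3)).card = 0 ∧ 
    (T.filter (fun x => dg r T x ≤ 1)).card = 6 ∧ (T.filter (fun x => dg r T x = 2)).card = 4 := by
  have h := C.h
  have hr3 : ∀ v ∈ R, dg r R v ≤ 3 := fun v hv => C.r3 hv
  have hg2 : ∀ v ∈ T, dg r T v ≤ 3 := fun v hv => by have := C.gm hv; omega
  obtain ⟨m, hm⟩ := E2_even h T
  have H1 := hist hr3 (fun _ => 1)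
  have H2 : ∑ v ∈ R, dg r T v = ∑ v ∈ R, (4 - dg r R v) := sum_congr rfl fun v hv => by have := C.kr hv; omega
  have H3 : ∑ v ∈ R, dg r T v * dg r T v = ∑ v ∈ R, (4 - dg r R v) * (4 - dg r R v) := sum_congr rfl fun v hv => by
    have : dg r T v = 4 - dg r R v := by have := C.kr hv; omega
    rw [this]
  rw [hist hr3 (fun x => 4 - x)] at H2
  rw [hist hr3 (fun x => (4 - x) * (4 - x))] at H3
  have G1 := hist hg2 (fun _ => 1)
  have G2 := hist hg2 (fun x => x)
  have G3 := hist hg2 (fun x => x * x)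
  have sq := C.t.sq
  have sc := C.t.sc
  have z3 : (T.filter (fun v => dg r T v = 3)).card = 0 := by
    rw [card_eq_zero, filter_eq_empty_iff]; intro v hv; have := C.gm hv; omega
  set L := R.filter (fun v => dg r R v = 1) with hL
  set M2 := R.filter (fun v => dg r R v = 2) with hM2
  set M3 := R.filter (fun v => dg r R v = 3) with hM3
  have mL : ∀ {x}, x ∈ L ↔ x ∈ R ∧ dg r R x = 1 := by simp [hL]
  have mM2 : ∀ {x}, x ∈ M2 ↔ x ∈ R ∧ dg r R x = 2 := by simp [hM2]
  have mM3 : ∀ {x}, x ∈ M3 ↔ x ∈ R ∧ dg r R x = 3 := by simp [hM3]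
  have ev : ∃ e, M2.card = 2 * e := by
    obtain ⟨e, he⟩ := E2_even h M2
    refine ⟨e, ?_⟩
    rw [← he]
    unfold E2
    rw [sum_congr (g := fun _ => 1) rfl]
    · simp
    · intro b hb
      obtain ⟨hbR, hb2⟩ := mM2.1 hb
      obtain ⟨w, hw, w', hw', hne, h1, h2, h3, h4, h5⟩ := C.r2nb hbR hb2
      have : nb r M2 b = {w} := by
        ext x
        simp only [mem_nb, mem_singleton, mM2]
        constructor
        · rintro ⟨⟨x1, x2⟩, x3⟩
          rcases h5 x x1 x3 with e | e
          · exact e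
          · subst e; omega
        · rintro rfl; exact ⟨⟨hw, h3⟩, h1⟩
      unfold dg; rw [this]; simp
  have lf : M2.card + 3 * M3.card ≤ L.card := by
    have dj : Disjoint M2 M3 := by
      rw [Finset.disjoint_left]; intro x h1 h2; rw [mM2] at h1; rw [mM3] at h2; omega
    have e1 : ∑ v ∈ L, dg r (M2 ∪ M3) v ≤ ∑ v ∈ L, 1 := sum_le_sum fun v hv => by
      rw [← (mL.1 hv).2]; apply dg_mono
      exact union_subset (filter_subset _ _) (filter_subset _ _)
    rw [sum_dg_comm h, sum_union dj] at e1
    have e2 : ∑ v ∈ M2, 1 ≤ ∑ v ∈ M2, dg r L v := sum_le_sum fun v hv => by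
      obtain ⟨hbR, hb2⟩ := mM2.1 hv
      obtain ⟨w, hw, w', hw', hne, h1, h2, h3, h4, h5⟩ := C.r2nb hbR hb2
      exact dg_pos.2 ⟨w', mL.2 ⟨hw', h4⟩, h2⟩
    have e3 : ∑ v ∈ M3, 3 ≤ ∑ v ∈ M3, dg r L v := sum_le_sum fun v hv => by
      rw [← (mM3.1 hv).2]
      apply card_le_card
      intro x hx
      rw [mem_nb] at *
      exact ⟨mL.2 ⟨hx.1, C.r3nb (mM3.1 hv).1 hx.1 (mM3.1 hv).2 hx.2⟩, hx.2⟩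
    simp at e1 e2 e3
    omega
  have p4c : 0 < M2.card → 6 ≤ (T.filter (fun x => dg r T x ≤ 1)).card := by
    intro hp
    obtain ⟨b, hb⟩ := card_pos.1 hp
    obtain ⟨a, c, d, P⟩ := C.p4 (mM2.1 hb).1 (mM2.1 hb).2
    exact C.p4six P
  have Uc : (T.filter (fun x => dg r T x ≤ 1)).card = (T.filter (fun x => dg r T x = 0)).card + (T.filter (fun x => dg r T x = 1)).card := by
    rw [← card_union_of_disjoint]
    · congr 1; ext x; simp only [mem_filter, mem_union]; 
      constructor
      · rintro ⟨h1, h2⟩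
        rcases Nat.le_one_iff_eq_zero_or_eq_one.1 h2 with h3 | h3
        · exact Or.inl ⟨h1, h3⟩
        · exact Or.inr ⟨h1, h3⟩
      · rintro (⟨h1, h2⟩ | ⟨h1, h2⟩)
        · exact ⟨h1, by omega⟩
        · exact ⟨h1, by omega⟩
    · rw [Finset.disjoint_left]; intro x h1 h2; rw [mem_filter] at h1 h2; omega
  have hm' : ∑ v ∈ T, dg r T v = 2 * m := hm
  obtain ⟨e, he⟩ := ev
  simp only [sum_const, smul_eq_mul, C.hR, C.hT] at H1 G1 sq sc
  norm_num at H2 H3 H1 G1 G2 G3 sq sc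
  have fin : m = 7 ∧ (T.filter (fun x => dg r T x = 0)).card = 0 ∧ M2.card = 4 ∧ L.card = 8 ∧ M3.card = 0 ∧
    (T.filter (fun x => dg r T x ≤ 1)).card = 6 ∧ (T.filter (fun x => dg r T x = 2)).card = 4 := by
    have hm7 : 7 ≤ m := by omega
    have hm8 : m ≤ 8 := by omega
    have hM2 : 0 < M2.card := by omega
    have := p4c hM2
    omega
  obtain ⟨f1, f2, f3, f4, f5, f6, f7⟩ := fin
  refine ⟨by omega, ?_, f3, f4, f5, f6, f7⟩
  intro x hx
  by_contra hc
  rw [card_eq_zero, filter_eq_empty_iff] at f2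
  exact f2 hx (by omega)
end C23
end Q19

namespace Q19
open scoped Classical
open Finset
variable {V : Type} {r : V → V → Prop}
namespace C23
variable {S T R : Finset V}

lemma k2 (C : C23 r S T R) {v w : V} (hv : v ∈ R) (hw : w ∈ R) (hv1 : dg r R v = 1) (hw1 : dg r R w = 1) (hvw : r v w) :
    ∃ q ∈ T, dg r T q = 2 ∧ (r v q ∨ r w q) ∧ ∀ q' ∈ T, dg r T q' = 2 → q' ≠ q → ¬ r v q' ∧ ¬ r w q' ∧
      ∃ s ∈ T, ∃ s' ∈ T, s ≠ s' ∧ r q' s ∧ r v s ∧ r q' s' ∧ r w s' ∧ ∀ x ∈ T, r q' x → x = s ∨ x = s' := by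
  have h := C.h
  have dj := @C.t.dj
  obtain ⟨n1, n2, -, -, -, -, n3⟩ := C.nums
  have kv := C.kr hv
  have kw := C.kr hw
  set Z := nb r T v ∪ nb r T w with hZ
  have mZ : ∀ {x}, x ∈ Z ↔ x ∈ T ∧ (r v x ∨ r w x) := by
    intro x; simp only [hZ, mem_union, mem_nb]; tauto
  have hZT : Z ⊆ T := fun x hx => (mZ.1 hx).1
  have hZc : Z.card = 6 := by
    rw [hZ, card_union_of_disjoint]
    · change dg r T v + dg r T w = 6; omega
    · rw [Finset.disjoint_left]; intro x h1 h2; rw [mem_nb] at h1 h2; exact h.c3 hvw h2.2 h1.2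
  set Y := T \ Z with hY
  have mY : ∀ {x}, x ∈ Y ↔ x ∈ T ∧ ¬ r v x ∧ ¬ r w x := by
    intro x; simp only [hY, mem_sdiff, mZ]; tauto
  have hYc : Y.card = 4 := by
    have := card_sdiff_add_card_eq_card hZT; rw [C.hT] at this; change Y.card + _ = _ at this; omega
  have uv : ∀ x ∈ R, r v x → x = w := fun x hx hr => dg_le_one hv1.le hx hw hr hvw
  have uw : ∀ x ∈ R, r w x → x = v := fun x hx hr => dg_le_one hw1.le hx hv hr (h.sy hvw)
  have YY : ∀ y ∈ Y, ∃ e1 ∈ nb r T y ∪ ms r S S y, ∃ e2 ∈ nb r T y ∪ ms r S S y, e1 ≠ e2 ∧ (e1 = v ∨ (e1 ∈ T ∧ r v e1)) ∧ (e2 = w ∨ (e2 ∈ T ∧ r w e2)) ∧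
      ∀ x ∈ nb r T y, x = e1 ∨ x = e2 := by
    intro y hy
    obtain ⟨y1, y2, y3⟩ := mY.1 hy
    obtain ⟨e1, he1, x1⟩ := C.reach hv y1 y2 (fun x hx hr => by rw [uv x hx hr]; exact y3)
    obtain ⟨e2, he2, x2⟩ := C.reach hw y1 y3 (fun x hx hr => by rw [uw x hx hr]; exact y2)
    have hne : e1 ≠ e2 := by
      rintro rfl
      rcases x1 with rfl | ⟨a, b⟩ <;> rcases x2 with rfl | ⟨c, d⟩
      · exact h.ir hvw
      · exact dj c hv
      · exact dj a hw
      · exact h.c3 hvw d b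
    refine ⟨e1, he1, e2, he2, hne, x1, x2, ?_⟩
    intro x hx
    by_contra hc
    push Not at hc
    have := C.reach_card y1
    have : 2 < (nb r T y ∪ ms r S S y).card := two_lt_card.2 ⟨e1, he1, e2, he2, x, mem_union_left _ hx, hne, hc.1.symm, hc.2.symm⟩
    omega
  have YZ : ∀ y ∈ Y, dg r T y = dg r Z y := by
    intro y hy
    obtain ⟨e1, -, e2, -, -, x1, x2, x3⟩ := YY y hy
    unfold dg; congr 1; ext x
    constructor
    · intro hx
      have hx' := mem_nb.1 hx
      refine mem_nb.2 ⟨mZ.2 ⟨hx'.1, ?_⟩, hx'.2⟩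
      rcases x3 x hx with rfl | rfl
      · rcases x1 with rfl | h1
        · exact absurd hv (dj hx'.1)
        · exact Or.inl h1.2
      · rcases x2 with rfl | h1
        · exact absurd hw (dj hx'.1)
        · exact Or.inr h1.2
    · intro hx; rw [mem_nb] at *; exact ⟨hZT hx.1, hx.2⟩
  have ZY : ∀ z ∈ Z, dg r T z = dg r Y z := by
    intro z hz
    have : dg r Z z = 0 := by
      by_contra hc
      obtain ⟨x, hx, hr⟩ := dg_pos.1 (Nat.pos_of_ne_zero hc)
      rw [mZ] at hz hx
      obtain ⟨hz0, hz⟩ := hz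
      obtain ⟨hx0, hx⟩ := hx
      rcases hz with hz | hz <;> rcases hx with hx | hx
      · exact h.c3 hz hr hx
      · have := h.c4 hz hvw (h.sy hr) (h.sy hx) (by rintro rfl; exact dj hz0 hw)
        subst this; exact dj hx0 hv
      · have := h.c4 hz (h.sy hvw) (h.sy hr) (h.sy hx) (by rintro rfl; exact dj hz0 hv)
        subst this; exact dj hx0 hw
      · exact h.c3 hz hr hx
    have := dg_sdiff (r := r) hZT z
    change dg r Y z + _ = _ at this
    omega
  have s1 : ∑ y ∈ Y, dg r T y = 7 := by
    have e1 : ∑ y ∈ Y, dg r T y = ∑ y ∈ Y, dg r Z y := sum_congr rfl YZ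
    have e2 : ∑ y ∈ Z, dg r T y = ∑ y ∈ Z, dg r Y y := sum_congr rfl ZY
    have e3 := sum_dg_comm h Y Z
    have e4 : ∑ y ∈ Y, dg r T y + ∑ y ∈ Z, dg r T y = E2 r T := sum_sdiff hZT
    omega
  have s2 : (Y.filter (fun x => dg r T x = 2)).card = 3 := by
    have : ∑ y ∈ Y, dg r T y = ∑ y ∈ Y, (1 + if dg r T y = 2 then 1 else 0) := sum_congr rfl fun y hy => by
      have a1 := n2 y (mY.1 hy).1
      have a2 := C.gm (mY.1 hy).1
      split_ifs <;> omega
    rw [sum_add_distrib, ← card_filter] at this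
    simp [hYc] at this
    omega
  have s3 : (Z.filter (fun x => dg r T x = 2)).card = 1 := by
    have : (T.filter (fun x => dg r T x = 2)).card = (Y.filter (fun x => dg r T x = 2)).card + (Z.filter (fun x => dg r T x = 2)).card := by
      simp only [card_filter]; exact (sum_sdiff hZT).symm
    omega
  obtain ⟨q, hq⟩ := card_eq_one.1 s3
  have mq : ∀ x, (x ∈ Z ∧ dg r T x = 2) ↔ x = q := by
    intro x; rw [← mem_filter (s := Z) (p := fun x => dg r T x = 2), hq, mem_singleton]
  obtain ⟨hqZ, hq2⟩ := (mq q).2 rfl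
  refine ⟨q, (mZ.1 hqZ).1, hq2, (mZ.1 hqZ).2, ?_⟩
  intro q' hq' hq2' hne
  have hqY : q' ∈ Y := by
    rw [hY, mem_sdiff]; exact ⟨hq', fun hh => hne ((mq q').1 ⟨hh, hq2'⟩)⟩
  obtain ⟨e1, he1, e2, he2, hne', x1, x2, x3⟩ := YY q' hqY
  have hms : ms r S S q' = ∅ := by rw [← card_eq_zero]; have := C.gm hq'; omega
  rw [hms, union_empty, mem_nb] at he1 he2
  refine ⟨(mY.1 hqY).2.1, (mY.1 hqY).2.2, e1, he1.1, e2, he2.1, hne', he1.2, ?_, he2.2, ?_, ?_⟩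
  · rcases x1 with rfl | x1
    · exact absurd hv (dj he1.1)
    · exact x1.2
  · rcases x2 with rfl | x2
    · exact absurd hw (dj he2.1)
    · exact x2.2
  · intro x hx hr; exact x3 x (mem_nb.2 ⟨hx, hr⟩)

structure K2s (r : V → V → Prop) (T : Finset V) (v w q : V) : Prop where
  qT : q ∈ T
  q2 : dg r T q = 2
  vq : r v q
  ot : ∀ q' ∈ T, dg r T q' = 2 → q' ≠ q → ¬ r v q' ∧ ¬ r w q' ∧
      ∃ s ∈ T, ∃ s' ∈ T, s ≠ s' ∧ r q' s ∧ r v s ∧ r q' s' ∧ r w s' ∧ ∀ x ∈ T, r q' x → x = s ∨ x = s'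
lemma k2' (C : C23 r S T R) {v w : V} (hv : v ∈ R) (hw : w ∈ R) (hv1 : dg r R v = 1) (hw1 : dg r R w = 1) (hvw : r v w) :
    ∃ q, K2s r T v w q ∨ K2s r T w v q := by
  obtain ⟨q, h1, h2, h3 | h3, h4⟩ := C.k2 hv hw hv1 hw1 hvw
  · exact ⟨q, Or.inl ⟨h1, h2, h3, h4⟩⟩
  · refine ⟨q, Or.inr ⟨h1, h2, h3, ?_⟩⟩
    intro q' a b c
    obtain ⟨d, e, s, hs, s', hs', x0, x1, x2, x3, x4, x5⟩ := h4 q' a b c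
    exact ⟨e, d, s', hs', s, hs, x0.symm, x3, x4, x1, x2, fun x hx hr => (x5 x hx hr).symm⟩

/-- two disjoint single edges of R away from M2 -/
lemma twoK (C : C23 r S T R) : ∃ v1 ∈ R, ∃ w1 ∈ R, ∃ v2 ∈ R, ∃ w2 ∈ R, dg r R v1 = 1 ∧ dg r R w1 = 1 ∧ dg r R v2 = 1 ∧ dg r R w2 = 1 ∧
    r v1 w1 ∧ r v2 w2 ∧ v1 ≠ v2 ∧ v1 ≠ w2 ∧ w1 ≠ v2 ∧ w1 ≠ w2 := by
  have h := C.h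
  obtain ⟨-, -, n1, n2, n3, -, -⟩ := C.nums
  set L := R.filter (fun v => dg r R v = 1) with hL
  set M2 := R.filter (fun v => dg r R v = 2) with hM2
  have mL : ∀ {x}, x ∈ L ↔ x ∈ R ∧ dg r R x = 1 := by simp [hL]
  have mM2 : ∀ {x}, x ∈ M2 ↔ x ∈ R ∧ dg r R x = 2 := by simp [hM2]
  set L' := L.filter (fun v => dg r M2 v = 0) with hL'
  have mL' : ∀ {x}, x ∈ L' ↔ x ∈ L ∧ dg r M2 x = 0 := by simp [hL']
  have c1 : ∑ v ∈ L, dg r M2 v = 4 := by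
    rw [sum_dg_comm h, sum_congr (g := fun _ => 1) rfl]
    · simp [n1]
    · intro b hb
      obtain ⟨hbR, hb2⟩ := mM2.1 hb
      obtain ⟨w, hw, w', hw', hne, h1, h2, h3, h4, h5⟩ := C.r2nb hbR hb2
      have : nb r L b = {w'} := by
        ext x
        simp only [mem_nb, mem_singleton, mL]
        constructor
        · rintro ⟨⟨x1, x2⟩, x3⟩
          rcases h5 x x1 x3 with e | e
          · subst e; omega
          · exact e
        · rintro rfl; exact ⟨⟨hw', h4⟩, h2⟩
      unfold dg; rw [this]; simp
  have c2 : 2 < L'.card := by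
    have : ∑ v ∈ L, (dg r M2 v + if dg r M2 v = 0 then 1 else 0) = ∑ v ∈ L, 1 := sum_congr rfl fun v hv => by
      have h1 : dg r M2 v ≤ 1 := by rw [← (mL.1 hv).2]; exact dg_mono (filter_subset _ _) v
      split_ifs <;> omega
    rw [sum_add_distrib, ← card_filter] at this
    simp at this
    change _ + L'.card = _ at this; omega
  have step : ∀ v ∈ L', ∃ w ∈ L', r v w := by
    intro v hv
    obtain ⟨h1, h2⟩ := mL'.1 hv
    obtain ⟨hvR, hv1⟩ := mL.1 h1
    obtain ⟨w, hw, hvw, hu⟩ := dg_one hv1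
    have hw3 := C.r3 hw
    have hw0 := dg_pos.2 ⟨v, hvR, h.sy hvw⟩
    have hw2 : dg r R w ≠ 2 := fun hh => dg_zero h2 w (mM2.2 ⟨hw, hh⟩) hvw
    have hw3' : dg r R w ≠ 3 := by
      rw [card_eq_zero, filter_eq_empty_iff] at n3
      exact n3 hw
    have hw1 : dg r R w = 1 := by omega
    refine ⟨w, mL'.2 ⟨mL.2 ⟨hw, hw1⟩, ?_⟩, hvw⟩
    by_contra hc
    obtain ⟨x, hx, hr⟩ := dg_pos.1 (Nat.pos_of_ne_zero hc)
    have := dg_le_one hw1.le (mM2.1 hx).1 hvR hr (h.sy hvw)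
    subst this
    have := (mM2.1 hx).2
    omega
  obtain ⟨v1, hv1⟩ := card_pos.1 (show 0 < L'.card by omega)
  obtain ⟨w1, hw1, hvw1⟩ := step v1 hv1
  obtain ⟨v2, hv2⟩ := card_pos.1 (show 0 < ((L'.erase v1).erase w1).card by
    have h1 := pred_card_le_card_erase (s := L'.erase v1) (a := w1)
    have h2 := pred_card_le_card_erase (s := L') (a := v1)
    omega)
  simp only [mem_erase] at hv2
  obtain ⟨w2, hw2, hvw2⟩ := step v2 hv2.2.2
  have d : ∀ x ∈ L', x ∈ R ∧ dg r R x = 1 := fun x hx => mL.1 (mL'.1 hx).1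
  refine ⟨v1, (d _ hv1).1, w1, (d _ hw1).1, v2, (d _ hv2.2.2).1, w2, (d _ hw2).1, (d _ hv1).2, (d _ hw1).2, (d _ hv2.2.2).2, (d _ hw2).2,
    hvw1, hvw2, hv2.2.1.symm, ?_, hv2.1.symm, ?_⟩
  · rintro rfl
    exact hv2.1 (dg_le_one (d _ hv1).2.le (d _ hv2.2.2).1 (d _ hw1).1 (h.sy hvw2) hvw1)
  · rintro rfl
    exact hv2.2.1 (dg_le_one (d _ hw1).2.le (d _ hv2.2.2).1 (d _ hv1).1 (h.sy hvw2) (h.sy hvw1))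

lemma twoP (C : C23 r S T R) : ∃ a1 b1 c1 d1 a2 b2 c2 d2, P4s r T R a1 b1 c1 d1 ∧ P4s r T R a2 b2 c2 d2 ∧
    a1 ≠ a2 ∧ a1 ≠ d2 ∧ d1 ≠ a2 ∧ d1 ≠ d2 := by
  have h := C.h
  obtain ⟨-, -, n1, n2, n3, -, -⟩ := C.nums
  obtain ⟨b1, hb1⟩ := card_pos.1 (show 0 < (R.filter (fun v => dg r R v = 2)).card by omega)
  obtain ⟨a1, c1, d1, P⟩ := C.p4 (mem_filter.1 hb1).1 (mem_filter.1 hb1).2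
  obtain ⟨b2, hb2⟩ := card_pos.1 (show 0 < (((R.filter (fun v => dg r R v = 2)).erase b1).erase c1).card by
    have h1 := pred_card_le_card_erase (s := (R.filter (fun v => dg r R v = 2)).erase b1) (a := c1)
    have h2 := pred_card_le_card_erase (s := (R.filter (fun v => dg r R v = 2))) (a := b1)
    omega)
  simp only [mem_erase, mem_filter] at hb2
  obtain ⟨n1, n2, hb2R, hb22⟩ := hb2
  obtain ⟨a2, c2, d2, P'⟩ := C.p4 hb2R hb22
  have e1 : c2 ≠ b1 := by
    rintro rfl
    rcases P.bu b2 hb2R (h.sy P'.bc) with e | e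
    · rw [e] at hb22; have := P.a1; omega
    · exact n1 e
  have e2 : c2 ≠ c1 := by
    rintro rfl
    rcases P.cu b2 hb2R (h.sy P'.bc) with e | e
    · exact n2 e
    · rw [e] at hb22; have := P.d1; omega
  refine ⟨a1, b1, c1, d1, a2, b2, c2, d2, P, P', ?_, ?_, ?_, ?_⟩
  · rintro rfl; exact n2 (dg_le_one P.a1.le P'.bR P.bR P'.ab P.ab)
  · rintro rfl; exact e1 (dg_le_one P.a1.le P'.cR P.bR (h.sy P'.cd) P.ab)
  · rintro rfl; exact n1 (dg_le_one P.d1.le P'.bR P.cR P'.ab (h.sy P.cd))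
  · rintro rfl; exact e2 (dg_le_one P.d1.le P'.cR P.cR (h.sy P'.cd) (h.sy P.cd))
end C23
end Q19

namespace Q19
open scoped Classical
open Finset
variable {V : Type} {r : V → V → Prop}
namespace C23
variable {S T R : Finset V}

structure Zp (r : V → V → Prop) (T R : Finset V) (z q : V) : Prop where
  zR : z ∈ R
  z1 : dg r R z = 1
  nb : ∃ b ∈ R, dg r R b = 2 ∧ r z b
  zq : r z q
  q' : ∃ q' ∈ T, q' ≠ q ∧ dg r T q' = 2 ∧ r z q'
  e : ∃ e ∈ T, dg r T e ≤ 1 ∧ r z e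

lemma zp1 (C : C23 r S T R) {a b c d q : V} (P : P4s r T R a b c d) (hq : q ∈ T) (hq2 : dg r T q = 2) :
    ∃ z, (z = a ∨ z = d) ∧ Zp r T R z q := by
  have h := C.h
  obtain ⟨-, -, -, -, -, n1, -⟩ := C.nums
  obtain ⟨z, zR, had, zq, q', hq', hne, h2, zq', he⟩ := C.p4Q P n1.le hq hq2.ge
  have := C.gm hq'
  refine ⟨z, had, zR, ?_, ?_, zq, ⟨q', hq', hne, by omega, zq'⟩, he⟩
  · rcases had with rfl | rfl
    · exact P.a1
    · exact P.d1
  · rcases had with rfl | rfl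
    · exact ⟨b, P.bR, P.b2, P.ab⟩
    · exact ⟨c, P.cR, P.c2, h.sy P.cd⟩

lemma zpp (C : C23 r S T R) {q : V} (hq : q ∈ T) (hq2 : dg r T q = 2) :
    ∃ z z', z ≠ z' ∧ Zp r T R z q ∧ Zp r T R z' q := by
  obtain ⟨a1, b1, c1, d1, a2, b2, c2, d2, P, P', n1, n2, n3, n4⟩ := C.twoP
  obtain ⟨z, hz, Z⟩ := C.zp1 P hq hq2
  obtain ⟨z', hz', Z'⟩ := C.zp1 P' hq hq2
  refine ⟨z, z', ?_, Z, Z'⟩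
  rcases hz with rfl | rfl <;> rcases hz' with rfl | rfl <;> assumption

lemma zpne {z q v w : V} (Z : Zp r T R z q) (hw : w ∈ R) (hw1 : dg r R w = 1) (hvw : r v w) : z ≠ v := by
  rintro rfl
  obtain ⟨b, hb, hb2, hzb⟩ := Z.nb
  have := dg_le_one Z.z1.le hb hw hzb hvw
  subst this
  omega

lemma one (C : C23 r S T R) {q p x y v s s' u u' z : V} (hq2 : dg r T q = 2) (hpT : p ∈ T) (hqp : r q p)
    (hQ : ∀ f ∈ T, dg r T f = 2 → f = q ∨ f = p ∨ f = x ∨ f = y)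
    (hU : ∀ e ∈ T, dg r T e ≤ 1 → ∃ f ∈ T, dg r T f = 2 ∧ r e f)
    (hx : ∀ t ∈ T, r x t → t = s ∨ t = s') (hy : ∀ t ∈ T, r y t → t = u ∨ t = u')
    (hvs : r v s) (hvu : r v u) (hvq : r v q) (hne : z ≠ v) (Z : Zp r T R z q) :
    (r z x ∧ r z u') ∨ (r z y ∧ r z s') := by
  have h := C.h
  obtain ⟨q', hq', hqq, h2, zq'⟩ := Z.q'
  obtain ⟨e, he, he1, hze⟩ := Z.e
  obtain ⟨f, hf, hf2, hef⟩ := hU e he he1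
  have zq := Z.zq
  have hqe : q ≠ e := by rintro rfl; omega
  have f1 : f ≠ q := by rintro rfl; exact h.c3 hze hef zq
  have f2 : f ≠ p := by
    rintro rfl
    have := h.c4 zq hze (h.sy hqp) (h.sy hef) hqe
    subst this
    exact C.t.dj hpT Z.zR
  have f3 : f ≠ q' := by rintro rfl; exact h.c3 hze hef zq'
  have g : ∀ t, r v t → e = t → False := by
    rintro t ht rfl
    exact hne (h.c4 zq hze hvq ht hqe)
  rcases hQ q' hq' h2 with e1 | e1 | e1 | e1
  · exact absurd e1 hqq
  · subst e1; exact (h.c3 zq hqp zq').elim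
  · subst e1
    left
    rcases hQ f hf hf2 with e2 | e2 | e2 | e2
    · exact absurd e2 f1
    · exact absurd e2 f2
    · exact absurd e2 f3
    · subst e2
      rcases hy e he (h.sy hef) with e3 | e3
      · exact (g _ hvu e3).elim
      · subst e3; exact ⟨zq', hze⟩
  · subst e1
    right
    rcases hQ f hf hf2 with e2 | e2 | e2 | e2
    · exact absurd e2 f1
    · exact absurd e2 f2
    · subst e2
      rcases hx e he (h.sy hef) with e3 | e3
      · exact (g _ hvs e3).elim
      · subst e3; exact ⟨zq', hze⟩
    · exact absurd e2 f3

lemma one2 (C : C23 r S T R) {q p x y v w s s' u u' : V} (hqT : q ∈ T) (hq2 : dg r T q = 2) (hpT : p ∈ T) (hqp : r q p)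
    (hqx : q ≠ x) (hqy : q ≠ y) (hw : w ∈ R) (hw1 : dg r R w = 1) (hvw : r v w)
    (hQ : ∀ f ∈ T, dg r T f = 2 → f = q ∨ f = p ∨ f = x ∨ f = y)
    (hU : ∀ e ∈ T, dg r T e ≤ 1 → ∃ f ∈ T, dg r T f = 2 ∧ r e f)
    (hx : ∀ t ∈ T, r x t → t = s ∨ t = s') (hy : ∀ t ∈ T, r y t → t = u ∨ t = u')
    (hvs : r v s) (hvu : r v u) (hvq : r v q) :
    (∃ z, r z q ∧ r z x ∧ r z u') ∧ (∃ z, r z q ∧ r z y ∧ r z s') := by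
  have h := C.h
  obtain ⟨z, z', hne, Z, Z'⟩ := C.zpp hqT hq2
  have o1 := C.one hq2 hpT hqp hQ hU hx hy hvs hvu hvq (zpne Z hw hw1 hvw) Z
  have o2 := C.one hq2 hpT hqp hQ hU hx hy hvs hvu hvq (zpne Z' hw hw1 hvw) Z'
  rcases o1 with o1 | o1 <;> rcases o2 with o2 | o2
  · exact absurd (h.c4 Z.zq o1.1 Z'.zq o2.1 hqx) hne
  · exact ⟨⟨z, Z.zq, o1⟩, ⟨z', Z'.zq, o2⟩⟩
  · exact ⟨⟨z', Z'.zq, o2⟩, ⟨z, Z.zq, o1⟩⟩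
  · exact absurd (h.c4 Z.zq o1.1 Z'.zq o2.1 hqy) hne

lemma fin (C : C23 r S T R) {v1 w1 v2 w2 q1 q2 : V} (K1 : K2s r T v1 w1 q1) (K2 : K2s r T v2 w2 q2)
    (hv1 : v1 ∈ R) (hw1 : w1 ∈ R) (hv2 : v2 ∈ R) (hw2 : w2 ∈ R) (hw11 : dg r R w1 = 1) (hw21 : dg r R w2 = 1)
    (r1 : r v1 w1) (r2 : r v2 w2) (n1 : v1 ≠ v2) (n2 : w1 ≠ v2) : False := by
  have h := C.h
  obtain ⟨-, m1, -, -, -, m2, m3⟩ := C.nums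
  have hq12 : q1 ≠ q2 := by
    rintro rfl
    obtain ⟨z, z', hne, Z, Z'⟩ := C.zpp K1.qT K1.q2
    have : ({z, z', v1, v2} : Finset V) ⊆ nb r R q1 := by
      intro x; simp only [mem_insert, mem_singleton, mem_nb]
      rintro (rfl | rfl | rfl | rfl)
      · exact ⟨Z.zR, h.sy Z.zq⟩
      · exact ⟨Z'.zR, h.sy Z'.zq⟩
      · exact ⟨hv1, h.sy K1.vq⟩
      · exact ⟨hv2, h.sy K2.vq⟩
    have := card_le_card this
    rw [card_insert_of_notMem, card_insert_of_notMem, card_pair n1] at this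
    · change _ ≤ dg r R q1 at this
      have := C.t.ds q1; have := C.t.dT K1.qT; have := K1.q2; omega
    · simp [zpne Z' hw1 hw11 r1, zpne Z' hw2 hw21 r2]
    · simp [zpne Z hw1 hw11 r1, zpne Z hw2 hw21 r2, hne]
  have ad1 : ∀ q ∈ T, dg r T q = 2 → ∀ n ∈ T, dg r T n = 2 → r q n → q ≠ q1 → n = q1 := by
    intro q hq hq2 n hn hn2 hqn hne
    by_contra hc
    obtain ⟨a, b, -⟩ := K1.ot n hn hn2 hc
    obtain ⟨-, -, s, hs, s', hs', -, -, x1, -, x2, x3⟩ := K1.ot q hq hq2 hne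
    rcases x3 n hn hqn with rfl | rfl
    · exact a x1
    · exact b x2
  have ad2 : ∀ q ∈ T, dg r T q = 2 → ∀ n ∈ T, dg r T n = 2 → r q n → q ≠ q2 → n = q2 := by
    intro q hq hq2 n hn hn2 hqn hne
    by_contra hc
    obtain ⟨a, b, -⟩ := K2.ot n hn hn2 hc
    obtain ⟨-, -, s, hs, s', hs', -, -, x1, -, x2, x3⟩ := K2.ot q hq hq2 hne
    rcases x3 n hn hqn with rfl | rfl
    · exact a x1
    · exact b x2
  have ad : ∀ q ∈ T, dg r T q = 2 → ∀ n ∈ T, dg r T n = 2 → r q n → (q = q1 ∧ n = q2) ∨ (q = q2 ∧ n = q1) := by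
    intro q hq hq2 n hn hn2 hqn
    by_cases e1 : q = q1
    · left; exact ⟨e1, ad2 q hq hq2 n hn hn2 hqn (by rw [e1]; exact hq12)⟩
    · have := ad1 q hq hq2 n hn hn2 hqn e1
      right; refine ⟨?_, this⟩
      by_contra e2
      exact hq12 (this.symm.trans (ad2 q hq hq2 n hn hn2 hqn e2))
  set Q := T.filter (fun x => dg r T x = 2) with hQ
  set U := T.filter (fun x => dg r T x ≤ 1) with hU
  have mQ : ∀ {x}, x ∈ Q ↔ x ∈ T ∧ dg r T x = 2 := by simp [hQ]
  have mU : ∀ {x}, x ∈ U ↔ x ∈ T ∧ dg r T x ≤ 1 := by simp [hU]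
  have hTQU : T = Q ∪ U := by
    ext x; rw [mem_union, mQ, mU]
    constructor
    · intro hx; have := C.gm hx
      by_cases e : dg r T x = 2
      · exact Or.inl ⟨hx, e⟩
      · exact Or.inr ⟨hx, by omega⟩
    · rintro (hx | hx) <;> exact hx.1
  have djQU : Disjoint Q U := by
    rw [Finset.disjoint_left]; intro x h1 h2; have := mQ.1 h1; have := mU.1 h2; omega
  have c1 : ∑ x ∈ Q, dg r Q x + ∑ x ∈ Q, dg r U x = 8 := by
    rw [← sum_add_distrib, sum_congr rfl (g := fun _ => 2)]
    · simp [m3]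
    · intro x hx; rw [← dg_union djQU, ← hTQU]; exact (mQ.1 hx).2
  have c2 := sum_dg_comm h Q U
  have c3 : ∀ e ∈ U, dg r Q e ≤ 1 := fun e he => (dg_mono (filter_subset _ _) e).trans (mU.1 he).2
  have c4 : ∑ e ∈ U, dg r Q e ≤ 6 := by
    have := sum_le_sum c3; simpa [m2] using this
  have hq1Q : q1 ∈ Q := mQ.2 ⟨K1.qT, K1.q2⟩
  have hq2Q : q2 ∈ Q := mQ.2 ⟨K2.qT, K2.q2⟩
  have hr12 : r q1 q2 := by
    have : ∃ x ∈ Q, dg r Q x ≠ 0 := by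
      by_contra hc; push Not at hc
      have := sum_eq_zero hc; omega
    obtain ⟨x, hx, hx0⟩ := this
    obtain ⟨y, hy, hr⟩ := dg_pos.1 (Nat.pos_of_ne_zero hx0)
    rcases ad x (mQ.1 hx).1 (mQ.1 hx).2 y (mQ.1 hy).1 (mQ.1 hy).2 hr with ⟨rfl, rfl⟩ | ⟨rfl, rfl⟩
    · exact hr
    · exact h.sy hr
  have c5 : ∑ x ∈ Q, dg r Q x ≤ 2 := by
    have : ∑ x ∈ Q, dg r Q x ≤ ∑ x ∈ Q, ((if x = q1 then 1 else 0) + if x = q2 then 1 else 0) := by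
      refine sum_le_sum fun x hx => ?_
      have hx' := mQ.1 hx
      have hle : dg r Q x ≤ 1 := by
        refine card_le_one.2 fun a ha b hb => ?_
        rw [mem_nb] at ha hb
        have ha' := mQ.1 ha.1
        have hb' := mQ.1 hb.1
        rcases ad x hx'.1 hx'.2 a ha'.1 ha'.2 ha.2 with ⟨i1, i2⟩ | ⟨i1, i2⟩ <;>
        rcases ad x hx'.1 hx'.2 b hb'.1 hb'.2 hb.2 with ⟨j1, j2⟩ | ⟨j1, j2⟩
        · rw [i2, j2]
        · exact absurd (i1.symm.trans j1) hq12
        · exact absurd (i1.symm.trans j1).symm hq12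
        · rw [i2, j2]
      by_cases h0 : dg r Q x = 0
      · omega
      · obtain ⟨y, hy, hr⟩ := dg_pos.1 (Nat.pos_of_ne_zero h0)
        have hy' := mQ.1 hy
        rcases ad x hx'.1 hx'.2 y hy'.1 hy'.2 hr with ⟨i1, i2⟩ | ⟨i1, i2⟩
        · rw [if_pos i1]; omega
        · rw [if_pos i1]; omega
    rw [sum_add_distrib] at this
    simpa [hq1Q, hq2Q] using this
  have hUQ : ∀ e ∈ T, dg r T e ≤ 1 → ∃ f ∈ T, dg r T f = 2 ∧ r e f := by
    intro e he he1
    have := sum_eq_const_of_le c3 (by omega) e (mU.2 ⟨he, he1⟩)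
    obtain ⟨f, hf, hr⟩ := dg_pos.1 (show 0 < dg r Q e by omega)
    exact ⟨f, (mQ.1 hf).1, (mQ.1 hf).2, hr⟩
  have c6 : ((Q.erase q1).erase q2).card = 2 := by
    rw [card_erase_of_mem, card_erase_of_mem hq1Q, m3]
    exact mem_erase.2 ⟨hq12.symm, hq2Q⟩
  obtain ⟨x, y, hxy, hxyQ⟩ := card_eq_two.1 c6
  have mxy : ∀ f, (f ≠ q2 ∧ f ≠ q1 ∧ f ∈ Q) ↔ f = x ∨ f = y := by
    intro f; rw [← mem_erase, ← mem_erase, hxyQ]; simp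
  obtain ⟨x2, x1, xQ⟩ := (mxy x).2 (Or.inl rfl)
  obtain ⟨y2, y1, yQ⟩ := (mxy y).2 (Or.inr rfl)
  have hall : ∀ f ∈ T, dg r T f = 2 → f = q1 ∨ f = q2 ∨ f = x ∨ f = y := by
    intro f hf hf2
    by_cases e1 : f = q1
    · exact Or.inl e1
    by_cases e2 : f = q2
    · exact Or.inr (Or.inl e2)
    · exact Or.inr (Or.inr ((mxy f).1 ⟨e2, e1, mQ.2 ⟨hf, hf2⟩⟩))
  have hall' : ∀ f ∈ T, dg r T f = 2 → f = q2 ∨ f = q1 ∨ f = x ∨ f = y := by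
    intro f hf hf2; have := hall f hf hf2; tauto
  have nU : ∀ a, a ∈ Q → a ≠ q1 → a ≠ q2 → ∀ t ∈ T, r a t → dg r T t ≤ 1 := by
    intro a ha a1 a2 t ht hat
    by_contra hc
    have := C.gm ht
    rcases ad a (mQ.1 ha).1 (mQ.1 ha).2 t ht (by omega) hat with i | i
    · exact a1 i.1
    · exact a2 i.1
  obtain ⟨-, -, s, hs, s', hs', ss, xs, vs, xs', ws', hx⟩ := K1.ot x (mQ.1 xQ).1 (mQ.1 xQ).2 x1
  obtain ⟨-, -, u, hu, u', hu', uu, yu, vu, yu', wu', hy⟩ := K1.ot y (mQ.1 yQ).1 (mQ.1 yQ).2 y1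
  obtain ⟨-, -, s2, hs2, -, -, -, xs2, vs2, -⟩ := K2.ot x (mQ.1 xQ).1 (mQ.1 xQ).2 x2
  obtain ⟨-, -, u2, hu2, -, -, -, yu2, vu2, -⟩ := K2.ot y (mQ.1 yQ).1 (mQ.1 yQ).2 y2
  have dif : ∀ t ∈ T, r x t → ∀ t' ∈ T, r y t' → t ≠ t' := by
    rintro t ht hxt t' ht' hyt rfl
    exact hxy (dg_le_one (nU x xQ x1 x2 t ht hxt) (mQ.1 xQ).1 (mQ.1 yQ).1 (h.sy hxt) (h.sy hyt))
  obtain ⟨⟨z, zq, zx, zu⟩, ⟨z', z'q, z'y, z's⟩⟩ := C.one2 K1.qT K1.q2 K2.qT hr12 x1.symm y1.symm hw1 hw11 r1 hall hUQ hx hy vs vu K1.vq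
  have hx' : ∀ t ∈ T, r x t → t = s' ∨ t = s := fun t ht hr => (hx t ht hr).symm
  have hy' : ∀ t ∈ T, r y t → t = u' ∨ t = u := fun t ht hr => (hy t ht hr).symm
  rcases hx s2 hs2 xs2 with rfl | rfl <;> rcases hy u2 hu2 yu2 with rfl | rfl
  · exact n1 (h.c4 vs vu vs2 vu2 (dif _ hs xs _ hu yu))
  · obtain ⟨-, ⟨Z, Zq, Zy, Zs⟩⟩ := C.one2 K2.qT K2.q2 K1.qT (h.sy hr12) x2.symm y2.symm hw2 hw21 r2 hall' hUQ hx hy' vs2 vu2 K2.vq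
    have := h.c4 z'y z's Zy Zs (by rintro rfl; exact hxy (by
      have := nU x xQ x1 x2 _ hs' xs'
      have := (mQ.1 yQ).2; omega))
    subst this
    exact h.c3 z'q hr12 Zq
  · obtain ⟨⟨Z, Zq, Zx, Zu⟩, -⟩ := C.one2 K2.qT K2.q2 K1.qT (h.sy hr12) x2.symm y2.symm hw2 hw21 r2 hall' hUQ hx' hy vs2 vu2 K2.vq
    have := h.c4 zx zu Zx Zu (by rintro rfl; exact hxy (by
      have := nU y yQ y1 y2 _ hu' yu'
      have := (mQ.1 xQ).2; omega))
    subst this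
    exact h.c3 zq hr12 Zq
  · exact n2 (h.c4 ws' wu' vs2 vu2 (dif _ hs' xs' _ hu' yu'))

lemma absurd' (C : C23 r S T R) : False := by
  obtain ⟨v1, hv1, w1, hw1, v2, hv2, w2, hw2, a1, a2, a3, a4, r1, r2, n1, n2, n3, n4⟩ := C.twoK
  have h := C.h
  obtain ⟨q1, K1 | K1⟩ := C.k2' hv1 hw1 a1 a2 r1 <;> obtain ⟨q2, K2 | K2⟩ := C.k2' hv2 hw2 a3 a4 r2
  · exact C.fin K1 K2 hv1 hw1 hv2 hw2 a2 a4 r1 r2 n1 n3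
  · exact C.fin K1 K2 hv1 hw1 hw2 hv2 a2 a3 r1 (h.sy r2) n2 n4
  · exact C.fin K1 K2 hw1 hv1 hv2 hw2 a1 a4 (h.sy r1) r2 n3 n1
  · exact C.fin K1 K2 hw1 hv1 hw2 hv2 a1 a3 (h.sy r1) (h.sy r2) n4 n2
end C23

lemma bd23 : bd V 23 50 := by
  apply bd_exact
  intro r h S hS hE
  have hd : ∀ w ∈ S, 4 ≤ dg r S w := by
    intro w hw
    have := bd_min h bd22 hS hw
    omega
  obtain ⟨T, R, t⟩ := two_split h (S := S) (a := 4) fun w hw => ⟨hd w hw, by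
    have := ball_ge h hw hd
    omega⟩
  have hTc : T.card = 10 := by have := t.cT; omega
  have hRc : R.card = 13 := by have := t.cd; omega
  exact C23.absurd' ⟨h, t, hS, hTc, hRc⟩
lemma bd24 : bd V 24 54 := bd_easy' bd23 5 (by norm_num) (by norm_num)
lemma bd25 : bd V 25 58 := bd_easy' bd24 5 (by norm_num) (by norm_num)
end Q19

namespace Q19
open scoped Classical
open Finset
variable {V : Type} {r : V → V → Prop}

structure Three (r : V → V → Prop) (S A B C : Finset V) (a : ℕ) : Prop where
  As : A ⊆ S
  Bs : B ⊆ S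
  Cs : C ⊆ S
  dA : ∀ {x}, x ∈ A → dg r S x = a
  dB : ∀ {x}, x ∈ B → dg r S x = a + 1
  dC : ∀ {x}, x ∈ C → dg r S x = a + 2
  un : ∀ {x}, x ∈ S → x ∈ A ∨ x ∈ B ∨ x ∈ C
  ss : ∀ (f : V → ℕ), ∑ w ∈ S, f w = ∑ w ∈ A, f w + ∑ w ∈ B, f w + ∑ w ∈ C, f w
  sm : ∀ (x : V) (f : V → ℕ), ∑ w ∈ nb r S x, f w = ∑ w ∈ nb r A x, f w + ∑ w ∈ nb r B x, f w + ∑ w ∈ nb r C x, f w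
  ds : ∀ x, dg r S x = dg r A x + dg r B x + dg r C x
  cd : S.card = A.card + B.card + C.card
  e2 : E2 r S = a * A.card + (a + 1) * B.card + (a + 2) * C.card

lemma three_split {S : Finset V} {a : ℕ} (hd : ∀ v ∈ S, a ≤ dg r S v ∧ dg r S v ≤ a + 2) :
    ∃ A B C, Three r S A B C a := by
  have ss : ∀ (f : V → ℕ), ∑ w ∈ S, f w = ∑ w ∈ S.filter (fun v => dg r S v = a), f w + 
      ∑ w ∈ S.filter (fun v => dg r S v = a + 1), f w + ∑ w ∈ S.filter (fun v => dg r S v = a + 2), f w := by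
    intro f
    simp only [sum_filter, ← sum_add_distrib]
    refine sum_congr rfl fun v hv => ?_
    have := hd v hv
    split_ifs <;> omega
  refine ⟨S.filter (fun v => dg r S v = a), S.filter (fun v => dg r S v = a + 1), S.filter (fun v => dg r S v = a + 2),
    filter_subset _ _, filter_subset _ _, filter_subset _ _, fun hx => (mem_filter.1 hx).2, fun hx => (mem_filter.1 hx).2,
    fun hx => (mem_filter.1 hx).2, ?_, ss, ?_, ?_, ?_, ?_⟩
  · intro x hx
    have := hd x hx
    simp only [mem_filter]
    have : dg r S x = a ∨ dg r S x = a + 1 ∨ dg r S x = a + 2 := by omega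
    tauto
  · intro x f
    have := ss (fun w => if r x w then f w else 0)
    simpa only [nb, sum_filter (p := fun w => r x w)] using this
  · intro x
    have := ss (fun w => if r x w then 1 else 0)
    simpa only [dg_eq_sum] using this
  · have := ss (fun _ => 1); simpa using this
  · have := ss (dg r S)
    unfold E2; rw [this]
    rw [sum_congr rfl (fun x hx => (mem_filter.1 hx).2), sum_congr rfl (fun x hx => (mem_filter.1 hx).2) (s₁ := S.filter (fun v => dg r S v = a + 1)),
      sum_congr rfl (fun x hx => (mem_filter.1 hx).2) (s₁ := S.filter (fun v => dg r S v = a + 2))]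
    simp only [sum_const, smul_eq_mul]; ring

lemma sum_dgS {S A : Finset V} {v : V} {c : ℕ} (hA : ∀ {x}, x ∈ A → dg r S x = c) : ∑ w ∈ nb r A v, dg r S w = c * dg r A v :=
  nb_sum_const fun _ hw _ => hA hw

lemma bd26 : bd V 26 61 := by
  apply bd_exact
  intro r h S hS hE
  have hd : ∀ w ∈ S, 4 ≤ dg r S w := by
    intro w hw
    have := bd_min h bd25 hS hw
    omega
  obtain ⟨A, B, C, t⟩ := three_split (r := r) (S := S) (a := 4) fun w hw => ⟨hd w hw, by
    have := ball_ge h hw hd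
    omega⟩
  have f1 : ∀ x ∈ A, dg r A x = 0 := by
    intro x hx
    by_contra hc
    obtain ⟨y, hy, hr⟩ := dg_pos.1 (Nat.pos_of_ne_zero hc)
    have := bd_adj h bd24 (t.As hx) (t.As hy) hr (by omega)
    rw [t.dA hx, t.dA hy] at this
    omega
  have f2 : ∀ x ∈ B, dg r A x ≤ 1 := by
    intro x hx
    by_contra hc
    obtain ⟨D, hD, hDc⟩ := exists_subset_card_eq (s := nb r A x) (n := 2) (by change _ ≤ dg r A x; omega)
    have := bd_star h bd23 (t.Bs hx) (D := D) (fun y hy => t.As (mem_nb.1 (hD hy)).1) (fun y hy => (mem_nb.1 (hD hy)).2) (by omega)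
    rw [sum_congr rfl (fun y hy => t.dA (mem_nb.1 (hD hy)).1), t.dB hx] at this
    simp [hDc] at this
    omega
  have f3 : ∀ x ∈ C, dg r A x ≤ 6 := fun x hx => by
    have := t.ds x; have := t.dC hx; omega
  have g := sum_dg_comm h A S
  rw [t.ss, sum_congr rfl (fun y hy => t.dA hy), sum_congr rfl f1] at g
  have g2 := sum_le_sum f2
  have g3 := sum_le_sum f3
  simp at g g2 g3
  have := t.cd
  have := t.e2
  omega
lemma bd27 : bd V 27 65 := bd_easy' bd26 5 (by norm_num) (by norm_num)
lemma bd28 : bd V 28 70 := bd_easy' bd27 6 (by norm_num) (by norm_num)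

structure C28 (r : V → V → Prop) (S A B C : Finset V) : Prop where
  h : Good r
  t : Three r S A B C 4
  hS : S.card = 28
  hE : E2 r S = 138

namespace C28
variable {S A B C : Finset V}

lemma AA (H : C28 r S A B C) {x y : V} (hx : x ∈ A) (hy : y ∈ A) : ¬ r x y := by
  intro hr
  have h := H.h
  have t := H.t
  have := bd_adj h bd26 (t.As hx) (t.As hy) hr (by rw [H.hS])
  rw [t.dA hx, t.dA hy, H.hE] at this
  omega
lemma AA0 (H : C28 r S A B C) {x : V} (hx : x ∈ A) : dg r A x = 0 := by
  by_contra hc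
  obtain ⟨y, hy, hr⟩ := dg_pos.1 (Nat.pos_of_ne_zero hc)
  exact H.AA hx hy hr
lemma cA (H : C28 r S A B C) : A.card = C.card + 2 ∧ B.card + 2 * C.card = 26 := by
  have := H.t.cd; have := H.t.e2; have := H.hS; have := H.hE; omega
lemma six (H : C28 r S A B C) {x : V} (hx : x ∈ C) : dg r A x = 3 ∧ dg r B x = 3 ∧ dg r C x = 0 ∧ (ms r S S x).card = 0 := by
  have h := H.h
  have t := H.t
  have h3 : dg r A x ≤ 3 := by
    by_contra hc
    obtain ⟨D, hD, hDc⟩ := exists_subset_card_eq (s := nb r A x) (n := 4) (by change _ ≤ dg r A x; omega)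
    have := bd_star h bd23 (t.Cs hx) (D := D) (fun y hy => t.As (mem_nb.1 (hD hy)).1) (fun y hy => (mem_nb.1 (hD hy)).2) (by rw [hDc, H.hS])
    rw [sum_congr rfl (fun y hy => t.dA (mem_nb.1 (hD hy)).1), t.dC hx, H.hE] at this
    simp [hDc] at this
  have i := ident_S h (t.Cs hx)
  rw [t.sm, sum_dgS t.dA, sum_dgS t.dB, sum_dgS t.dC, H.hS] at i
  have := t.ds x
  have := t.dC hx
  omega
lemma share (H : C28 r S A B C) {x y : V} (hx : x ∈ C) (hy : y ∈ C) (hne : y ≠ x) : ∃ p ∈ A, r x p ∧ r y p := by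
  have h := H.h
  have t := H.t
  obtain ⟨s1, s2, s3, s4⟩ := H.six hx
  have xA : x ∉ A := fun hh => by have := t.dA hh; have := t.dC hx; omega
  have yA : y ∉ A := fun hh => by have := t.dA hh; have := t.dC hy; omega
  set D := insert x (nb r A x) with hD
  have hDS : D ⊆ S := insert_subset (t.Cs hx) (fun z hz => t.As (mem_nb.1 hz).1)
  have xn : x ∉ nb r A x := fun hh => h.ir (mem_nb.1 hh).2
  have hDc : D.card = 4 := by
    rw [hD, card_insert_of_notMem xn]; change dg r A x + 1 = 4; omega
  have e1 : ∑ v ∈ D, dg r S v = 18 := by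
    rw [hD, sum_insert xn, sum_dgS t.dA, s1, t.dC hx]
  have e2 : 2 * dg r A x ≤ E2 r D := E2_star h (fun z hz => (mem_nb.1 hz).2)
  have e3 := E2_del h hDS
  have hc' : (S \ D).card = 24 := by rw [card_sdiff_of_subset hDS, hDc, H.hS]
  have hd : ∀ w ∈ S \ D, 4 ≤ dg r (S \ D) w := by
    intro w hw
    have := bd_min h bd23 hc' hw
    have := H.hE
    omega
  have hyD : y ∈ S \ D := by
    rw [mem_sdiff, hD, mem_insert, mem_nb]
    refine ⟨t.Cs hy, ?_⟩
    rintro (e | e)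
    · exact hne e
    · exact yA e.1
  have e4 := ball_ge h hyD hd
  have e5 := dg_sdiff (r := r) hDS y
  have := t.dC hy
  obtain ⟨p, hp, hr⟩ := dg_pos.1 (show 0 < dg r D y by omega)
  rw [hD, mem_insert, mem_nb] at hp
  rcases hp with rfl | hp
  · exact absurd (h.sy hr) (dg_zero s3 y hy)
  · exact ⟨p, hp.1, hp.2, hr⟩
lemma dj (H : C28 r S A B C) {x : V} : (x ∈ A → x ∈ B → False) ∧ (x ∈ A → x ∈ C → False) ∧ (x ∈ B → x ∈ C → False) := by
  have t := H.t
  refine ⟨fun h1 h2 => ?_, fun h1 h2 => ?_, fun h1 h2 => ?_⟩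
  · have := t.dA h1; have := t.dB h2; omega
  · have := t.dA h1; have := t.dC h2; omega
  · have := t.dB h1; have := t.dC h2; omega
lemma fiveC (H : C28 r S A B C) {q : V} (hq : q ∈ B) : dg r C q ≤ 1 := by
  have h := H.h
  by_contra hc
  obtain ⟨x, hx, y, hy, hne, rx, ry⟩ := two_of_le (r := r) (X := C) (v := q) (by omega)
  obtain ⟨p, hp, xp, yp⟩ := H.share hx hy hne.symm
  have := h.c4 rx ry (h.sy xp) (h.sy yp) hne
  subst this
  exact H.dj.1 hp hq
lemma sumA (H : C28 r S A B C) {x : V} (hx : x ∈ C) : ∑ q ∈ nb r B x, dg r A q + 1 = C.card := by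
  have h := H.h
  have t := H.t
  obtain ⟨s1, s2, s3, s4⟩ := H.six hx
  have i := ident_out h t.As (v := x) (fun hh => H.dj.2.1 hh hx)
  have := ms_card_le (r := r) (S := S) t.As x
  rw [t.sm, nb_sum_const (c := 0) (fun w hw _ => H.AA0 hw)] at i
  have e : ∑ w ∈ nb r C x, dg r A w = 0 := by
    rw [card_eq_zero.1 (show (nb r C x).card = 0 from s3)]; simp
  have := H.cA
  omega
lemma sumC (H : C28 r S A B C) {x : V} (hx : x ∈ C) : ∑ p ∈ nb r A x, dg r C p = C.card + 2 := by
  have h := H.h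
  have t := H.t
  obtain ⟨s1, s2, s3, s4⟩ := H.six hx
  have i := ident_in h t.Cs hx
  have := ms_card_le (r := r) (S := S) t.Cs x
  rw [t.sm, nb_sum_const (X := B) (c := 1) (fun w hw hr => by
    have := H.fiveC hw
    have := dg_pos.2 ⟨x, hx, h.sy hr⟩
    omega)] at i
  have e : ∑ w ∈ nb r C x, dg r C w = 0 := by
    rw [card_eq_zero.1 (show (nb r C x).card = 0 from s3)]; simp
  have := t.dC hx
  omega
lemma tot (H : C28 r S A B C) : ∑ q ∈ B, dg r A q = C.card + 8 ∧ ∑ q ∈ B, dg r C q * dg r A q + C.card = C.card * C.card ∧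
    ∑ p ∈ A, dg r C p = 3 * C.card ∧ ∑ p ∈ A, dg r C p * dg r C p = C.card * (C.card + 2) ∧ ∑ q ∈ B, dg r C q = 3 * C.card := by
  have h := H.h
  have t := H.t
  have cA := H.cA
  refine ⟨?_, ?_, ?_, ?_, ?_⟩
  · have g := sum_dg_comm h A S
    rw [t.ss, sum_congr rfl (fun y hy => t.dA hy), sum_congr rfl (fun y hy => H.AA0 hy) (s₁ := A), 
      sum_congr rfl (fun y hy => (H.six hy).1) (s₁ := C)] at g
    simp at g
    omega
  · have g : ∑ x ∈ C, (∑ q ∈ nb r B x, dg r A q + 1) = ∑ x ∈ C, C.card := sum_congr rfl fun x hx => H.sumA hx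
    rw [sum_add_distrib, sum_swap h] at g
    simpa using g
  · rw [sum_dg_comm h, sum_congr rfl (fun y hy => (H.six hy).1)]; simp; ring
  · rw [← sum_swap h, sum_congr rfl (fun y hy => H.sumC hy)]; simp
  · rw [sum_dg_comm h, sum_congr rfl (fun y hy => (H.six hy).2.1)]; simp; ring
lemma c1or4 (H : C28 r S A B C) : C.card = 0 ∨ C.card = 1 ∨ C.card = 4 := by
  obtain ⟨t1, t2, t3, t4, -⟩ := H.tot
  have cA := H.cA
  have g : ∑ q ∈ B, dg r C q * dg r A q ≤ ∑ q ∈ B, dg r A q := by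
    refine sum_le_sum fun q hq => ?_
    have := H.fiveC hq
    nlinarith
  have hc : C.card ≤ 4 := by nlinarith
  have cv := convex A (dg r C) 1
  rw [t3, t4, cA.1] at cv
  generalize C.card = c at *
  interval_cases c <;> omega

lemma c4 (H : C28 r S A B C) : C.card ≠ 4 := by
  intro hC
  have h := H.h
  have t := H.t
  obtain ⟨t1, t2, t3, t4, t5⟩ := H.tot
  have cA := H.cA
  rw [hC] at t1 t2 t3 t4 t5 cA
  have rr : ∀ p ∈ A, dg r C p = 2 := by
    intro p hp
    have h1 := convex_eq (N := A) (f := dg r C) (a := 1) (by rw [t3, t4, cA.1]) p hp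
    have h2 := convex_eq (N := A) (f := dg r C) (a := 2) (by rw [t3, t4, cA.1]) p hp
    omega
  have ab : ∀ q ∈ B, dg r A q ≠ 0 → dg r C q = 1 := by
    intro q hq h0
    by_contra hc
    have hlt : ∑ q ∈ B, dg r C q * dg r A q < ∑ q ∈ B, dg r A q := by
      refine sum_lt_sum (fun q hq => ?_) ⟨q, hq, ?_⟩
      · have := H.fiveC hq
        nlinarith
      · have := H.fiveC hq
        have : dg r C q = 0 := by omega
        rw [this]; omega
    omega
  set Q := B.filter (fun q => dg r C q = 1) with hQ
  have mQ : ∀ {x}, x ∈ Q ↔ x ∈ B ∧ dg r C x = 1 := by simp [hQ]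
  have QB : Q ⊆ B := filter_subset _ _
  have cQ : Q.card = 12 := by
    rw [hQ, card_filter]
    refine Eq.trans (sum_congr rfl fun q hq => ?_) t5
    have := H.fiveC hq
    split_ifs <;> omega
  -- the other two sixes
  have a1 : ∀ q ∈ Q, dg r A q ≤ 1 := by
    intro q hq
    obtain ⟨hqB, hq1⟩ := mQ.1 hq
    by_contra hc
    obtain ⟨p, hp, p', hp', hne, rp, rp'⟩ := two_of_le (r := r) (X := A) (v := q) (by omega)
    obtain ⟨x, hx, rx, -⟩ := dg_one hq1
    have : nb r C p ∪ nb r C p' ⊆ C.erase x := by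
      intro z hz
      rw [mem_union, mem_nb, mem_nb] at hz
      rw [mem_erase]
      rcases hz with ⟨h1, h2⟩ | ⟨h1, h2⟩
      · exact ⟨by rintro rfl; exact h.c3 rp h2 rx, h1⟩
      · exact ⟨by rintro rfl; exact h.c3 rp' h2 rx, h1⟩
    have hcc := card_le_card this
    have : Disjoint (nb r C p) (nb r C p') := by
      rw [Finset.disjoint_left]
      intro z hz hz'
      rw [mem_nb] at hz hz'
      have := h.c4 rp rp' (h.sy hz.2) (h.sy hz'.2) hne
      subst this
      exact H.dj.2.2 hqB hz.1
    rw [card_union_of_disjoint this, card_erase_of_mem hx, hC] at hcc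
    change dg r C p + dg r C p' ≤ _ at hcc
    rw [rr p hp, rr p' hp'] at hcc
    omega
  have a1' : ∀ q ∈ Q, dg r A q = 1 := by
    apply sum_eq_const_of_le a1
    have : ∑ q ∈ B, dg r C q * dg r A q = ∑ q ∈ Q, dg r A q := by
      rw [hQ, sum_filter]; refine sum_congr rfl fun q hq => ?_
      have := H.fiveC hq
      split_ifs with h1
      · rw [h1, one_mul]
      · have : dg r C q = 0 := by omega
        rw [this, zero_mul]
    omega
  obtain ⟨x, hx⟩ := card_pos.1 (show 0 < C.card by omega)
  obtain ⟨s1, s2, s3, s4⟩ := H.six hx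
  have i := ident_out h (QB.trans t.Bs) (v := x) (fun hh => H.dj.2.2 (QB hh) hx)
  have m0 := ms_card_le (r := r) (S := S) (QB.trans t.Bs) x
  have eC : nb r C x = ∅ := card_eq_zero.1 s3
  have dQ : dg r Q x = 3 := by
    rw [← s2]; unfold dg; congr 1; ext q; rw [mem_nb, mem_nb]
    constructor
    · exact fun hh => ⟨QB hh.1, hh.2⟩
    · rintro ⟨h1, h2⟩
      refine ⟨mQ.2 ⟨h1, ?_⟩, h2⟩
      have := H.fiveC h1
      have := dg_pos.2 ⟨x, hx, h.sy h2⟩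
      omega
  rw [t.sm, eC, sum_empty, nb_sum_const (X := A) (c := 2) (fun p hp hr => by
    have e1 := t.ds p
    rw [t.dA hp, H.AA0 hp, rr p hp] at e1
    have : dg r Q p = dg r B p := by
      unfold dg; congr 1; ext q; rw [mem_nb, mem_nb]
      constructor
      · exact fun hh => ⟨QB hh.1, hh.2⟩
      · rintro ⟨h1, h2⟩
        refine ⟨mQ.2 ⟨h1, ab q h1 ?_⟩, h2⟩
        have := dg_pos.2 ⟨p, hp, h.sy h2⟩
        omega
    omega), s1, cQ, dQ] at i
  have : ∃ q ∈ nb r B x, dg r Q q ≠ 0 := by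
    by_contra hc; push Not at hc
    have := sum_eq_zero hc
    omega
  obtain ⟨q, hq, hq0⟩ := this
  rw [mem_nb] at hq
  obtain ⟨q', hq', rqq⟩ := dg_pos.1 (Nat.pos_of_ne_zero hq0)
  have hqQ : q ∈ Q := by
    refine mQ.2 ⟨hq.1, ?_⟩
    have := H.fiveC hq.1
    have := dg_pos.2 ⟨x, hx, h.sy hq.2⟩
    omega
  obtain ⟨x', hx', rx', -⟩ := dg_one (mQ.1 hq').2
  obtain ⟨p, hp, rp, -⟩ := dg_one (a1' q hqQ)
  obtain ⟨p', hp', rp', -⟩ := dg_one (a1' q' hq')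
  have hxx : x' ≠ x := by rintro rfl; exact h.c3 rqq rx' (h.sy hq.2)
  have j1 : ¬ r p x := fun hh => h.c3 rp hh (h.sy hq.2)
  have j2 : ¬ r p' x' := fun hh => h.c3 rp' hh rx'
  have j3 : ¬ r p x' := fun hh => by
    have := h.c4 rqq rp (h.sy rx') (h.sy hh) (by rintro rfl; exact H.dj.1 hp (QB hq'))
    subst this; exact H.dj.2.2 hq.1 hx'
  have j4 : ¬ r p' x := fun hh => by
    have := h.c4 (h.sy rqq) rp' hq.2 (h.sy hh) (by rintro rfl; exact H.dj.1 hp' hq.1)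
    subst this; exact H.dj.2.2 (QB hq') hx
  set W := (C.erase x).erase x' with hW
  have cW : W.card = 2 := by
    rw [hW, card_erase_of_mem (mem_erase.2 ⟨hxx, hx'⟩), card_erase_of_mem hx, hC]
  have k : ∀ p ∈ A, ¬ r p x → ¬ r p x' → nb r C p = W := by
    intro p hp h1 h2
    apply eq_of_subset_of_card_le
    · intro z hz
      rw [mem_nb] at hz
      rw [hW, mem_erase, mem_erase]
      exact ⟨by rintro rfl; exact h2 hz.2, by rintro rfl; exact h1 hz.2, hz.1⟩
    · rw [cW]; exact (rr p hp).ge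
  obtain ⟨y, y', hyy, hyW⟩ := card_eq_two.1 cW
  have k1 := k p hp j1 j3
  have k2 := k p' hp' j4 j2
  rw [hyW] at k1 k2
  have z1 : y ∈ nb r C p := by rw [k1]; simp
  have z2 : y' ∈ nb r C p := by rw [k1]; simp
  have z3 : y ∈ nb r C p' := by rw [k2]; simp
  have z4 : y' ∈ nb r C p' := by rw [k2]; simp
  rw [mem_nb] at z1 z2 z3 z4
  have := h.c4 z1.2 z2.2 z3.2 z4.2 hyy
  subst this
  exact h.c3 rqq rp' rp
end C28
end Q19

namespace Q19
open scoped Classical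
open Finset
variable {V : Type} {r : V → V → Prop}

structure D28 (r : V → V → Prop) (N P Q : Finset V) : Prop where
  h : Good r
  cN : N.card = 3
  cP : P.card = 9
  cQ : Q.card = 12
  dPQ : ∀ {v}, v ∈ P → v ∈ Q → False
  dNQ : ∀ {v}, v ∈ N → v ∈ Q → False
  dNP : ∀ {v}, v ∈ N → v ∈ P → False
  nQ : ∀ {q}, q ∈ N → dg r Q q = 4
  qN : ∀ {v}, v ∈ Q → dg r N v = 1
  pN : ∀ {v q}, v ∈ P → q ∈ N → ¬ r v q
  p : ∀ {v}, v ∈ P → (dg r Q v = 2 ∧ dg r P v = 2) ∨ (dg r Q v = 3 ∧ dg r P v = 1 ∧ ∀ q ∈ N, ∃ w ∈ Q, r v w ∧ r w q)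
  q : ∀ {v}, v ∈ Q → (dg r Q v = 2 ∧ dg r P v = 2 ∧ ∀ q ∈ N, ¬ r v q → ∃ w ∈ Q, r v w ∧ r w q) ∨ (dg r Q v = 1 ∧ dg r P v = 3)

lemma nb_sum_le {X Y : Finset V} (hXY : X ⊆ Y) (v : V) {f : V → ℕ} (hf : ∀ w ∈ X, f w = 1) :
    dg r X v ≤ ∑ w ∈ nb r Y v, f w := by
  have : ∑ w ∈ nb r X v, f w ≤ ∑ w ∈ nb r Y v, f w :=
    sum_le_sum_of_subset (filter_subset_filter _ hXY)
  rwa [nb_sum_const (c := 1) (fun w hw _ => hf w hw), one_mul] at this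

lemma C28.toD {S A B C : Finset V} (H : C28 r S A B C) (hC : C.card = 1) : ∃ N P Q, D28 r N P Q := by
  have h := H.h
  have t := H.t
  obtain ⟨x, hxC⟩ := card_eq_one.1 hC
  have hx : x ∈ C := by rw [hxC]; simp
  have Cx : ∀ z ∈ C, z = x := by intro z hz; rw [hxC] at hz; simpa using hz
  obtain ⟨s1, s2, s3, s4⟩ := H.six hx
  have cA := H.cA
  rw [hC] at cA
  have xA : ∀ p ∈ A, r x p := by
    have : nb r A x = A := eq_of_subset_of_card_le (filter_subset _ _) (by change _ ≤ dg r A x; omega)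
    intro p hp
    rw [← this, mem_nb] at hp
    exact hp.2
  set N := nb r B x with hN
  have cN : N.card = 3 := s2
  have mN : ∀ {q}, q ∈ N ↔ q ∈ B ∧ r x q := by simp [hN, mem_nb]
  have aN : ∀ q ∈ N, dg r A q = 0 := by
    have := H.sumA hx
    rw [hC, ← hN] at this
    exact sum_eq_zero_iff.1 (show ∑ q ∈ N, dg r A q = 0 by omega)
  have NN : ∀ q ∈ N, ∀ q' ∈ N, ¬ r q q' := fun q hq q' hq' hr => h.c3 (mN.1 hq).2 hr (mN.1 hq').2
  have ds := t.ds
  set P := B.filter (fun v => v ∉ N ∧ 0 < dg r A v) with hP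
  set Q := B.filter (fun v => v ∉ N ∧ dg r A v = 0) with hQ
  have mP : ∀ {v}, v ∈ P ↔ v ∈ B ∧ v ∉ N ∧ 0 < dg r A v := by simp [hP]
  have mQ : ∀ {v}, v ∈ Q ↔ v ∈ B ∧ v ∉ N ∧ dg r A v = 0 := by simp [hQ]
  have uB : B = N ∪ (P ∪ Q) := by
    ext v; rw [mem_union, mem_union, mP, mQ]
    by_cases e : v ∈ N
    · simp [e, (mN.1 e).1]
    · simp only [e]
      have : 0 < dg r A v ∨ dg r A v = 0 := by omega
      tauto
  have dPQ : ∀ {v}, v ∈ P → v ∈ Q → False := by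
    intro v h1 h2; have := mP.1 h1; have := mQ.1 h2; omega
  have dNQ : ∀ {v}, v ∈ N → v ∈ Q → False := fun h1 h2 => (mQ.1 h2).2.1 h1
  have dNP : ∀ {v}, v ∈ N → v ∈ P → False := fun h1 h2 => (mP.1 h2).2.1 h1
  have dj1 : Disjoint P Q := Finset.disjoint_left.2 fun v h1 h2 => dPQ h1 h2
  have dj2 : Disjoint N (P ∪ Q) := Finset.disjoint_left.2 fun v h1 h2 => by
    rcases mem_union.1 h2 with h3 | h3
    · exact dNP h1 h3
    · exact dNQ h1 h3
  have dB : ∀ v, dg r B v = dg r N v + (dg r P v + dg r Q v) := by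
    intro v; conv_lhs => rw [uB]
    rw [dg_union dj2, dg_union dj1]
  have cB : B.card = N.card + (P.card + Q.card) := by
    conv_lhs => rw [uB]
    rw [card_union_of_disjoint dj2, card_union_of_disjoint dj1]
  -- common neighbours with x
  have cx : ∀ v, v ∈ B → v ∉ N → ∀ w w', r x w → r x w' → r v w → r v w' → w = w' := by
    intro v hv hvN w w' h1 h2 h3 h4
    by_contra hc
    have := h.c4 h1 h2 h3 h4 hc
    subst this; exact H.dj.2.2 hv hx
  have dist : ∀ v, v ∈ B → v ∉ N → 0 < dg r A v ∨ 0 < dg r N v := by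
    intro v hv hvN
    rcases dist2' s4 (t.Bs hv) (by rintro rfl; exact H.dj.2.2 hv hx) with h1 | ⟨w, hw, h1, h2⟩
    · exact absurd (mN.2 ⟨hv, h1⟩) hvN
    · rcases t.un hw with h3 | h3 | h3
      · left; exact dg_pos.2 ⟨w, h3, h.sy h2⟩
      · right; exact dg_pos.2 ⟨w, mN.2 ⟨h3, h1⟩, h.sy h2⟩
      · have := Cx w h3; subst this; exact absurd h1 h.ir
  have a1 : ∀ v ∈ P, dg r A v = 1 ∧ dg r N v = 0 := by
    intro v hv
    obtain ⟨v1, v2, v3⟩ := mP.1 hv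
    obtain ⟨p, hp, rp⟩ := dg_pos.1 v3
    constructor
    · refine le_antisymm (card_le_one.2 fun a ha b hb => ?_) v3
      rw [mem_nb] at ha hb
      exact cx v v1 v2 a b (xA a ha.1) (xA b hb.1) ha.2 hb.2
    · by_contra hc
      obtain ⟨q, hq, rq⟩ := dg_pos.1 (Nat.pos_of_ne_zero hc)
      have := cx v v1 v2 p q (xA p hp) (mN.1 hq).2 rp rq
      subst this; exact H.dj.1 hp (mN.1 hq).1
  have q1 : ∀ v ∈ Q, dg r N v = 1 := by
    intro v hv
    obtain ⟨v1, v2, v3⟩ := mQ.1 hv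
    have := dist v v1 v2
    refine le_antisymm (card_le_one.2 fun a ha b hb => ?_) (by omega)
    rw [mem_nb] at ha hb
    exact cx v v1 v2 a b (mN.1 ha.1).2 (mN.1 hb.1).2 ha.2 hb.2
  have c0 : ∀ v, v ∈ B → v ∉ N → dg r C v = 0 := by
    intro v hv hvN
    by_contra hc
    obtain ⟨z, hz, hr⟩ := dg_pos.1 (Nat.pos_of_ne_zero hc)
    have := Cx z hz; subst this
    exact hvN (mN.2 ⟨hv, h.sy hr⟩)
  have QS : Q ⊆ S := (filter_subset _ _).trans t.Bs
  have PS : P ⊆ S := (filter_subset _ _).trans t.Bs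
  have NS : N ⊆ S := (filter_subset _ _).trans t.Bs
  have nQ : ∀ q ∈ N, dg r Q q = 4 := by
    intro q hq
    have e1 := ds q
    rw [t.dB (mN.1 hq).1, aN q hq, dB] at e1
    have e2 := H.fiveC (mN.1 hq).1
    have e3 := dg_pos.2 ⟨x, hx, h.sy (mN.1 hq).2⟩
    have e4 : dg r N q = 0 := by
      by_contra hc
      obtain ⟨z, hz, hr⟩ := dg_pos.1 (Nat.pos_of_ne_zero hc)
      exact NN q hq z hz hr
    have e5 : dg r P q = 0 := by
      by_contra hc
      obtain ⟨z, hz, hr⟩ := dg_pos.1 (Nat.pos_of_ne_zero hc)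
      have := dg_pos.2 ⟨q, hq, h.sy hr⟩
      have := (a1 z hz).2
      omega
    omega
  have cQ : Q.card = 12 := by
    have := sum_dg_comm h N Q
    rw [sum_congr rfl nQ, sum_congr rfl q1] at this
    simp at this; omega
  -- reaching
  have reach : ∀ v, v ∈ B → v ∉ N → (ms r S N v).card = 0 → ∀ q ∈ N, ¬ r v q → ∃ w ∈ Q, r v w ∧ r w q := by
    intro v hv hvN hm q hq hvq
    rcases dist2' hm hq (by rintro rfl; exact hvN hq) with h1 | ⟨w, hw, h1, h2⟩
    · exact absurd h1 hvq
    · rcases t.un hw with h3 | h3 | h3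
      · exact absurd (h.sy h2) (dg_zero (aN q hq) w h3)
      · refine ⟨w, ?_, h1, h2⟩
        rw [uB, mem_union, mem_union] at h3
        rcases h3 with h3 | h3 | h3
        · exact absurd h2 (NN w h3 q hq)
        · exact absurd h2 (dg_zero (a1 w h3).2 q hq)
        · exact h3
      · have := Cx w h3; subst this
        exact absurd (mN.2 ⟨hv, h.sy h1⟩) hvN
  refine ⟨N, P, Q, h, cN, by omega, cQ, dPQ, dNQ, dNP, fun hq => nQ _ hq, fun hv => q1 _ hv, 
    fun hv hq => dg_zero (a1 _ hv).2 _ hq, ?_, ?_⟩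
  · intro v hv
    obtain ⟨v1, v2, v3⟩ := mP.1 hv
    obtain ⟨k1, k2⟩ := a1 v hv
    have e1 := ds v
    rw [t.dB v1, k1, dB, k2, c0 v v1 v2] at e1
    have i1 := ident_out h NS v2
    have i2 := ident_out h t.As (v := v) (fun hh => H.dj.1 hh v1)
    have j1 := nb_sum_le (r := r) QS v q1
    have j2 := nb_sum_le (r := r) PS v (fun w hw => (a1 w hw).1)
    have : dg r Q v = 2 ∨ dg r Q v = 3 := by omega
    rcases this with e | e
    · left; omega
    · right; exact ⟨e, by omega, fun q hq => reach v v1 v2 (by omega) q hq (dg_zero k2 q hq)⟩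
  · intro v hv
    obtain ⟨v1, v2, v3⟩ := mQ.1 hv
    have k2 := q1 v hv
    have e1 := ds v
    rw [t.dB v1, v3, dB, k2, c0 v v1 v2] at e1
    have i1 := ident_out h NS v2
    have i2 := ident_out h t.As (v := v) (fun hh => H.dj.1 hh v1)
    have j1 := nb_sum_le (r := r) QS v q1
    have j2 := nb_sum_le (r := r) PS v (fun w hw => (a1 w hw).1)
    have : dg r Q v = 2 ∨ dg r Q v = 1 := by omega
    rcases this with e | e
    · left; exact ⟨e, by omega, fun q hq hvq => reach v v1 v2 (by omega) q hq hvq⟩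
    · right; omega
end Q19

namespace Q19
def al {n : ℕ} (π : Fin n → Fin n) (g : Fin n → Bool) (t : Fin n × Fin n × Fin n) : Bool :=
  decide (t.1 ≠ t.2.1 ∧ t.2.1 ≠ t.2.2 ∧ t.1 ≠ t.2.2 ∧ (g t.2.2 = true → t.1 ≠ π t.2.2 ∧ t.2.1 ≠ π t.2.2) ∧ (g t.2.1 = true → t.1 ≠ π t.2.1))
def cf3 {n : ℕ} (s t : Fin n × Fin n × Fin n) : Bool :=
  decide (s ≠ t ∧ ((s.1 = t.1 ∧ s.2.1 = t.2.1) ∨ (s.1 = t.1 ∧ s.2.2 = t.2.2) ∨ (s.2.1 = t.2.1 ∧ s.2.2 = t.2.2)))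
def cp3 {n : ℕ} (π : Fin n → Fin n) (s t : Fin n × Fin n × Fin n) : Bool :=
  decide (s.1 ≠ t.1 ∧ s.2.1 ≠ t.2.1 ∧ s.2.2 ≠ t.2.2 ∧ s.1 ≠ t.2.1 ∧ s.2.1 ≠ t.1 ∧ s.2.1 ≠ t.2.2 ∧ s.2.2 ≠ t.2.1 ∧ t.1 ≠ π s.2.2 ∧ s.1 ≠ π t.2.2)
lemma dec0 : ∀ a b c d : Fin 4, (∀ i j, ![a,b,c,d] i = ![a,b,c,d] j → i = j) → (∀ k, ![a,b,c,d] k ≠ k) → 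
   (Finset.univ.filter fun t => al ![a,b,c,d] (fun _ => true) t = true).card ≤ 4 := by decide +kernel
lemma dec1 : ∀ k0 a b c d : Fin 4, (∀ i j, ![a,b,c,d] i = ![a,b,c,d] j → i = j) → (∀ k, k ≠ k0 → ![a,b,c,d] k ≠ k) → 
   ![a,b,c,d] k0 = k0 → ∀ t, al ![a,b,c,d] (fun k => decide (k ≠ k0)) t = true → t.1 = k0 ∨ t.2.1 = k0 ∨ t.2.2 = k0 := by decide +kernel
lemma dec2 : ∀ k0 a b c d : Fin 4, (∀ i j, ![a,b,c,d] i = ![a,b,c,d] j → i = j) → (∀ k, ![a,b,c,d] k ≠ k) → 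
   ((Finset.univ.filter fun t => al ![a,b,c,d] (fun k => decide (k ≠ k0)) t = true).card < 8 ∨ 
    ((Finset.univ.filter fun t => al ![a,b,c,d] (fun k => decide (k ≠ k0)) t = true).card ≤ 8 ∧ 
      ∃ s, al ![a,b,c,d] (fun k => decide (k ≠ k0)) s = true ∧ ∃ t, al ![a,b,c,d] (fun k => decide (k ≠ k0)) t = true ∧ cf3 s t = true)) := by decide +kernel
lemma vec4 (π : Fin 4 → Fin 4) : π = ![π 0, π 1, π 2, π 3] := by
  ext i; fin_cases i <;> rfl
lemma vec5 (π : Fin 5 → Fin 5) : π = ![π 0, π 1, π 2, π 3, π 4] := by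
  ext i; fin_cases i <;> rfl
/-- sequence of iterates -/
def itr (π : Fin 5 → Fin 5) : Fin 5 → Fin 5 := ![0, π 0, π (π 0), π (π (π 0)), π (π (π (π 0)))]
lemma dec5 : ∀ a : Fin 5, a ≠ 0 → ∀ b : Fin 5, b ≠ 1 → b ≠ a → ∀ c : Fin 5, c ≠ 2 → c ≠ a → c ≠ b → 
    ∀ d : Fin 5, d ≠ 3 → d ≠ a → d ≠ b → d ≠ c → ∀ e : Fin 5, e ≠ 4 → e ≠ a → e ≠ b → e ≠ c → e ≠ d → 
   ((∃ i, ![a,b,c,d,e] (![a,b,c,d,e] i) = i) ∧ (∀ t, al ![a,b,c,d,e] (fun _ => true) t = true → 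
   (if ![a,b,c,d,e] (![a,b,c,d,e] t.1) = t.1 then 1 else 0) + (if ![a,b,c,d,e] (![a,b,c,d,e] t.2.1) = t.2.1 then 1 else 0)
   + (if ![a,b,c,d,e] (![a,b,c,d,e] t.2.2) = t.2.2 then 1 else 0) = 1) ∧ 
   (Finset.univ.filter fun i => ![a,b,c,d,e] (![a,b,c,d,e] i) = i).card = 2) ∨ 
   ((∀ i j, itr ![a,b,c,d,e] i = itr ![a,b,c,d,e] j → i = j) ∧ ∀ i, ![a,b,c,d,e] (itr ![a,b,c,d,e] i) = itr ![a,b,c,d,e] (i + 1)) := by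
  decide +kernel
lemma dec7 : ∀ t : Fin 5 × Fin 5 × Fin 5, al (fun k => k + 1) (fun _ => true) t = true → t = (t.1, t.1 + 3, t.1 + 1) ∨ ∃ i, t = (i, i+1, i+2) ∨ cp3 (fun k => k + 1) t (i, i+1,i+2) = true := by
  decide +kernel
lemma dec8 : ∀ i : Fin 5, cp3 (fun k => k + 1) (i,i+1,i+2) (i+2,i+4,i) = true ∧ cp3 (fun k => k + 1) (i+2,i+4,i) (i,i+1,i+3) = true ∧
   cp3 (fun k => k + 1) (i,i+1,i+3) (i+3,i+4,i) = true ∧ al (fun k => k + 1) (fun _ => true) (i,i+1,i+2) = true ∧ 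
   al (fun k => k + 1) (fun _ => true) (i+2,i+4,i) = true ∧ al (fun k => k + 1) (fun _ => true) (i,i+1,i+3) = true := by decide +kernel
lemma dec9 : ∀ t : Fin 5 × Fin 5 × Fin 5, al (fun k => k + 1) (fun _ => true) t = true → 
   (Finset.univ.filter fun s => al (fun k => k + 1) (fun _ => true) s = true ∧ cp3 (fun k => k + 1) t s = true).card = 2 := by decide +kernel
end Q19

namespace Q19
open scoped Classical
open Finset
variable {V : Type} {r : V → V → Prop}

structure Lab (r : V → V → Prop) (n : ℕ) (Q1 Q2 Q3 : Finset V) (e1 e2 e3 : Fin n → V) : Prop where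
  m1 : ∀ i, e1 i ∈ Q1
  m2 : ∀ i, e2 i ∈ Q2
  m3 : ∀ i, e3 i ∈ Q3
  i1 : ∀ {i j}, e1 i = e1 j → i = j
  i2 : ∀ {i j}, e2 i = e2 j → i = j
  i3 : ∀ {i j}, e3 i = e3 j → i = j
  s1 : ∀ y ∈ Q1, ∃ i, e1 i = y
  s2 : ∀ y ∈ Q2, ∃ i, e2 i = y
  s3 : ∀ y ∈ Q3, ∃ i, e3 i = y
  d12 : ∀ i j, e1 i ≠ e2 j
  d23 : ∀ i j, e2 i ≠ e3 j
  d13 : ∀ i j, e1 i ≠ e3 j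
  a12 : ∀ i, r (e1 i) (e2 i)
  a23 : ∀ i, r (e2 i) (e3 i)

lemma surj_of_inj {n : ℕ} {X : Finset V} (hX : X.card = n) {e : Fin n → V} (he : ∀ i, e i ∈ X) (hi : ∀ {i j}, e i = e j → i = j) :
    ∀ y ∈ X, ∃ i, e i = y := by
  have : univ.image e = X := by
    apply eq_of_subset_of_card_le
    · intro y hy; rw [mem_image] at hy; obtain ⟨i, -, rfl⟩ := hy; exact he i
    · rw [card_image_of_injective _ (fun i j => hi), hX]; simp
  intro y hy
  rw [← this, mem_image] at hy
  obtain ⟨i, -, hh⟩ := hy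
  exact ⟨i, hh⟩

lemma lab (h : Good r) {n : ℕ} {Q1 Q2 Q3 : Finset V} (c1 : Q1.card = n) (c2 : Q2.card = n) (c3 : Q3.card = n)
    (d12 : ∀ v ∈ Q1, v ∉ Q2) (d23 : ∀ v ∈ Q2, v ∉ Q3) (d13 : ∀ v ∈ Q1, v ∉ Q3)
    (h21 : ∀ y ∈ Q2, ∃ w ∈ Q1, r y w) (h23 : ∀ y ∈ Q2, ∃ w ∈ Q3, r y w) (h12 : ∀ y ∈ Q1, dg r Q2 y ≤ 1)
    (h32 : ∀ y ∈ Q3, dg r Q2 y ≤ 1) : ∃ e1 e2 e3, Lab r n Q1 Q2 Q3 e1 e2 e3 := by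
  let E := Q2.equivFinOfCardEq c2
  set e2 : Fin n → V := fun i => (E.symm i : V) with he2
  have m2 : ∀ i, e2 i ∈ Q2 := fun i => (E.symm i).2
  have i2 : ∀ {i j}, e2 i = e2 j → i = j := by
    intro i j hij
    exact E.symm.injective (Subtype.ext hij)
  choose e1 m1 a1 using fun i => h21 (e2 i) (m2 i)
  choose e3 m3 a3 using fun i => h23 (e2 i) (m2 i)
  have i1 : ∀ {i j}, e1 i = e1 j → i = j := by
    intro i j hij
    have := a1 j
    rw [← hij] at this
    exact i2 (dg_le_one (h12 _ (m1 i)) (m2 i) (m2 j) (h.sy (a1 i)) (h.sy this))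
  have i3 : ∀ {i j}, e3 i = e3 j → i = j := by
    intro i j hij
    have := a3 j
    rw [← hij] at this
    exact i2 (dg_le_one (h32 _ (m3 i)) (m2 i) (m2 j) (h.sy (a3 i)) (h.sy this))
  exact ⟨e1, e2, e3, m1, m2, m3, i1, i2, i3, surj_of_inj c1 m1 i1, surj_of_inj c2 m2 i2, surj_of_inj c3 m3 i3,
    fun i j hh => d12 _ (m1 i) (hh ▸ m2 j), fun i j hh => d23 _ (m2 i) (hh ▸ m3 j), fun i j hh => d13 _ (m1 i) (hh ▸ m3 j),
    fun i => h.sy (a1 i), a3⟩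

namespace Lab
variable {n : ℕ} {Q1 Q2 Q3 : Finset V} {e1 e2 e3 : Fin n → V}

lemma alw (L : Lab r n Q1 Q2 Q3 e1 e2 e3) (h : Good r) {π : Fin n → Fin n} {g : Fin n → Bool} 
    (hg : ∀ k, g k = true → r (e3 k) (e1 (π k))) {v : V} (n1 : v ∉ Q1) (n2 : v ∉ Q2) (n3 : v ∉ Q3) (t : Fin n × Fin n × Fin n)
    (h1 : r v (e1 t.1)) (h2 : r v (e2 t.2.1)) (h3 : r v (e3 t.2.2)) : al π g t = true := by
  obtain ⟨i, j, k⟩ := t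
  simp only at h1 h2 h3
  simp only [al, decide_eq_true_eq]
  have a12 := L.a12
  have a23 := L.a23
  have d1 : ∀ i, v ≠ e1 i := fun i hh => n1 (hh ▸ L.m1 i)
  have d2 : ∀ i, v ≠ e2 i := fun i hh => n2 (hh ▸ L.m2 i)
  have d3 : ∀ i, v ≠ e3 i := fun i hh => n3 (hh ▸ L.m3 i)
  refine ⟨?_, ?_, ?_, ?_, ?_⟩
  · rintro rfl; exact h.c3 h1 (a12 i) h2
  · rintro rfl; exact h.c3 h2 (a23 j) h3
  · rintro rfl
    exact d2 i (h.c4 h1 h3 (h.sy (a12 i)) (a23 i) (L.d13 _ _))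
  · intro hk
    have := hg k hk
    refine ⟨?_, ?_⟩
    · rintro rfl; exact h.c3 h3 this h1
    · rintro rfl
      exact d1 _ (h.c4 h2 h3 (a12 _) (h.sy this) (L.d23 _ _))
  · intro hk
    have := hg j hk
    rintro rfl
    exact d3 _ (h.c4 h1 h2 this (h.sy (a23 j)) (L.d12 _ _))

lemma cnt (L : Lab r n Q1 Q2 Q3 e1 e2 e3) (h : Good r) (hn : 0 < n) {W : Finset V}
    (hW : ∀ v ∈ W, (∃ w ∈ Q1, r v w) ∧ (∃ w ∈ Q2, r v w) ∧ (∃ w ∈ Q3, r v w)) :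
    ∃ F : Finset (Fin n × Fin n × Fin n), F.card = W.card ∧
      (∀ t ∈ F, ∃ v ∈ W, r v (e1 t.1) ∧ r v (e2 t.2.1) ∧ r v (e3 t.2.2)) ∧
      (∀ v ∈ W, ∃ t ∈ F, r v (e1 t.1) ∧ r v (e2 t.2.1) ∧ r v (e3 t.2.2)) ∧
      ∀ s ∈ F, ∀ t ∈ F, cf3 s t = true → False := by
  have ex : ∀ v : V, ∃ t : Fin n × Fin n × Fin n, v ∈ W → r v (e1 t.1) ∧ r v (e2 t.2.1) ∧ r v (e3 t.2.2) := by
    intro v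
    by_cases hv : v ∈ W
    · obtain ⟨⟨a, ha, ra⟩, ⟨b, hb, rb⟩, ⟨c, hc, rc⟩⟩ := hW v hv
      obtain ⟨i, rfl⟩ := L.s1 a ha
      obtain ⟨j, rfl⟩ := L.s2 b hb
      obtain ⟨k, rfl⟩ := L.s3 c hc
      exact ⟨(i, j, k), fun _ => ⟨ra, rb, rc⟩⟩
    · exact ⟨⟨⟨0, hn⟩, ⟨0, hn⟩, ⟨0, hn⟩⟩, fun hh => absurd hh hv⟩
  choose f hf using ex
  refine ⟨W.image f, ?_, ?_, ?_, ?_⟩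
  · apply card_image_of_injOn
    intro v hv w hw hvw
    have a := hf v hv
    have b := hf w hw
    rw [← hvw] at b
    exact h.c4 a.1 a.2.1 b.1 b.2.1 (L.d12 _ _)
  · intro t ht
    rw [mem_image] at ht
    obtain ⟨v, hv, rfl⟩ := ht
    exact ⟨v, hv, hf v hv⟩
  · intro v hv
    exact ⟨f v, mem_image_of_mem _ hv, hf v hv⟩
  · intro s hs t ht hc
    rw [mem_image] at hs ht
    obtain ⟨v, hv, rfl⟩ := hs
    obtain ⟨w, hw, rfl⟩ := ht
    simp only [cf3, decide_eq_true_eq] at hc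
    obtain ⟨hne, hc⟩ := hc
    have a := hf v hv
    have b := hf w hw
    apply hne
    congr 1
    rcases hc with ⟨c1, c2⟩ | ⟨c1, c2⟩ | ⟨c1, c2⟩
    · rw [← c1, ← c2] at b
      exact h.c4 a.1 a.2.1 b.1 b.2.1 (L.d12 _ _)
    · rw [← c1, ← c2] at b
      exact h.c4 a.1 a.2.2 b.1 b.2.2 (L.d13 _ _)
    · rw [← c1, ← c2] at b
      exact h.c4 a.2.1 a.2.2 b.2.1 b.2.2 (L.d23 _ _)

lemma cpw (L : Lab r n Q1 Q2 Q3 e1 e2 e3) (h : Good r) {π : Fin n → Fin n}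
    (hg : ∀ k, r (e3 k) (e1 (π k))) {v w : V} (n1 : v ∉ Q1) (n2 : v ∉ Q2) (n3 : v ∉ Q3)
    (m1 : w ∉ Q1) (m2 : w ∉ Q2) (m3 : w ∉ Q3) (hvw : r v w) (s t : Fin n × Fin n × Fin n)
    (h1 : r v (e1 s.1)) (h2 : r v (e2 s.2.1)) (h3 : r v (e3 s.2.2))
    (k1 : r w (e1 t.1)) (k2 : r w (e2 t.2.1)) (k3 : r w (e3 t.2.2)) : cp3 π s t = true := by
  obtain ⟨i, j, k⟩ := s
  obtain ⟨i', j', k'⟩ := t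
  simp only at h1 h2 h3 k1 k2 k3
  simp only [cp3, decide_eq_true_eq]
  have a12 := L.a12
  have a23 := L.a23
  have key : ∀ x y, r v x → r w y → r x y → v ≠ y → w ≠ x → False := fun x y hx hy hxy h1 h2 => 
    h1 (h.c4 hvw hx (h.sy hy) (h.sy hxy) h2)
  have d1 : ∀ i, v ≠ e1 i := fun i hh => n1 (hh ▸ L.m1 i)
  have d2 : ∀ i, v ≠ e2 i := fun i hh => n2 (hh ▸ L.m2 i)
  have d3 : ∀ i, v ≠ e3 i := fun i hh => n3 (hh ▸ L.m3 i)
  have f1 : ∀ i, w ≠ e1 i := fun i hh => m1 (hh ▸ L.m1 i)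
  have f2 : ∀ i, w ≠ e2 i := fun i hh => m2 (hh ▸ L.m2 i)
  have f3 : ∀ i, w ≠ e3 i := fun i hh => m3 (hh ▸ L.m3 i)
  refine ⟨?_, ?_, ?_, ?_, ?_, ?_, ?_, ?_, ?_⟩
  · rintro rfl; exact h.c3 hvw k1 h1
  · rintro rfl; exact h.c3 hvw k2 h2
  · rintro rfl; exact h.c3 hvw k3 h3
  · rintro rfl; exact key _ _ h1 k2 (a12 _) (d2 _) (f1 _)
  · rintro rfl; exact key _ _ h2 k1 (h.sy (a12 _)) (d1 _) (f2 _)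
  · rintro rfl; exact key _ _ h2 k3 (a23 _) (d3 _) (f2 _)
  · rintro rfl; exact key _ _ h3 k2 (h.sy (a23 _)) (d2 _) (f3 _)
  · rintro rfl; exact key _ _ h3 k1 (hg _) (d1 _) (f3 _)
  · rintro rfl; exact key _ _ h1 k3 (h.sy (hg _)) (d3 _) (f1 _)
end Lab
end Q19

namespace Q19
open scoped Classical
open Finset
variable {V : Type} {r : V → V → Prop}
namespace D28
variable {N P Q : Finset V}

lemma own (D : D28 r N P Q) {v a b : V} (hv : v ∈ Q) (ha : a ∈ N) (hb : b ∈ N) (ra : r v a) (rb : r v b) : a = b :=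
  dg_le_one (by rw [D.qN hv]) ha hb ra rb

lemma dj (D : D28 r N P Q) {a b : V} (ha : a ∈ N) (hb : b ∈ N) (hab : a ≠ b) : ∀ v ∈ nb r Q a, v ∉ nb r Q b := by
  intro v hv hv'
  rw [mem_nb] at hv hv'
  exact hab (D.own hv.1 ha hb (D.h.sy hv.2) (D.h.sy hv'.2))

lemma le1 (D : D28 r N P Q) {a v : V} (hv : v ≠ a) : dg r (nb r Q a) v ≤ 1 := by
  by_contra hc
  obtain ⟨x, hx, y, hy, hxy⟩ := one_lt_card.1 (show 1 < (nb r (nb r Q a) v).card by change ¬ dg r _ _ ≤ 1 at hc; unfold dg at hc; omega)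
  rw [mem_nb, mem_nb] at hx hy
  exact hv (D.h.c4 hx.2 hy.2 hx.1.2 hy.1.2 hxy)

lemma QN (D : D28 r N P Q) {a v : V} (hv : v ∈ Q) (ha : a ∈ N) : v ≠ a := by
  rintro rfl; exact D.dNQ ha hv

lemma full (D : D28 r N P Q) {v b : V} (hv : v ∈ Q) (hd : dg r Q v ≠ 1) (hb : b ∈ N) (hn : ¬ r v b) : ∃ w ∈ nb r Q b, r v w := by
  rcases D.q hv with h1 | h1
  · obtain ⟨w, hw, h2, h3⟩ := h1.2.2 b hb hn
    exact ⟨w, mem_nb.2 ⟨hw, D.h.sy h3⟩, h2⟩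
  · exact absurd h1.1 hd

lemma mklab (D : D28 r N P Q) {a b c : V} (ha : a ∈ N) (hb : b ∈ N) (hc : c ∈ N) (hab : a ≠ b) (hbc : b ≠ c) (hac : a ≠ c)
    (hf : ∀ v ∈ nb r Q b, dg r Q v ≠ 1) : ∃ e1 e2 e3, Lab r 4 (nb r Q a) (nb r Q b) (nb r Q c) e1 e2 e3 := by
  apply lab D.h (D.nQ ha) (D.nQ hb) (D.nQ hc) (D.dj ha hb hab) (D.dj hb hc hbc) (D.dj ha hc hac)
  · intro y hy
    have hy' := mem_nb.1 hy
    exact D.full hy'.1 (hf y hy) ha (fun hh => hab (D.own hy'.1 ha hb hh (D.h.sy hy'.2)))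
  · intro y hy
    have hy' := mem_nb.1 hy
    exact D.full hy'.1 (hf y hy) hc (fun hh => hbc (D.own hy'.1 hb hc (D.h.sy hy'.2) hh))
  · intro y hy; exact D.le1 (D.QN (mem_nb.1 hy).1 hb)
  · intro y hy; exact D.le1 (D.QN (mem_nb.1 hy).1 hb)

lemma cntF (D : D28 r N P Q) {a b c : V} (ha : a ∈ N) (hb : b ∈ N) (hc : c ∈ N) {e1 e2 e3 : Fin 4 → V}
    (L : Lab r 4 (nb r Q a) (nb r Q b) (nb r Q c) e1 e2 e3) {π : Fin 4 → Fin 4} {g : Fin 4 → Bool} 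
    (hg : ∀ k, g k = true → r (e3 k) (e1 (π k))) :
    ∃ F : Finset (Fin 4 × Fin 4 × Fin 4), F.card = (P.filter fun v => dg r Q v = 3).card ∧ 
      (∀ t ∈ F, al π g t = true) ∧ (∀ v ∈ P.filter (fun v => dg r Q v = 3), ∃ t ∈ F, r v (e1 t.1) ∧ r v (e2 t.2.1) ∧ r v (e3 t.2.2)) ∧
      ∀ s ∈ F, ∀ t ∈ F, cf3 s t = true → False := by
  have nP : ∀ q, ∀ v ∈ P, v ∉ nb r Q q := fun q v hv hh => D.dPQ hv (mem_nb.1 hh).1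
  obtain ⟨F, h1, h2, h3, h4⟩ := L.cnt D.h (by norm_num) (W := P.filter fun v => dg r Q v = 3) (by
    intro v hv
    rw [mem_filter] at hv
    rcases D.p hv.1 with hp | hp
    · omega
    · have : ∀ q ∈ N, ∃ w ∈ nb r Q q, r v w := by
        intro q hq
        obtain ⟨w, hw, h5, h6⟩ := hp.2.2 q hq
        exact ⟨w, mem_nb.2 ⟨hw, D.h.sy h6⟩, h5⟩
      exact ⟨this a ha, this b hb, this c hc⟩)
  refine ⟨F, h1, ?_, h3, h4⟩
  intro t ht
  obtain ⟨v, hv, r1, r2, r3⟩ := h2 t ht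
  have hv := (mem_filter.1 hv).1
  exact L.alw D.h hg (nP _ _ hv) (nP _ _ hv) (nP _ _ hv) t r1 r2 r3

lemma cnts (D : D28 r N P Q) : (P.filter fun v => dg r Q v = 3).card = 6 + (Q.filter fun v => dg r Q v = 1).card ∧ 
    ((Q.filter fun v => dg r Q v = 1).card = 0 ∨ (Q.filter fun v => dg r Q v = 1).card = 2) := by
  have e1 : ∑ v ∈ P, dg r Q v = 2 * P.card + (P.filter fun v => dg r Q v = 3).card := by
    rw [card_filter, mul_comm, ← smul_eq_mul, ← sum_const, ← sum_add_distrib]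
    refine sum_congr rfl fun v hv => ?_
    rcases D.p hv with hp | hp
    · simp [hp.1]
    · simp [hp.1]
  have e2 : ∑ v ∈ Q, dg r P v = 2 * Q.card + (Q.filter fun v => dg r Q v = 1).card := by
    rw [card_filter, mul_comm, ← smul_eq_mul, ← sum_const, ← sum_add_distrib]
    refine sum_congr rfl fun v hv => ?_
    rcases D.q hv with hp | hp
    · simp [hp.1, hp.2.1]
    · simp [hp.1, hp.2]
  have e3 : ∑ v ∈ Q, dg r Q v + (Q.filter fun v => dg r Q v = 1).card = 2 * Q.card := by
    rw [card_filter, mul_comm, ← smul_eq_mul, ← sum_const, ← sum_add_distrib]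
    refine sum_congr rfl fun v hv => ?_
    rcases D.q hv with hp | hp
    · simp [hp.1]
    · simp [hp.1]
  obtain ⟨e, he⟩ := E2_even D.h Q
  unfold E2 at he
  have := sum_dg_comm D.h P Q
  have h1 : (P.filter fun v => dg r Q v = 3).card ≤ P.card := card_filter_le _ _
  have := D.cP
  have := D.cQ
  omega

lemma fls (D : D28 r N P Q) : False := by
  have h := D.h
  obtain ⟨c3, hc⟩ := D.cnts
  rcases hc with hc | hc
  · obtain ⟨a, b, c, hab, hac, hbc, hN⟩ := card_eq_three.1 D.cN
    have ha : a ∈ N := by rw [hN]; simp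
    have hb : b ∈ N := by rw [hN]; simp
    have hc' : c ∈ N := by rw [hN]; simp
    have fu : ∀ v ∈ Q, dg r Q v ≠ 1 := by
      intro v hv hh
      rw [card_eq_zero] at hc
      have : v ∈ (Q.filter fun v => dg r Q v = 1) := mem_filter.2 ⟨hv, hh⟩
      rw [hc] at this
      simp at this
    obtain ⟨e1, e2, e3, L⟩ := D.mklab ha hb hc' hab hbc hac (fun v hv => fu v (mem_nb.1 hv).1)
    have ex : ∀ k, ∃ i, r (e3 k) (e1 i) := by
      intro k
      have hk := mem_nb.1 (L.m3 k)
      obtain ⟨w, hw, h1⟩ := D.full hk.1 (fu _ hk.1) ha (fun hh => hac (D.own hk.1 ha hc' hh (h.sy hk.2)))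
      obtain ⟨i, rfl⟩ := L.s1 w hw
      exact ⟨i, h1⟩
    choose π hπ using ex
    obtain ⟨F, f1, f2, -, -⟩ := D.cntF ha hb hc' L (π := π) (g := fun _ => true) (fun k _ => hπ k)
    have d := dec0 (π 0) (π 1) (π 2) (π 3)
    rw [← vec4 π] at d
    have := d (by
      intro i j hij
      have hj := hπ j
      rw [← hij] at hj
      exact L.i3 (dg_le_one (D.le1 (D.QN (mem_nb.1 (L.m1 (π i))).1 hc')) (L.m3 i) (L.m3 j) (h.sy (hπ i)) (h.sy hj))) (by
      intro k hk
      have := hπ k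
      rw [hk] at this
      exact h.c3 (L.a12 k) (L.a23 k) (h.sy this))
    have h2 : F.card ≤ _ := card_le_card (fun t ht => mem_filter.2 ⟨mem_univ t, f2 t ht⟩)
    have := h2.trans this
    omega
  · have ex : ∃ a b c u, a ∈ N ∧ b ∈ N ∧ c ∈ N ∧ a ≠ b ∧ b ≠ c ∧ a ≠ c ∧ (∀ x ∈ N, x = a ∨ x = b ∨ x = c) ∧ u ∈ Q ∧ dg r Q u = 1 ∧ r u a ∧ 
        ∀ w ∈ nb r Q b, ¬ r u w := by
      obtain ⟨u, hu⟩ := card_pos.1 (show 0 < (Q.filter fun v => dg r Q v = 1).card by omega)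
      rw [mem_filter] at hu
      obtain ⟨a, ha, ra, -⟩ := dg_one (D.qN hu.1)
      have : (N.erase a).card = 2 := by rw [card_erase_of_mem ha, D.cN]
      obtain ⟨b, c, hbc, hE⟩ := card_eq_two.1 this
      have hb : b ∈ N.erase a := by rw [hE]; simp
      have hc' : c ∈ N.erase a := by rw [hE]; simp
      rw [mem_erase] at hb hc'
      have cov : ∀ x ∈ N, x = a ∨ x = b ∨ x = c := by
        intro x hx
        by_cases e : x = a
        · exact Or.inl e
        · have : x ∈ N.erase a := mem_erase.2 ⟨e, hx⟩
          rw [hE] at this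
          simpa using Or.inr this
      obtain ⟨w, hw, rw1, rw2⟩ := dg_one hu.2
      by_cases e : r b w
      · refine ⟨a, c, b, u, ha, hc'.2, hb.2, hc'.1.symm, hbc.symm, hb.1.symm, ?_, hu.1, hu.2, ra, ?_⟩
        · intro x hx
          have := cov x hx
          tauto
        · intro x hx hux
          rw [mem_nb] at hx
          have := rw2 x hx.1 hux
          subst this
          exact hbc (D.own hw hb.2 hc'.2 (h.sy e) (h.sy hx.2))
      · refine ⟨a, b, c, u, ha, hb.2, hc'.2, hb.1.symm, hbc, hc'.1.symm, cov, hu.1, hu.2, ra, ?_⟩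
        intro x hx hux
        rw [mem_nb] at hx
        have := rw2 x hx.1 hux
        subst this
        exact e hx.2
    obtain ⟨a, b, c, u, ha, hb, hc', hab, hbc, hac, cov, hu, du, ra, nu⟩ := ex
    have ua : u ∈ nb r Q a := mem_nb.2 ⟨hu, h.sy ra⟩
    have : ∃ u2 ∈ nb r Q b, dg r (nb r Q a) u2 = 0 := by
      by_contra hcon
      push Not at hcon
      have s1 : (nb r Q b).card ≤ ∑ v ∈ nb r Q b, dg r (nb r Q a) v := by
        rw [card_eq_sum_ones]
        exact sum_le_sum fun v hv => Nat.one_le_iff_ne_zero.2 (hcon v hv)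
      rw [sum_dg_comm h] at s1
      rw [← add_sum_erase _ _ ua] at s1
      have : dg r (nb r Q b) u = 0 := by
        by_contra hne
        obtain ⟨w, hw, h1⟩ := dg_pos.1 (Nat.pos_of_ne_zero hne)
        exact nu w hw h1
      have s2 : ∑ v ∈ (nb r Q a).erase u, dg r (nb r Q b) v ≤ ((nb r Q a).erase u).card := by
        rw [card_eq_sum_ones]
        exact sum_le_sum fun v hv => D.le1 (D.QN (mem_nb.1 (mem_erase.1 hv).2).1 hb)
      rw [card_erase_of_mem ua] at s2
      have := D.nQ ha
      have := D.nQ hb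
      unfold dg at *
      omega
    obtain ⟨u2, ub, hu2⟩ := this
    have mu2 := mem_nb.1 ub
    have u2a : ∀ w ∈ nb r Q a, ¬ r u2 w := by
      intro w hw hh
      have := dg_pos.2 ⟨w, hw, hh⟩
      omega
    have du2 : dg r Q u2 = 1 := by
      by_contra hne
      obtain ⟨w, hw, h1⟩ := D.full mu2.1 hne ha (fun hh => hab (D.own mu2.1 ha hb hh (h.sy mu2.2)))
      exact u2a w hw h1
    have une : u ≠ u2 := by
      rintro rfl; exact D.dj ha hb hab u ua ub
    have Qe : ∀ v ∈ Q, dg r Q v = 1 → v = u ∨ v = u2 := by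
      have : ({u, u2} : Finset V) = Q.filter fun v => dg r Q v = 1 := by
        apply eq_of_subset_of_card_le
        · intro x hx
          simp only [mem_insert, mem_singleton] at hx
          rw [mem_filter]
          rcases hx with rfl | rfl
          · exact ⟨hu, du⟩
          · exact ⟨mu2.1, du2⟩
        · rw [card_pair une, hc]
      intro v hv hd
      have h2 : v ∈ Q.filter fun v => dg r Q v = 1 := mem_filter.2 ⟨hv, hd⟩
      rw [← this] at h2
      simpa using h2
    obtain ⟨e1, e2, e3, L⟩ := D.mklab ha hc' hb hac hbc.symm hab (by
      intro v hv hd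
      rcases Qe v (mem_nb.1 hv).1 hd with rfl | rfl
      · exact D.dj ha hc' hac _ ua hv
      · exact D.dj hb hc' hbc _ ub hv)
    obtain ⟨k0, hk0⟩ := L.s3 u2 ub
    obtain ⟨i0, hi0⟩ := L.s1 u ua
    have ex : ∀ k, ∃ i, (k ≠ k0 → r (e3 k) (e1 i)) ∧ (k = k0 → i = i0) := by
      intro k
      by_cases e : k = k0
      · exact ⟨i0, fun hh => absurd e hh, fun _ => rfl⟩
      · have hk := mem_nb.1 (L.m3 k)
        obtain ⟨w, hw, h1⟩ := D.full hk.1 (by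
          intro hd
          rcases Qe _ hk.1 hd with h1 | h1
          · exact D.dj ha hb hab u ua (h1 ▸ L.m3 k)
          · exact e (L.i3 (h1.trans hk0.symm))) ha (fun hh => hab (D.own hk.1 ha hb hh (h.sy hk.2)))
        obtain ⟨i, rfl⟩ := L.s1 w hw
        exact ⟨i, fun _ => h1, fun hh => absurd hh e⟩
    choose π hπ hπ0 using ex
    have hπ0 := hπ0 k0 rfl
    obtain ⟨F, f1, f2, f3, f4⟩ := D.cntF ha hc' hb L (π := π) (g := fun k => decide (k ≠ k0)) (fun k hk => hπ k (by simpa using hk))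
    have inj : ∀ i j, π i = π j → i = j := by
      intro i j hij
      have aux : ∀ k, k ≠ k0 → π k ≠ π k0 := by
        intro k hk hh
        have := hπ k hk
        rw [hh, hπ0, hi0] at this
        exact nu _ (L.m3 k) (h.sy this)
      by_cases ei : i = k0
      · by_cases ej : j = k0
        · rw [ei, ej]
        · exact absurd (by rw [← hij, ei]) (aux j ej)
      · by_cases ej : j = k0
        · exact absurd (by rw [hij, ej]) (aux i ei)
        · have hj := hπ j ej
          rw [← hij] at hj
          exact L.i3 (dg_le_one (D.le1 (D.QN (mem_nb.1 (L.m1 (π i))).1 hb)) (L.m3 i) (L.m3 j) (h.sy (hπ i ei)) (h.sy hj))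
    have nf : ∀ k, k ≠ k0 → π k ≠ k := by
      intro k hk hh
      have := hπ k hk
      rw [hh] at this
      exact h.c3 (L.a12 k) (L.a23 k) (h.sy this)
    by_cases e0 : π k0 = k0
    · have d := dec1 k0 (π 0) (π 1) (π 2) (π 3)
      rw [← vec4 π] at d
      have d := d inj nf e0
      set P3 := P.filter fun v => dg r Q v = 3 with hP3
      have hi0k : i0 = k0 := by rw [← hπ0, e0]
      rw [hi0k] at hi0
      set y := e2 k0 with hy
      have yc := L.m2 k0
      rw [← hy] at yc
      have yQ := (mem_nb.1 yc).1
      have ruy : r u y := by rw [← hi0]; exact L.a12 k0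
      have ru2y : r u2 y := by rw [← hk0]; exact h.sy (L.a23 k0)
      have dy : dg r P y = 2 := by
        rcases D.q yQ with hq | hq
        · exact hq.2.1
        · rcases Qe y yQ hq.1 with e | e
          · exact absurd ruy (e ▸ h.ir)
          · exact absurd ru2y (e ▸ h.ir)
      have dPu : dg r P u = 3 := by
        rcases D.q hu with hq | hq <;> omega
      have dPu2 : dg r P u2 = 3 := by
        rcases D.q mu2.1 with hq | hq <;> omega
      have sub : ∀ v ∈ P3, r v u ∨ r v y ∨ r v u2 := by
        intro v hv
        obtain ⟨t, ht, r1, r2, r3⟩ := f3 v hv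
        rcases d t (f2 t ht) with e | e | e
        · rw [e, hi0] at r1; exact Or.inl r1
        · rw [e] at r2; exact Or.inr (Or.inl r2)
        · rw [e, hk0] at r3; exact Or.inr (Or.inr r3)
      have P3P : ∀ v ∈ P3, v ∈ P := fun v hv => (mem_filter.1 hv).1
      have eq : P3 = nb r P u ∪ (nb r P y ∪ nb r P u2) := by
        apply eq_of_subset_of_card_le
        · intro v hv
          simp only [mem_union, mem_nb]
          have := sub v hv
          have := P3P v hv
          rcases sub v hv with e | e | e
          · exact Or.inl ⟨this, h.sy e⟩
          · exact Or.inr (Or.inl ⟨this, h.sy e⟩)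
          · exact Or.inr (Or.inr ⟨this, h.sy e⟩)
        · have := card_union_le (nb r P u) (nb r P y ∪ nb r P u2)
          have := card_union_le (nb r P y) (nb r P u2)
          unfold dg at dy dPu dPu2
          omega
      obtain ⟨v, hv, v', hv', hne, rv, rv', -⟩ := dg_two dy
      have pt : ∀ x ∈ P, r y x → ∃ p ∈ P \ P3, r x p := by
        intro x hx rx
        have hx3 : x ∈ P3 := by rw [eq]; simp [mem_nb, hx, rx]
        have : dg r P x = 1 := by
          have := (mem_filter.1 hx3).2
          rcases D.p hx with hp | hp <;> omega
        obtain ⟨p, hp, rp, -⟩ := dg_one this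
        refine ⟨p, ?_, rp⟩
        rw [mem_sdiff]
        refine ⟨hp, fun hp3 => ?_⟩
        have yp : y ≠ p := by rintro rfl; exact D.dPQ hp yQ
        rcases sub p hp3 with e | e | e
        · exact D.dPQ hx ((h.c4 (h.sy rx) rp ruy (h.sy e) yp) ▸ hu)
        · exact h.c3 rx rp (h.sy e)
        · exact D.dPQ hx ((h.c4 (h.sy rx) rp ru2y (h.sy e) yp) ▸ mu2.1)
      obtain ⟨p, hp, rp⟩ := pt v hv rv
      obtain ⟨p', hp', rp'⟩ := pt v' hv' rv'
      have : (P \ P3).card ≤ 1 := by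
        have hs : P3 ⊆ P := filter_subset _ _
        rw [card_sdiff_of_subset hs, D.cP]; omega
      have pp : p = p' := card_le_one.1 this p hp p' hp'
      subst pp
      have := h.c4 rv rv' (h.sy rp) (h.sy rp') hne
      subst this
      exact D.dPQ (mem_sdiff.1 hp).1 yQ
    · have d := dec2 k0 (π 0) (π 1) (π 2) (π 3)
      rw [← vec4 π] at d
      have d := d inj (by
        intro k
        by_cases e : k = k0
        · rw [e]; exact e0
        · exact nf k e)
      have hs : F ⊆ Finset.univ.filter fun t => al π (fun k => decide (k ≠ k0)) t = true := 
        fun t ht => mem_filter.2 ⟨mem_univ t, f2 t ht⟩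
      have h2 := card_le_card hs
      rcases d with d | ⟨d, s, hs1, t, ht1, hst⟩
      · have := lt_of_le_of_lt h2 d
        omega
      · have hE := eq_of_subset_of_card_le hs (d.trans (by rw [f1, c3, hc]))
        refine f4 s ?_ t ?_ hst
        · rw [hE]; exact mem_filter.2 ⟨mem_univ s, hs1⟩
        · rw [hE]; exact mem_filter.2 ⟨mem_univ t, ht1⟩
end D28
lemma C28.c0 {S A B C : Finset V} (H : C28 r S A B C) : C.card = 0 := by
  rcases H.c1or4 with h1 | h1 | h1
  · exact h1
  · obtain ⟨N, P, Q, D⟩ := H.toD h1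
    exact D.fls.elim
  · exact absurd h1 H.c4
end Q19

namespace Q19
open scoped Classical
open Finset
variable {V : Type} {r : V → V → Prop}

structure C29 (r : V → V → Prop) (N1 N2 N3 Z : Finset V) : Prop where
  h : Good r
  c1 : N1.card = 5
  c2 : N2.card = 5
  c3 : N3.card = 5
  cZ : Z.card = 10
  d12 : ∀ v ∈ N1, v ∉ N2
  d23 : ∀ v ∈ N2, v ∉ N3
  d13 : ∀ v ∈ N1, v ∉ N3
  z1 : ∀ v ∈ Z, v ∉ N1
  z2 : ∀ v ∈ Z, v ∉ N2
  z3 : ∀ v ∈ Z, v ∉ N3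
  n12 : ∀ v ∈ N1, dg r N2 v = 1
  n13 : ∀ v ∈ N1, dg r N3 v = 1
  n21 : ∀ v ∈ N2, dg r N1 v = 1
  n23 : ∀ v ∈ N2, dg r N3 v = 1
  n31 : ∀ v ∈ N3, dg r N1 v = 1
  n32 : ∀ v ∈ N3, dg r N2 v = 1
  y1 : ∀ v ∈ N1, dg r Z v = 2
  y2 : ∀ v ∈ N2, dg r Z v = 2
  y3 : ∀ v ∈ N3, dg r Z v = 2
  w1 : ∀ v ∈ Z, dg r N1 v = 1
  w2 : ∀ v ∈ Z, dg r N2 v = 1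
  w3 : ∀ v ∈ Z, dg r N3 v = 1
  zz : ∀ v ∈ Z, dg r Z v = 2

lemma ex_of_one {X : Finset V} {v : V} (hd : dg r X v = 1) : ∃ w ∈ X, r v w := dg_pos.1 (by omega)

lemma sumI (h : Good r) {n : ℕ} {Z : Finset V} {e : Fin n → V} {t : V → Fin n} (I : Finset (Fin n))
    (ht : ∀ z ∈ Z, r z (e (t z))) (hu : ∀ z ∈ Z, ∀ i, r z (e i) → i = t z) :
    ∑ i ∈ I, dg r Z (e i) = ∑ z ∈ Z, if t z ∈ I then 1 else 0 := by
  simp only [dg_eq_sum]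
  rw [sum_comm]
  refine sum_congr rfl fun z hz => ?_
  rw [← sum_ite_eq' I (t z) (fun _ => 1)]
  refine sum_congr rfl fun i _ => ?_
  by_cases e1 : i = t z
  · subst e1
    simp [h.sy (ht z hz)]
  · have : ¬ r (e i) z := fun hh => e1 (hu z hz i (h.sy hh))
    simp [e1, this]

namespace C29
variable {N1 N2 N3 Z : Finset V}
lemma five (D : C29 r N1 N2 N3 Z) {e1 e2 e3 : Fin 5 → V} (L : Lab r 5 N1 N2 N3 e1 e2 e3)
    (hπ : ∀ k, r (e3 k) (e1 (k + 1))) : False := by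
  have h := D.h
  obtain ⟨F, f1, f2, f3, f4⟩ := L.cnt h (by norm_num) (W := Z) (fun v hv => 
    ⟨ex_of_one (D.w1 v hv), ex_of_one (D.w2 v hv), ex_of_one (D.w3 v hv)⟩)
  have alF : ∀ t ∈ F, al (fun k => k + 1) (fun _ => true) t = true := by
    intro t ht
    obtain ⟨v, hv, r1, r2, r3⟩ := f2 t ht
    exact L.alw h (fun k _ => hπ k) (D.z1 v hv) (D.z2 v hv) (D.z3 v hv) t r1 r2 r3
  have cl : ∀ s ∈ F, ∀ t, al (fun k => k + 1) (fun _ => true) t = true → cp3 (fun k => k + 1) s t = true → t ∈ F := by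
    intro s hs t hal hcp
    obtain ⟨v, hv, r1, r2, r3⟩ := f2 s hs
    obtain ⟨z, hz, z', hz', hne, rz, rz', -⟩ := dg_two (D.zz v hv)
    obtain ⟨a, ha, a1, a2, a3⟩ := f3 z hz
    obtain ⟨b, hb, b1, b2, b3⟩ := f3 z' hz'
    have ca := L.cpw h hπ (D.z1 v hv) (D.z2 v hv) (D.z3 v hv) (D.z1 z hz) (D.z2 z hz) (D.z3 z hz) rz s a r1 r2 r3 a1 a2 a3
    have cb := L.cpw h hπ (D.z1 v hv) (D.z2 v hv) (D.z3 v hv) (D.z1 z' hz') (D.z2 z' hz') (D.z3 z' hz') rz' s b r1 r2 r3 b1 b2 b3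
    have hab : a ≠ b := by
      rintro rfl
      exact hne (h.c4 a1 a2 b1 b2 (L.d12 _ _))
    have h9 := dec9 s (alF s hs)
    have hsub : ({a, b} : Finset (Fin 5 × Fin 5 × Fin 5)) ⊆ 
        Finset.univ.filter fun x => al (fun k => k + 1) (fun _ => true) x = true ∧ cp3 (fun k => k + 1) s x = true := by
      intro x hx
      simp only [mem_insert, mem_singleton] at hx
      rw [mem_filter]
      rcases hx with rfl | rfl
      · exact ⟨mem_univ _, alF _ ha, ca⟩
      · exact ⟨mem_univ _, alF _ hb, cb⟩
    have hE := eq_of_subset_of_card_le hsub (by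
      rw [card_pair hab, ← h9])
    have : t ∈ ({a, b} : Finset (Fin 5 × Fin 5 × Fin 5)) := by
      rw [hE]; exact mem_filter.2 ⟨mem_univ _, hal, hcp⟩
    simp only [mem_insert, mem_singleton] at this
    rcases this with rfl | rfl
    · exact ha
    · exact hb
  by_cases ex : ∃ i, (i, i + 1, i + 2) ∈ F
  · obtain ⟨i, hi⟩ := ex
    obtain ⟨p1, p2, p3, p4, p5, p6⟩ := dec8 i
    have q1 := cl _ hi _ p5 p1
    have q2 := cl _ q1 _ p6 p2
    exact f4 _ hi _ q2 ((by decide : ∀ i : Fin 5, cf3 (i, i + 1, i + 2) (i, i + 1, i + 3) = true) i)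
  · have : F.card ≤ (univ : Finset (Fin 5)).card := by
      apply card_le_card_of_injOn (fun t => t.1) (fun _ _ => mem_univ _)
      have key : ∀ t ∈ F, t = (t.1, t.1 + 3, t.1 + 1) := by
        intro t ht
        rcases dec7 t (alF t ht) with e | ⟨i, e | e⟩
        · exact e
        · exact absurd ⟨i, e ▸ ht⟩ ex
        · exact absurd ⟨i, cl t ht _ (dec8 i).2.2.2.1 e⟩ ex
      intro s hs t ht hst
      simp only at hst
      rw [key s hs, key t ht, hst]
    rw [f1, D.cZ] at this
    simp at this

lemma fls (D : C29 r N1 N2 N3 Z) : False := by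
  have h := D.h
  obtain ⟨e1, e2, e3, L⟩ := lab h D.c1 D.c2 D.c3 D.d12 D.d23 D.d13 (fun y hy => ex_of_one (D.n21 y hy)) 
    (fun y hy => ex_of_one (D.n23 y hy)) (fun y hy => (D.n12 y hy).le) (fun y hy => (D.n32 y hy).le)
  have ex : ∀ k, ∃ i, r (e3 k) (e1 i) := by
    intro k
    obtain ⟨w, hw, hr⟩ := ex_of_one (D.n31 _ (L.m3 k))
    obtain ⟨i, rfl⟩ := L.s1 w hw
    exact ⟨i, hr⟩
  choose π hπ using ex
  have inj : ∀ {i j}, π i = π j → i = j := by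
    intro i j hij
    have hj := hπ j
    rw [← hij] at hj
    exact L.i3 (dg_le_one (D.n13 _ (L.m1 (π i))).le (L.m3 i) (L.m3 j) (h.sy (hπ i)) (h.sy hj))
  have nf : ∀ k, π k ≠ k := by
    intro k hk
    have := hπ k
    rw [hk] at this
    exact h.c3 (L.a12 k) (L.a23 k) (h.sy this)
  have ni : ∀ {i j}, i ≠ j → π i ≠ π j := fun hij hh => hij (inj hh)
  have d := dec5 (π 0) (nf 0) (π 1) (nf 1) (ni (by decide)) (π 2) (nf 2) (ni (by decide)) (ni (by decide))
    (π 3) (nf 3) (ni (by decide)) (ni (by decide)) (ni (by decide)) (π 4) (nf 4) (ni (by decide)) (ni (by decide)) (ni (by decide)) (ni (by decide))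
  rw [← vec5 π] at d
  rcases d with ⟨-, d1, d2⟩ | ⟨d1, d2⟩
  · have ex : ∀ v : V, ∃ t : Fin 5 × Fin 5 × Fin 5, v ∈ Z → r v (e1 t.1) ∧ r v (e2 t.2.1) ∧ r v (e3 t.2.2) := by
      intro v
      by_cases hv : v ∈ Z
      · obtain ⟨a, ha, ra⟩ := ex_of_one (D.w1 v hv)
        obtain ⟨b, hb, rb⟩ := ex_of_one (D.w2 v hv)
        obtain ⟨c, hc, rc⟩ := ex_of_one (D.w3 v hv)
        obtain ⟨i, rfl⟩ := L.s1 a ha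
        obtain ⟨j, rfl⟩ := L.s2 b hb
        obtain ⟨k, rfl⟩ := L.s3 c hc
        exact ⟨(i, j, k), fun _ => ⟨ra, rb, rc⟩⟩
      · exact ⟨(0, 0, 0), fun hh => absurd hh hv⟩
    choose t ht using ex
    set I := Finset.univ.filter fun i => π (π i) = i with hI
    have s1 := sumI h (e := e1) (t := fun z => (t z).1) (Z := Z) I (fun z hz => (ht z hz).1) (fun z hz i hi => 
      L.i1 (dg_le_one (D.w1 z hz).le (L.m1 _) (L.m1 _) hi (ht z hz).1))
    have s2 := sumI h (e := e2) (t := fun z => (t z).2.1) (Z := Z) I (fun z hz => (ht z hz).2.1) (fun z hz i hi => 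
      L.i2 (dg_le_one (D.w2 z hz).le (L.m2 _) (L.m2 _) hi (ht z hz).2.1))
    have s3 := sumI h (e := e3) (t := fun z => (t z).2.2) (Z := Z) I (fun z hz => (ht z hz).2.2) (fun z hz i hi => 
      L.i3 (dg_le_one (D.w3 z hz).le (L.m3 _) (L.m3 _) hi (ht z hz).2.2))
    rw [sum_congr rfl fun i _ => D.y1 _ (L.m1 i)] at s1
    rw [sum_congr rfl fun i _ => D.y2 _ (L.m2 i)] at s2
    rw [sum_congr rfl fun i _ => D.y3 _ (L.m3 i)] at s3
    have s4 : ∑ z ∈ Z, (((if (t z).1 ∈ I then 1 else 0) + (if (t z).2.1 ∈ I then 1 else 0)) + (if (t z).2.2 ∈ I then 1 else 0)) = ∑ z ∈ Z, 1 := by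
      refine sum_congr rfl fun z hz => ?_
      obtain ⟨r1, r2, r3⟩ := ht z hz
      have := d1 (t z) (L.alw h (fun k _ => hπ k) (D.z1 z hz) (D.z2 z hz) (D.z3 z hz) (t z) r1 r2 r3)
      simp only [hI, mem_filter, mem_univ, true_and]
      convert this
    rw [sum_add_distrib, sum_add_distrib, ← s1, ← s2, ← s3] at s4
    simp only [sum_const, smul_eq_mul, D.cZ] at s4
    have : I.card = 2 := by rw [← d2, hI]
    omega
  · have L' : Lab r 5 N1 N2 N3 (fun i => e1 (itr π i)) (fun i => e2 (itr π i)) (fun i => e3 (itr π i)) := by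
      have i1 : ∀ {i j}, e1 (itr π i) = e1 (itr π j) → i = j := fun hh => d1 _ _ (L.i1 hh)
      have i2 : ∀ {i j}, e2 (itr π i) = e2 (itr π j) → i = j := fun hh => d1 _ _ (L.i2 hh)
      have i3 : ∀ {i j}, e3 (itr π i) = e3 (itr π j) → i = j := fun hh => d1 _ _ (L.i3 hh)
      exact ⟨fun i => L.m1 _, fun i => L.m2 _, fun i => L.m3 _, i1, i2, i3, surj_of_inj D.c1 (fun i => L.m1 _) i1, 
        surj_of_inj D.c2 (fun i => L.m2 _) i2, surj_of_inj D.c3 (fun i => L.m3 _) i3, fun _ _ => L.d12 _ _, fun _ _ => L.d23 _ _, 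
        fun _ _ => L.d13 _ _, fun _ => L.a12 _, fun _ => L.a23 _⟩
    refine D.five L' ?_
    intro k
    have := hπ (itr π k)
    rw [d2 k] at this
    exact this
end C29
end Q19

namespace Q19
open scoped Classical
open Finset
variable {V : Type} {r : V → V → Prop}

lemma dg_erase_eq (h : Good r) {S : Finset V} {v : V} : dg r (S.erase v) v = dg r S v := by
  unfold dg; congr 1; ext x; simp [mem_nb]; intro hx _; rintro rfl; exact h.ir hx

lemma S29_4 (h : Good r) {S : Finset V} (hS : S.card = 28) (hE : E2 r S = 138) {v : V} (hv : v ∉ S) (hd : dg r S v = 4) : False := by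
  have hmin : ∀ w ∈ S, 4 ≤ dg r S w := by
    intro w hw
    have := bd_min h bd27 hS hw
    omega
  obtain ⟨A, B, C, t⟩ := three_split (r := r) (S := S) (a := 4) (by
    intro w hw
    refine ⟨hmin w hw, ?_⟩
    have := ball_ge h hw hmin
    omega)
  have H : C28 r S A B C := ⟨h, t, hS, hE⟩
  have c0 := H.c0
  have cA := H.cA
  have C0 : C = ∅ := card_eq_zero.1 c0
  have key : ∀ y ∈ nb r S v, ∃ p ∈ A, y = p ∨ r y p := by
    intro y hy
    have hy' := mem_nb.1 hy
    rcases t.un hy'.1 with hA | hB | hC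
    · exact ⟨y, hA, Or.inl rfl⟩
    · have id := ident_S h hy'.1
      rw [t.sm, sum_dgS t.dA, sum_dgS t.dB, sum_dgS t.dC] at id
      have ds := t.ds y
      rw [t.dB hB] at ds
      have m3 : 3 ≤ (ms r S S y).card := by
        have : (nb r S v).erase y ⊆ ms r S S y := by
          intro x hx
          rw [mem_erase] at hx
          have hx' := mem_nb.1 hx.2
          exact removed_miss h hy'.2 hx'.2 hv hx'.1 hx.1.symm
        have := card_le_card this
        rw [card_erase_of_mem hy] at this
        unfold dg at hd
        omega
      have C0' : dg r C y = 0 := by rw [C0]; simp [dg, nb]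
      rw [hS] at id
      obtain ⟨p, hp, rp⟩ := dg_pos.1 (show 0 < dg r A y by omega)
      exact ⟨p, hp, Or.inr rp⟩
    · rw [C0] at hC; simp at hC
  have ex : ∀ y, ∃ p, y ∈ nb r S v → p ∈ A ∧ (y = p ∨ r y p) := by
    intro y
    by_cases hy : y ∈ nb r S v
    · obtain ⟨p, hp⟩ := key y hy
      exact ⟨p, fun _ => hp⟩
    · exact ⟨y, fun hh => absurd hh hy⟩
  choose f hf using ex
  obtain ⟨y, hy, y', hy', hne, hfe⟩ := exists_ne_map_eq_of_card_lt_of_maps_to (s := nb r S v) (t := A) (f := f)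
    (by unfold dg at hd; omega) (fun y hy => (hf y hy).1)
  have h1 := hf y hy
  have h2 := hf y' hy'
  rw [← hfe] at h2
  have ry := (mem_nb.1 hy).2
  have ry' := (mem_nb.1 hy').2
  rcases h1.2 with e | e <;> rcases h2.2 with e' | e'
  · exact hne (e.trans e'.symm)
  · rw [← e] at e'; exact h.c3 ry' e' ry
  · rw [← e'] at e; exact h.c3 ry e ry'
  · have := h.c4 ry ry' (h.sy e) (h.sy e') hne
    exact hv (this ▸ t.As h1.1)

lemma S29_3 (h : Good r) {S : Finset V} (hS : S.card = 28) (hE : E2 r S = 140) {v : V} (hv : v ∉ S) (hd : dg r S v = 3) : False := by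
  have hmin : ∀ w ∈ S, 5 ≤ dg r S w := by
    intro w hw
    have := bd_min h bd27 hS hw
    omega
  have reg : ∀ w ∈ S, dg r S w = 5 := by
    have : ∑ w ∈ S, 5 = ∑ w ∈ S, dg r S w := by
      change _ = E2 r S
      rw [hE]; simp [hS]
    intro w hw
    exact ((sum_eq_sum_iff_of_le hmin).1 this w hw).symm
  have msc : ∀ w ∈ S, (ms r S S w).card = 2 := by
    intro w hw
    have := ident_S h hw
    rw [nb_sum_const (c := 5) (fun x hx _ => reg x hx), reg w hw, hS] at this
    omega
  set X := nb r S v with hX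
  have cX : X.card = 3 := hd
  have XS : ∀ x ∈ X, x ∈ S := fun x hx => (mem_nb.1 hx).1
  have Xv : ∀ x ∈ X, r v x := fun x hx => (mem_nb.1 hx).2
  have msX : ∀ x ∈ X, ms r S S x = X.erase x := by
    intro x hx
    symm
    apply eq_of_subset_of_card_le
    · intro y hy
      rw [mem_erase] at hy
      exact removed_miss h (Xv x hx) (Xv y hy.2) hv (XS y hy.2) hy.1.symm
    · rw [msc x (XS x hx), card_erase_of_mem hx, cX]
  have XX : ∀ x ∈ X, ∀ y ∈ X, ¬ r x y := fun x hx y hy hh => h.c3 (Xv x hx) hh (Xv y hy)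
  have dj : ∀ x ∈ X, ∀ y ∈ X, x ≠ y → ∀ w ∈ nb r S x, w ∉ nb r S y := by
    intro x hx y hy hne w hw hw'
    rw [mem_nb] at hw hw'
    have := h.c4 (Xv x hx) (Xv y hy) (h.sy hw.2) (h.sy hw'.2) hne
    exact hv (this ▸ hw.1)
  have one : ∀ x ∈ X, ∀ z ∈ S, z ∉ X → ¬ r x z → dg r (nb r S x) z = 1 := by
    intro x hx z hz hzX hrz
    have zx : z ≠ x := by rintro rfl; exact hzX hx
    apply le_antisymm
    · by_contra hc
      obtain ⟨a, ha, b, hb, hab⟩ := one_lt_card.1 (show 1 < (nb r (nb r S x) z).card by change ¬ dg r _ _ ≤ 1 at hc; unfold dg at hc; omega)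
      rw [mem_nb, mem_nb] at ha hb
      exact zx (h.c4 ha.2 hb.2 ha.1.2 hb.1.2 hab)
    · have hm : z ∉ ms r S S x := by
        rw [msX x hx]; intro hh; exact hzX (mem_erase.1 hh).2
      rw [mem_ms] at hm
      push Not at hm
      obtain ⟨w, hw, h1, h2⟩ := hm hz zx hrz
      exact dg_pos.2 ⟨w, mem_nb.2 ⟨hw, h1⟩, h.sy h2⟩
  have zero : ∀ x ∈ X, ∀ z, r x z → dg r (nb r S x) z = 0 := by
    intro x hx z hz
    by_contra hc
    obtain ⟨w, hw, hr⟩ := dg_pos.1 (Nat.pos_of_ne_zero hc)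
    exact h.c3 hz hr (mem_nb.1 hw).2
  obtain ⟨x1, x2, x3, h12, h13, h23, hXe⟩ := card_eq_three.1 cX
  have m1 : x1 ∈ X := by rw [hXe]; simp
  have m2 : x2 ∈ X := by rw [hXe]; simp
  have m3 : x3 ∈ X := by rw [hXe]; simp
  set N1 := nb r S x1 with hN1
  set N2 := nb r S x2 with hN2
  set N3 := nb r S x3 with hN3
  set U := X ∪ (N1 ∪ (N2 ∪ N3)) with hU
  have US : U ⊆ S := by
    rw [hU]
    exact union_subset XS (union_subset (filter_subset _ _) (union_subset (filter_subset _ _) (filter_subset _ _)))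
  have NX : ∀ x ∈ X, ∀ w ∈ nb r S x, w ∉ X := fun x hx w hw hh => XX x hx w hh (mem_nb.1 hw).2
  have D23 : Disjoint N2 N3 := Finset.disjoint_left.2 fun w hw => dj _ m2 _ m3 h23 w hw
  have D1 : Disjoint N1 (N2 ∪ N3) := by
    rw [Finset.disjoint_left]; intro w hw hh
    rcases mem_union.1 hh with hh | hh
    · exact dj _ m1 _ m2 h12 w hw hh
    · exact dj _ m1 _ m3 h13 w hw hh
  have DX : Disjoint X (N1 ∪ (N2 ∪ N3)) := by
    rw [disjoint_right]; intro w hw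
    simp only [mem_union] at hw
    rcases hw with hw | hw | hw
    · exact NX _ m1 w hw
    · exact NX _ m2 w hw
    · exact NX _ m3 w hw
  have dgU : ∀ w, dg r U w = dg r X w + (dg r N1 w + (dg r N2 w + dg r N3 w)) := by
    intro w; rw [hU, dg_union DX, dg_union D1, dg_union D23]
  have c1 : N1.card = 5 := reg _ (XS _ m1)
  have c2 : N2.card = 5 := reg _ (XS _ m2)
  have c3 : N3.card = 5 := reg _ (XS _ m3)
  have cU : U.card = 18 := by
    rw [hU, card_union_of_disjoint DX, card_union_of_disjoint D1, card_union_of_disjoint D23]; omega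
  have dZ : ∀ w ∈ S, dg r (S \ U) w + dg r U w = 5 := by
    intro w hw; rw [dg_sdiff US, reg w hw]
  have mZ : ∀ z ∈ S \ U, z ∈ S ∧ z ∉ X ∧ z ∉ N1 ∧ z ∉ N2 ∧ z ∉ N3 := by
    intro z hz
    rw [mem_sdiff, hU] at hz
    simp only [mem_union, not_or] at hz
    exact ⟨hz.1, hz.2.1, hz.2.2.1, hz.2.2.2.1, hz.2.2.2.2⟩
  have nr : ∀ x z, z ∈ S → z ∉ nb r S x → ¬ r x z := fun x z hz hh hr => hh (mem_nb.2 ⟨hz, hr⟩)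
  have Xone : ∀ x ∈ X, ∀ w ∈ nb r S x, dg r X w = 1 := by
    intro x hx w hw
    apply le_antisymm
    · by_contra hc
      obtain ⟨a, ha, b, hb, hab⟩ := one_lt_card.1 (show 1 < (nb r X w).card by change ¬ dg r _ _ ≤ 1 at hc; unfold dg at hc; omega)
      rw [mem_nb] at ha hb
      have := h.c4 ha.2 hb.2 (Xv _ ha.1) (Xv _ hb.1) hab
      exact hv (this ▸ (mem_nb.1 hw).1)
    · exact dg_pos.2 ⟨x, hx, h.sy (mem_nb.1 hw).2⟩
  have cross : ∀ x ∈ X, ∀ y ∈ X, x ≠ y → ∀ w ∈ nb r S x, dg r (nb r S y) w = 1 := by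
    intro x hx y hy hne w hw
    exact one y hy w (mem_nb.1 hw).1 (NX x hx w hw) (nr _ _ (mem_nb.1 hw).1 (dj x hx y hy hne w hw))
  have w1 : ∀ z ∈ S \ U, dg r N1 z = 1 := fun z hz => by
    obtain ⟨a, b, c, d, e⟩ := mZ z hz
    exact one x1 m1 z a b (nr _ _ a c)
  have w2 : ∀ z ∈ S \ U, dg r N2 z = 1 := fun z hz => by
    obtain ⟨a, b, c, d, e⟩ := mZ z hz
    exact one x2 m2 z a b (nr _ _ a d)
  have w3 : ∀ z ∈ S \ U, dg r N3 z = 1 := fun z hz => by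
    obtain ⟨a, b, c, d, e⟩ := mZ z hz
    exact one x3 m3 z a b (nr _ _ a e)
  refine C29.fls (r := r) (N1 := N1) (N2 := N2) (N3 := N3) (Z := S \ U) ⟨h, c1, c2, c3, ?_, dj _ m1 _ m2 h12, dj _ m2 _ m3 h23, dj _ m1 _ m3 h13,
    fun z hz => (mZ z hz).2.2.1, fun z hz => (mZ z hz).2.2.2.1, fun z hz => (mZ z hz).2.2.2.2, 
    cross _ m1 _ m2 h12, cross _ m1 _ m3 h13, cross _ m2 _ m1 h12.symm, cross _ m2 _ m3 h23, cross _ m3 _ m1 h13.symm, cross _ m3 _ m2 h23.symm,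
    ?_, ?_, ?_, w1, w2, w3, ?_⟩
  · rw [card_sdiff_of_subset US, hS, cU]
  · intro w hw
    have q1 := dZ w (mem_nb.1 hw).1
    rw [dgU, Xone _ m1 w hw, cross _ m1 _ m2 h12 w hw, cross _ m1 _ m3 h13 w hw, zero _ m1 w (mem_nb.1 hw).2] at q1
    omega
  · intro w hw
    have q1 := dZ w (mem_nb.1 hw).1
    rw [dgU, Xone _ m2 w hw, cross _ m2 _ m1 h12.symm w hw, cross _ m2 _ m3 h23 w hw, zero _ m2 w (mem_nb.1 hw).2] at q1
    omega
  · intro w hw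
    have q1 := dZ w (mem_nb.1 hw).1
    rw [dgU, Xone _ m3 w hw, cross _ m3 _ m2 h23.symm w hw, cross _ m3 _ m1 h13.symm w hw, zero _ m3 w (mem_nb.1 hw).2] at q1
    omega
  · intro w hw
    obtain ⟨a, b, c, d, e⟩ := mZ w hw
    have q1 := dZ w a
    have x0 : dg r X w = 0 := by
      by_contra hc
      obtain ⟨x, hx, hr⟩ := dg_pos.1 (Nat.pos_of_ne_zero hc)
      have hx' := hx
      rw [hXe] at hx'
      simp only [mem_insert, mem_singleton] at hx'
      rcases hx' with rfl | rfl | rfl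
      · exact nr _ _ a c (h.sy hr)
      · exact nr _ _ a d (h.sy hr)
      · exact nr _ _ a e (h.sy hr)
    rw [dgU, x0, w1 w hw, w2 w hw, w3 w hw] at q1
    omega

lemma bd29 : bd V 29 72 := by
  apply bd_exact
  intro r h S hS hE
  have hd : ∀ w ∈ S, 5 ≤ dg r S w := by
    intro w hw
    have h1 := bd_min h bd28 hS hw
    by_contra hc
    have e1 := E2_erase h hw
    have c1 : (S.erase w).card = 28 := by rw [card_erase_of_mem hw, hS]
    have e2 := dg_erase_eq h (S := S) (v := w)
    have : dg r S w = 3 ∨ dg r S w = 4 := by omega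
    rcases this with e | e
    · exact S29_3 h c1 (by omega) (notMem_erase w S) (by omega)
    · exact S29_4 h c1 (by omega) (notMem_erase w S) (by omega)
  have : ∃ v ∈ S, 5 < dg r S v := by
    by_contra hc
    push Not at hc
    have : E2 r S ≤ ∑ v ∈ S, 5 := sum_le_sum hc
    simp [hS] at this
    omega
  obtain ⟨v, hv, hD⟩ := this
  have := ball_ge h hv hd
  omega
lemma bd30 : bd V 30 76 := bd_easy bd29 5 5 (by norm_num) (by norm_num) (by norm_num)
end Q19

namespace Q19
open scoped Classical
open Finset
variable {V : Type} {r : V → V → Prop}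

structure C31 (r : V → V → Prop) (T R : Finset V) : Prop where
  h : Good r
  cT : T.card = 7
  cR : R.card = 24
  dj : ∀ {x}, x ∈ T → x ∈ R → False
  tR : ∀ {t}, t ∈ T → dg r R t = 6
  tS : ∀ {t}, t ∈ T → ∑ w ∈ nb r R t, dg r T w = 12
  vR : ∀ {v}, v ∈ R → dg r R v + dg r T v = 5
  vS : ∀ {v}, v ∈ R → ∑ w ∈ nb r R v, dg r T w + dg r T v = 7
  cov : ∀ {v t}, v ∈ R → t ∈ T → r v t ∨ ∃ w ∈ R, r v w ∧ r w t
  s1 : ∑ v ∈ R, dg r T v = 42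
  s2 : ∑ v ∈ R, dg r T v * dg r T v = 84

lemma dg_eq_filter {R : Finset V} (p : V → Prop) [DecidablePred p] (v : V) : dg r (R.filter p) v = ∑ w ∈ nb r R v, if p w then 1 else 0 := by
  rw [← sum_filter, ← card_eq_sum_ones]
  unfold dg nb
  congr 1
  ext x; simp only [mem_filter]; tauto

namespace C31
variable {T R : Finset V}

lemma le4 (D : C31 r T R) {v : V} (hv : v ∈ R) : dg r T v ≤ 4 := by
  have h1 := D.vR hv
  have h2 := D.vS hv
  by_contra hc
  have : nb r R v = ∅ := by
    rw [← card_eq_zero]; change dg r R v = 0; omega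
  rw [this] at h2
  simp at h2
  omega

lemma qd (D : C31 r T R) : (R.filter fun v => dg r T v = 0).card + (R.filter fun v => dg r T v = 3).card + 3 * (R.filter fun v => dg r T v = 4).card = 3 := by
  have : ∑ v ∈ R, dg r T v * dg r T v + ∑ v ∈ R, 2 = 3 * ∑ v ∈ R, dg r T v + 
     (2 * ∑ v ∈ R, (if dg r T v = 0 then 1 else 0) + 2 * ∑ v ∈ R, (if dg r T v = 3 then 1 else 0) + 6 * ∑ v ∈ R, (if dg r T v = 4 then 1 else 0)) := by
    simp only [mul_sum]
    rw [← sum_add_distrib, ← sum_add_distrib, ← sum_add_distrib, ← sum_add_distrib]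
    refine sum_congr rfl fun v hv => ?_
    have := D.le4 hv
    interval_cases (dg r T v) <;> simp
  rw [D.s1, D.s2] at this
  simp only [sum_const, smul_eq_mul, D.cR] at this
  rw [card_filter, card_filter, card_filter]
  omega

lemma le3 (D : C31 r T R) {v : V} (hv : v ∈ R) : dg r T v ≤ 3 := by
  by_contra hc
  have h4 : dg r T v = 4 := by have := D.le4 hv; omega
  have h1 := D.vR hv
  have h2 := D.vS hv
  obtain ⟨w, hw, rw1, rw2⟩ := dg_one (show dg r R v = 1 by omega)
  have : nb r R v = {w} := by
    ext x; rw [mem_nb, mem_singleton]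
    exact ⟨fun hx => rw2 x hx.1 hx.2, fun hx => hx ▸ ⟨hw, rw1⟩⟩
  rw [this, sum_singleton] at h2
  have q := D.qd
  have p1 : 0 < (R.filter fun v => dg r T v = 4).card := card_pos.2 ⟨v, mem_filter.2 ⟨hv, h4⟩⟩
  have p2 : 0 < (R.filter fun v => dg r T v = 3).card := card_pos.2 ⟨w, mem_filter.2 ⟨hw, by omega⟩⟩
  omega

lemma n3 (D : C31 r T R) : (R.filter fun v => dg r T v = 3).card ≤ 3 := by
  have := D.qd
  omega

lemma bal (D : C31 r T R) {t : V} (ht : t ∈ T) : dg r (R.filter fun v => dg r T v = 3) t = dg r (R.filter fun v => dg r T v = 1) t := by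
  rw [dg_eq_filter, dg_eq_filter]
  have h1 := D.tS ht
  have h2 : ∑ w ∈ nb r R t, 1 = 6 := by rw [← card_eq_sum_ones]; exact D.tR ht
  have : ∑ w ∈ nb r R t, dg r T w + ∑ w ∈ nb r R t, (if dg r T w = 1 then 1 else 0) = 
     2 * ∑ w ∈ nb r R t, 1 + ∑ w ∈ nb r R t, (if dg r T w = 3 then 1 else 0) := by
    rw [mul_sum, ← sum_add_distrib, ← sum_add_distrib]
    refine sum_congr rfl fun w hw => ?_
    rw [mem_nb] at hw
    have := D.le3 hw.1
    have : 0 < dg r T w := dg_pos.2 ⟨t, ht, D.h.sy hw.2⟩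
    interval_cases (dg r T w) <;> simp
  omega

lemma ex3 (D : C31 r T R) : ∃ A ∈ R, dg r T A = 3 := by
  by_contra hc
  push Not at hc
  have n1 : ∀ v ∈ R, dg r T v ≠ 1 := by
    intro v hv h1
    obtain ⟨t, ht, rt⟩ := ex_of_one h1
    have hb := D.bal ht
    have : 0 < dg r (R.filter fun v => dg r T v = 1) t := dg_pos.2 ⟨v, mem_filter.2 ⟨hv, h1⟩, D.h.sy rt⟩
    rw [← hb] at this
    obtain ⟨A, hA, -⟩ := dg_pos.1 this
    rw [mem_filter] at hA
    exact hc A hA.1 hA.2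
  have ev : ∀ v ∈ R, dg r T v = 0 ∨ dg r T v = 2 := by
    intro v hv
    have := D.le3 hv
    have := n1 v hv
    have := hc v hv
    omega
  have : ∃ v ∈ R, dg r T v = 2 := by
    by_contra hn
    push Not at hn
    have : ∑ v ∈ R, dg r T v = 0 := sum_eq_zero fun v hv => by
      have := ev v hv
      have := hn v hv
      omega
    have := D.s1
    omega
  obtain ⟨v, hv, h2⟩ := this
  have hs := D.vS hv
  have : 2 ∣ ∑ w ∈ nb r R v, dg r T w := dvd_sum fun w hw => by
    rcases ev w (mem_nb.1 hw).1 with e | e <;> rw [e] <;> norm_num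
  omega

/-- two R-neighbours of a triple -/
lemma nb3 (D : C31 r T R) {A : V} (hA : A ∈ R) (h3 : dg r T A = 3) : ∃ P ∈ R, ∃ Q ∈ R, P ≠ Q ∧ r A P ∧ r A Q ∧ 
    (∀ x ∈ R, r A x → x = P ∨ x = Q) ∧ dg r T P + dg r T Q = 4 := by
  have h1 := D.vR hA
  have h2 := D.vS hA
  obtain ⟨P, hP, Q, hQ, hne, rP, rQ, hu, -⟩ := dg_two (show dg r R A = 2 by omega)
  have : nb r R A = {P, Q} := by
    ext x; rw [mem_nb, mem_insert, mem_singleton]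
    refine ⟨fun hx => hu x hx.1 hx.2, ?_⟩
    rintro (rfl | rfl)
    · exact ⟨hP, rP⟩
    · exact ⟨hQ, rQ⟩
  rw [this, sum_pair hne] at h2
  exact ⟨P, hP, Q, hQ, hne, rP, rQ, hu, by omega⟩

lemma no33 (D : C31 r T R) {A B : V} (hA : A ∈ R) (a3 : dg r T A = 3) (hB : B ∈ R) (b3 : dg r T B = 3) : ¬ r A B := by
  intro hAB
  have h := D.h
  have aux : ∀ {A B : V}, A ∈ R → dg r T A = 3 → B ∈ R → dg r T B = 3 → r A B → ∃ s ∈ R, s ≠ B ∧ r A s ∧ dg r T s = 1 ∧ 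
      ∀ x ∈ R, r A x → x = B ∨ x = s := by
    intro A B hA a3 hB b3 hAB
    obtain ⟨P, hP, Q, hQ, hne, rP, rQ, hu, hs⟩ := D.nb3 hA a3
    rcases hu B hB hAB with rfl | rfl
    · exact ⟨Q, hQ, hne.symm, rQ, by omega, hu⟩
    · exact ⟨P, hP, hne, rP, by omega, fun x hx hr => (hu x hx hr).symm⟩
  obtain ⟨s, hs, sB, rs, s1, -⟩ := aux hA a3 hB b3 hAB
  obtain ⟨s', hs', sA, rs', s1', us'⟩ := aux hB b3 hA a3 (h.sy hAB)
  obtain ⟨z, hz, rz⟩ := ex_of_one s1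
  have Az : ¬ r A z := fun hh => h.c3 rs rz hh
  have Bz : ¬ r B z := fun hh => D.dj hz ((h.c4 rs hAB (h.sy rz) (h.sy hh) sB) ▸ hA)
  have s'z : r s' z := by
    rcases D.cov hB hz with hh | ⟨w, hw, h1, h2⟩
    · exact absurd hh Bz
    · rcases us' w hw h1 with rfl | rfl
      · exact absurd h2 Az
      · exact h2
  have ss : s ≠ s' := by
    rintro rfl; exact h.c3 hAB rs' rs
  have two : 2 ≤ dg r (R.filter fun v => dg r T v = 1) z := by
    have : ({s, s'} : Finset V) ⊆ nb r (R.filter fun v => dg r T v = 1) z := by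
      intro x hx
      simp only [mem_insert, mem_singleton] at hx
      rw [mem_nb, mem_filter]
      rcases hx with rfl | rfl
      · exact ⟨⟨hs, s1⟩, h.sy rz⟩
      · exact ⟨⟨hs', s1'⟩, h.sy s'z⟩
    have := card_le_card this
    rwa [card_pair ss] at this
  rw [← D.bal hz] at two
  have AB : A ≠ B := h.ne hAB
  have : nb r (R.filter fun v => dg r T v = 3) z ∪ {A, B} ⊆ R.filter fun v => dg r T v = 3 := by
    apply union_subset (filter_subset _ _)
    intro x hx
    simp only [mem_insert, mem_singleton] at hx
    rw [mem_filter]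
    rcases hx with rfl | rfl
    · exact ⟨hA, a3⟩
    · exact ⟨hB, b3⟩
  have hc := card_le_card this
  rw [card_union_of_disjoint, card_pair AB] at hc
  · have := D.n3
    unfold dg at two
    unfold dg at this hc
    omega
  · rw [disjoint_right]
    intro x hx hh
    simp only [mem_insert, mem_singleton] at hx
    rw [mem_nb] at hh
    rcases hx with rfl | rfl
    · exact Az (h.sy hh.2)
    · exact Bz (h.sy hh.2)

lemma nb2 (D : C31 r T R) {A : V} (hA : A ∈ R) (h3 : dg r T A = 3) : ∃ P ∈ R, ∃ Q ∈ R, P ≠ Q ∧ r A P ∧ r A Q ∧ 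
    (∀ x ∈ R, r A x → x = P ∨ x = Q) ∧ dg r T P = 2 ∧ dg r T Q = 2 := by
  obtain ⟨P, hP, Q, hQ, hne, rP, rQ, hu, hs⟩ := D.nb3 hA h3
  have p3 : dg r T P ≠ 3 := fun e => D.no33 hA h3 hP e rP
  have q3 : dg r T Q ≠ 3 := fun e => D.no33 hA h3 hQ e rQ
  have := D.le3 hP
  have := D.le3 hQ
  exact ⟨P, hP, Q, hQ, hne, rP, rQ, hu, by omega, by omega⟩

lemma single (D : C31 r T R) {A P Q t : V} (hA : A ∈ R) (h3 : dg r T A = 3) (hP : P ∈ R) (hQ : Q ∈ R) (hne : P ≠ Q) (rP : r A P) (rQ : r A Q)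
    (p2 : dg r T P = 2) (q2 : dg r T Q = 2) (ht : t ∈ T) (rt : r Q t) : ∃ s ∈ R, dg r T s = 1 ∧ r P s ∧ r s t := by
  have h := D.h
  have h1 := D.vR hP
  have h2 := D.vS hP
  have mA : A ∈ nb r R P := mem_nb.2 ⟨hA, h.sy rP⟩
  have c2 : ((nb r R P).erase A).card = 2 := by
    rw [card_erase_of_mem mA]; unfold dg at h1 p2; omega
  rw [← add_sum_erase _ _ mA] at h2
  have cv : ∀ t ∈ T, r Q t → ∃ w ∈ (nb r R P).erase A, r w t := by
    intro t ht rt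
    rcases D.cov hP ht with hh | ⟨w, hw, w1, w2⟩
    · exact (D.dj ht ((h.c4 rP rQ (h.sy hh) (h.sy rt) hne) ▸ hA)).elim
    · refine ⟨w, mem_erase.2 ⟨?_, mem_nb.2 ⟨hw, w1⟩⟩, w2⟩
      rintro rfl
      exact h.c3 rQ rt w2
  obtain ⟨w, hw, wt⟩ := cv t ht rt
  have hw' := mem_erase.1 hw
  have hw2 := mem_nb.1 hw'.2
  rw [← add_sum_erase _ _ hw] at h2
  by_cases e : dg r T w = 1
  · exact ⟨w, hw2.1, e, hw2.2, wt⟩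
  · exfalso
    have wp : 0 < dg r T w := dg_pos.2 ⟨t, ht, wt⟩
    obtain ⟨a, ha, b, hb, hab, ra, rb, -⟩ := dg_two q2
    have all : ∀ t ∈ T, r Q t → r w t := by
      intro x hx rx
      obtain ⟨w', hw', wt'⟩ := cv x hx rx
      by_cases e' : w' = w
      · rw [← e']; exact wt'
      · have m : w' ∈ ((nb r R P).erase A).erase w := mem_erase.2 ⟨e', hw'⟩
        have hss := single_le_sum (f := fun x => dg r T x) (fun i _ => Nat.zero_le _) m
        have : 0 < dg r T w' := dg_pos.2 ⟨x, hx, wt'⟩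
        omega
    have := h.c4 (all a ha ra) (all b hb rb) ra rb hab
    subst this
    exact h.c3 rP hw2.2 rQ

lemma pt (D : C31 r T R) {A t : V} (hA : A ∈ R) (h3 : dg r T A = 3) (ht : t ∈ T) (hn : ¬ r A t) : ∃ P ∈ R, ∃ Q ∈ R, P ≠ Q ∧ r A P ∧ r A Q ∧ 
    (∀ x ∈ R, r A x → x = P ∨ x = Q) ∧ dg r T P = 2 ∧ dg r T Q = 2 ∧ r Q t := by
  obtain ⟨P, hP, Q, hQ, hne, rP, rQ, hu, p2, q2⟩ := D.nb2 hA h3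
  rcases D.cov hA ht with hh | ⟨w, hw, h1, h2⟩
  · exact absurd hh hn
  · rcases hu w hw h1 with rfl | rfl
    · exact ⟨Q, hQ, w, hP, hne.symm, rQ, rP, fun x hx hr => (hu x hx hr).symm, q2, p2, h2⟩
    · exact ⟨P, hP, w, hQ, hne, rP, rQ, hu, p2, q2, h2⟩

lemma meet (D : C31 r T R) {A B : V} (hA : A ∈ R) (a3 : dg r T A = 3) (hB : B ∈ R) (b3 : dg r T B = 3) : ∃ t ∈ T, r A t ∧ r B t := by
  by_contra hc
  push Not at hc
  have h := D.h
  obtain ⟨P, hP, Q, hQ, hne, rP, rQ, hu, p2, q2⟩ := D.nb2 hA a3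
  have : ∀ t, ∃ w, t ∈ nb r T B → w ∈ ({P, Q} : Finset V) ∧ r w t := by
    intro t
    by_cases ht : t ∈ nb r T B
    · rw [mem_nb] at ht
      rcases D.cov hA ht.1 with hh | ⟨w, hw, h1, h2⟩
      · exact absurd ht.2 (hc t ht.1 hh)
      · exact ⟨w, fun _ => ⟨by simpa using hu w hw h1, h2⟩⟩
    · exact ⟨t, fun hh => absurd hh ht⟩
  choose f hf using this
  obtain ⟨x, hx, y, hy, hxy, e⟩ := exists_ne_map_eq_of_card_lt_of_maps_to (s := nb r T B) (t := ({P, Q} : Finset V)) (f := f)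
    (by rw [card_pair hne]; unfold dg at b3; omega) (fun y hy => (hf y hy).1)
  have h1 := hf x hx
  have h2 := hf y hy
  rw [← e] at h2
  have := h.c4 (mem_nb.1 hx).2 (mem_nb.1 hy).2 h1.2 h2.2 hxy
  have h3 := h1.1
  rw [← this] at h3
  simp only [mem_insert, mem_singleton] at h3
  rcases h3 with rfl | rfl <;> omega

lemma sixpt (D : C31 r T R) {A B : V} (hA : A ∈ R) (a3 : dg r T A = 3) {t t' : V} (b3 : dg r T B = 3) (tT : t ∈ T) (tT' : t' ∈ T) (tt : t ≠ t')
    (Bt : r B t) (Bt' : r B t') (At' : ¬ r A t') (At : ¬ r A t) : ∃ P ∈ R, ∃ s ∈ R, r A P ∧ r P t ∧ dg r T s = 1 ∧ r P s ∧ r s t' := by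
  have h := D.h
  obtain ⟨P, hP, Q, hQ, hne, rP, rQ, hu, p2, q2, Qt⟩ := D.pt hA a3 tT' At'
  obtain ⟨s, hs, s1, Ps, st⟩ := D.single hA a3 hP hQ hne rP rQ p2 q2 tT' Qt
  refine ⟨P, hP, s, hs, rP, ?_, s1, Ps, st⟩
  rcases D.cov hA tT with hh | ⟨w, hw, h1, h2⟩
  · exact absurd hh At
  · rcases hu w hw h1 with rfl | rfl
    · exact h2
    · have := h.c4 Bt Bt' h2 Qt tt
      subst this
      omega

lemma fls (D : C31 r T R) : False := by
  have h := D.h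
  obtain ⟨A, hA, a3⟩ := D.ex3
  set Th := R.filter fun v => dg r T v = 3 with hTh
  have mT : ∀ {x}, x ∈ Th ↔ x ∈ R ∧ dg r T x = 3 := by simp [hTh]
  have cvT : ∀ t ∈ T, ∃ B ∈ Th, r B t := by
    intro t ht
    by_cases hn : r A t
    · exact ⟨A, mT.2 ⟨hA, a3⟩, hn⟩
    · obtain ⟨P, hP, Q, hQ, hne, rP, rQ, hu, p2, q2, Qt⟩ := D.pt hA a3 ht hn
      obtain ⟨s, hs, s1, Ps, st⟩ := D.single hA a3 hP hQ hne rP rQ p2 q2 ht Qt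
      have : 0 < dg r (R.filter fun v => dg r T v = 1) t := dg_pos.2 ⟨s, mem_filter.2 ⟨hs, s1⟩, h.sy st⟩
      rw [← D.bal ht] at this
      obtain ⟨B, hB, rB⟩ := dg_pos.1 this
      exact ⟨B, hB, h.sy rB⟩
  have c3 : Th.card = 3 := by
    have h1 := D.n3
    rw [← hTh] at h1
    have h2 : ∑ t ∈ T, 1 ≤ ∑ t ∈ T, dg r Th t := sum_le_sum fun t ht => by
      obtain ⟨B, hB, rB⟩ := cvT t ht
      exact dg_pos.2 ⟨B, hB, h.sy rB⟩
    rw [sum_dg_comm h, sum_congr rfl fun x hx => (mT.1 hx).2] at h2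
    simp only [sum_const, smul_eq_mul, D.cT] at h2
    omega
  obtain ⟨A, B, C, hAB, hAC, hBC, hE⟩ := card_eq_three.1 c3
  have mA := mT.1 (show A ∈ Th by rw [hE]; simp)
  have mB := mT.1 (show B ∈ Th by rw [hE]; simp)
  have mC := mT.1 (show C ∈ Th by rw [hE]; simp)
  obtain ⟨p, hp, Ap, Bp⟩ := D.meet mA.1 mA.2 mB.1 mB.2
  obtain ⟨q, hq, Bq, Cq⟩ := D.meet mB.1 mB.2 mC.1 mC.2
  obtain ⟨s, hs, As, Cs⟩ := D.meet mA.1 mA.2 mC.1 mC.2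
  have pq : p = q := by
    by_contra hne
    have sq : s ≠ q := by
      rintro rfl
      exact hAB (h.c4 Ap As Bp Bq hne)
    have sub : T ⊆ nb r T A ∪ ((nb r T B).erase p ∪ ((nb r T C).erase q).erase s) := by
      intro t ht
      simp only [mem_union, mem_erase, mem_nb]
      obtain ⟨X, hX, rX⟩ := cvT t ht
      rw [hE] at hX
      simp only [mem_insert, mem_singleton] at hX
      by_cases ep : t = p
      · subst ep; exact Or.inl ⟨ht, Ap⟩
      by_cases es : t = s
      · subst es; exact Or.inl ⟨ht, As⟩
      by_cases eq : t = q
      · subst eq; exact Or.inr (Or.inl ⟨ep, ht, Bq⟩)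
      rcases hX with rfl | rfl | rfl
      · exact Or.inl ⟨ht, rX⟩
      · exact Or.inr (Or.inl ⟨ep, ht, rX⟩)
      · exact Or.inr (Or.inr ⟨es, eq, ht, rX⟩)
    have c := card_le_card sub
    have u1 := card_union_le (nb r T A) ((nb r T B).erase p ∪ ((nb r T C).erase q).erase s)
    have u2 := card_union_le ((nb r T B).erase p) (((nb r T C).erase q).erase s)
    rw [card_erase_of_mem (mem_nb.2 ⟨hp, Bp⟩)] at u2
    rw [card_erase_of_mem (mem_erase.2 ⟨sq, mem_nb.2 ⟨hs, Cs⟩⟩), card_erase_of_mem (mem_nb.2 ⟨hq, Cq⟩)] at u2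
    have := mA.2; have := mB.2; have := mC.2; have := D.cT
    unfold dg at *
    omega
  subst pq
  have c2 : ((nb r T B).erase p).card = 2 := by
    rw [card_erase_of_mem (mem_nb.2 ⟨hp, Bp⟩)]
    have := mB.2
    unfold dg at this
    omega
  obtain ⟨t, t', tt, hb⟩ := card_eq_two.1 c2
  have ht : t ∈ (nb r T B).erase p := by rw [hb]; simp
  have ht' : t' ∈ (nb r T B).erase p := by rw [hb]; simp
  rw [mem_erase, mem_nb] at ht ht'
  have nA : ∀ x, x ≠ p → r B x → ¬ r A x := fun x hx hBx hAx => hAB (h.c4 Ap hAx Bp hBx hx.symm)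
  have nC : ∀ x, x ≠ p → r B x → ¬ r C x := fun x hx hBx hCx => hBC (h.c4 Bp hBx Cq hCx hx.symm)
  obtain ⟨P, hP, s, hs', rAP, Pt, s1, Ps, st⟩ := D.sixpt mA.1 mA.2 mB.2 ht.2.1 ht'.2.1 tt ht.2.2 ht'.2.2 (nA _ ht'.1 ht'.2.2) (nA _ ht.1 ht.2.2)
  obtain ⟨P', hP', s', hs'', rCP, Pt', s1', Ps', st'⟩ := D.sixpt mC.1 mC.2 mB.2 ht.2.1 ht'.2.1 tt ht.2.2 ht'.2.2 (nC _ ht'.1 ht'.2.2) (nC _ ht.1 ht.2.2)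
  have one : dg r Th t' ≤ 1 := by
    apply card_le_one.2
    have : ∀ x ∈ nb r Th t', x = B := by
      intro x hx
      rw [mem_nb, hE] at hx
      simp only [mem_insert, mem_singleton] at hx
      rcases hx.1 with rfl | rfl | rfl
      · exact absurd (h.sy hx.2) (nA _ ht'.1 ht'.2.2)
      · rfl
      · exact absurd (h.sy hx.2) (nC _ ht'.1 ht'.2.2)
    intro x hx y hy
    rw [this x hx, this y hy]
  rw [hTh, D.bal ht'.2.1] at one
  have ss : s = s' := dg_le_one one (mem_filter.2 ⟨hs', s1⟩) (mem_filter.2 ⟨hs'', s1'⟩) (h.sy st) (h.sy st')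
  subst ss
  have PP : P = P' := h.c4 Pt Ps Pt' Ps' (by rintro rfl; exact D.dj ht.2.1 hs')
  subst PP
  exact hAC (h.c4 Ap rAP Cq rCP (by rintro rfl; exact D.dj hp hP))
end C31

lemma bd31 : bd V 31 80 := by
  apply bd_exact
  intro r h S hS hE
  have hd : ∀ w ∈ S, 5 ≤ dg r S w := by
    intro w hw
    have := bd_min h bd30 hS hw
    omega
  obtain ⟨T, R, t⟩ := two_split h (S := S) (a := 5) (by
    intro w hw
    refine ⟨hd w hw, ?_⟩
    have := ball_ge h hw hd
    omega)
  have cT := t.cT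
  rw [hE, hS] at cT
  have cd := t.cd
  rw [hS] at cd
  have T0 : ∀ {x}, x ∈ T → dg r T x = 0 ∧ (ms r S S x).card = 0 := by
    intro x hx
    have := t.eT hx
    omega
  have mT0 : ∀ {x}, x ∈ S → (ms r S T x).card = 0 := by
    intro x hx
    rw [card_eq_zero, eq_empty_iff_forall_notMem]
    intro y hy
    have := ms_symm h hy (Y := S) hx
    have e := (T0 (mem_ms.1 hy).1).2
    rw [card_eq_zero] at e
    rw [e] at this
    simp at this
  have sT : ∀ x, ∑ w ∈ nb r T x, dg r T w = 0 := fun x => sum_eq_zero fun w hw => (T0 (mem_nb.1 hw).1).1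
  have sT' : ∑ w ∈ T, dg r T w = 0 := sum_eq_zero fun w hw => (T0 hw).1
  refine C31.fls (r := r) (T := T) (R := R) ⟨h, by omega, by omega, t.dj, ?_, ?_, ?_, ?_, ?_, ?_, ?_⟩
  · intro x hx
    have := t.ds x
    rw [t.dT hx, (T0 hx).1] at this
    omega
  · intro x hx
    have := t.iT hx
    rw [sT, (T0 hx).1, mT0 (t.Ts hx)] at this
    omega
  · intro x hx
    have := t.ds x
    rw [t.dR hx] at this
    omega
  · intro x hx
    have := t.iR hx
    rw [sT, mT0 (t.Rs hx)] at this
    omega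
  · intro v x hv hx
    rcases dist2' (mT0 (t.Rs hv)) hx (by rintro rfl; exact t.dj hx hv) with e | ⟨w, hw, h1, h2⟩
    · exact Or.inl e
    · rcases t.un hw with hw' | hw'
      · have := (T0 hw').1
        have : 0 < dg r T w := dg_pos.2 ⟨x, hx, h2⟩
        omega
      · exact Or.inr ⟨w, hw', h1, h2⟩
  · have := t.sc
    omega
  · have := t.sq
    have e1 : ∑ w ∈ T, dg r T w * dg r T w = 0 := sum_eq_zero fun w hw => by rw [(T0 hw).1, zero_mul]
    have e2 : ∑ w ∈ T, (ms r S T w).card = 0 := sum_eq_zero fun w hw => mT0 (t.Ts hw)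
    rw [e1, e2, sT'] at this
    have : T.card = 7 := by omega
    simp only [this] at *
    omega
end Q19

namespace Q19
open scoped Classical
open Finset

lemma final {V : Type} {r : V → V → Prop} (h : Good r) (S : Finset V) (hS : S.card = 32) (hE : E2 r S = 170) :
    (∀ v ∈ S, 5 ≤ dg r S v) ∧ ∃ x ∈ S, dg r S x = 6 ∧ ∃ w ∈ S, r x w ∧ dg r S w = 6 := by
  have hd : ∀ w ∈ S, 5 ≤ dg r S w := by
    intro w hw
    have := bd_min h bd31 hS hw
    omega
  refine ⟨hd, ?_⟩
  obtain ⟨T, R, t⟩ := two_split h (S := S) (a := 5) (by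
    intro w hw
    refine ⟨hd w hw, ?_⟩
    have := ball_ge h hw hd
    omega)
  have cT := t.cT
  rw [hE, hS] at cT
  have cd := t.cd
  rw [hS] at cd
  by_contra hc
  push Not at hc
  have T0 : ∀ x ∈ T, dg r T x = 0 := by
    intro x hx
    by_contra hne
    obtain ⟨w, hw, hr⟩ := dg_pos.1 (Nat.pos_of_ne_zero hne)
    exact hc x (t.Ts hx) (t.dT hx) w (t.Ts hw) hr (t.dT hw)
  have e0 : ∑ w ∈ T, dg r T w = 0 := sum_eq_zero T0
  have e1 : ∑ w ∈ T, dg r T w * dg r T w = 0 := sum_eq_zero fun w hw => by rw [T0 w hw, zero_mul]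
  have sc := t.sc
  have sq := t.sq
  have T10 : T.card = 10 := by omega
  have R22 : R.card = 22 := by omega
  rw [e0, e1, T10] at sq
  rw [e0, T10] at sc
  have := convex R (fun w => dg r T w) 2
  rw [R22] at this
  omega

lemma good_of_girth {V : Type} (G : SimpleGraph V) (hg : GirthAtLeast5 G) : Good G.Adj where
  sy := fun h => h.symm
  ir := fun h => G.loopless.irrefl _ h
  c3 := by
    intro a b c h1 h2 h3
    have w : (Walk.cons h1 (Walk.cons h2 (Walk.cons h3.symm Walk.nil))).IsCycle := by
      rw [Walk.cons_isCycle_iff]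
      have := h1.ne; have := h2.ne; have := h3.ne
      simp_all [Walk.cons_isPath_iff, ne_comm, eq_comm]
    have := hg _ w
    simp at this
  c4 := by
    intro a b c d h1 h2 h3 h4 hac
    by_contra hbd
    have w : (Walk.cons h1 (Walk.cons h3.symm (Walk.cons h4 (Walk.cons h2.symm Walk.nil)))).IsCycle := by
      rw [Walk.cons_isCycle_iff]
      have := h1.ne; have := h2.ne; have := h3.ne; have := h4.ne
      simp_all [Walk.cons_isPath_iff, ne_comm, eq_comm]
    have := hg _ w
    simp at this

lemma degree_eq {n : ℕ} (G : SimpleGraph (Fin n)) [DecidableRel G.Adj] (v : Fin n) : dg G.Adj univ v = G.degree v := by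
  unfold dg nb SimpleGraph.degree
  congr 1
  ext x
  simp
end Q19

theorem stmt19 (G : SimpleGraph (Fin 32)) [DecidableRel G.Adj]
    (hg : GirthAtLeast5 G) (he : G.edgeFinset.card = 85) :
    HasEmbeddedStar G 6 ![5, 4, 4, 4, 4, 4] := by
  have h := Q19.good_of_girth G hg
  have hE : Q19.E2 G.Adj Finset.univ = 170 := by
    unfold Q19.E2
    rw [Finset.sum_congr rfl fun v _ => Q19.degree_eq G v, G.sum_degrees_eq_twice_card_edges, he]
  obtain ⟨hd, x, -, hx, w, -, hr, hw⟩ := Q19.final h Finset.univ (by simp) hE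
  have hd' : ∀ v, 5 ≤ G.degree v := fun v => by
    have := hd v (Finset.mem_univ v)
    rwa [Q19.degree_eq] at this
  rw [Q19.degree_eq] at hx hw
  have mw : w ∈ G.neighborFinset x := by simpa using hr
  have c5 : ((G.neighborFinset x).erase w).card = 5 := by
    rw [Finset.card_erase_of_mem mw, G.card_neighborFinset_eq_degree, hx]
  let E := Finset.equivFinOfCardEq c5
  have mE : ∀ i, ((E.symm i : Fin 32)) ≠ w ∧ G.Adj x (E.symm i : Fin 32) := by
    intro i
    have := (E.symm i).2
    rw [Finset.mem_erase, G.mem_neighborFinset] at this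
    exact this
  refine ⟨x, Fin.cons w (fun i => (E.symm i : Fin 32)), hx, ?_, ?_, ?_⟩
  · rw [Fin.cons_injective_iff]
    refine ⟨?_, fun i j hij => E.symm.injective (Subtype.ext hij)⟩
    rintro ⟨i, hi⟩
    exact (mE i).1 hi
  · intro i
    refine Fin.cases ?_ (fun j => ?_) i
    · simpa using hr
    · simpa using (mE j).2
  · intro i
    refine Fin.cases ?_ (fun j => ?_) i
    · change 5 + 1 ≤ G.degree w
      omega
    · rw [Fin.cons_succ]
      have h4 : (![5, 4, 4, 4, 4, 4] : Fin 6 → ℕ) j.succ = 4 := by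
        fin_cases j <;> rfl
      rw [h4]
      exact hd' _
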